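/- Let ν ∈ [0,1/2], let I ⊂ ℝ be a compact interval, and let K ≥ 10 satisfy 10K|I| ≤ 1. Let a ∈ C_c^∞(ℝ²) with supp a ⊂ {(x,ξ) : x ∈ interior(I), |ξ| < 2K}. Let ψ_I ∈ C_c^∞(interior(I)) equal 1 on a neighborhood of the projection of supp a to the x-axis, and let ω_I ∈ C^∞(ℝ) vanish on a neighborhood of I and equal 1 outside I + [−1/(10K), 1/(10K)]. Then there exist C' > 0, constants C_N for each N ∈ ℕ, and a family of bounded linear operators Q_h : L²(ℝ, dx) → L²(ℝ, dP) for h ∈ (0,1] with operator norm ‖Q_h‖ ≤ C', such that for every h ∈ (0,1], with s := 1/2 − ν + i/h, and every u ∈ L²(ℝ, dx): ‖Op_h(a)u − ψ_I · B(s)(ω_I · Q_h u)‖_{L²(ℝ,dx)} ≤ C_N h^N ‖u‖_{L²(ℝ,dx)}. -/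

import Mathlib

open Complex MeasureTheory Metric Set
open scoped Real

noncomputable section


/-- `⟨x⟩ = √(1+x²)`. -/
def jap (x : ℝ) : ℝ := Real.sqrt (1 + x ^ 2)

/-- `|x−y|_S = 2|x−y|/(⟨x⟩⟨y⟩)`: the chordal (circle) distance on `ℝ ≃ S¹ ∖ {pt}`. -/
def dS (x y : ℝ) : ℝ := 2 * |x - y| / (jap x * jap y)

/-- The measure `dP(x) = 2⟨x⟩⁻² dx` on `ℝ`. -/
def muP : Measure ℝ := (volume : Measure ℝ).withDensity fun x => ENNReal.ofReal (2 / (1 + x ^ 2))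

/-- `t^w := exp(w log t)` for real `t` and complex `w` (junk value `exp 0 = 1` at `t = 0`). -/
def cpowR (t : ℝ) (w : ℂ) : ℂ := Complex.exp (w * Real.log t)

/-- The operator `B(s)`: `(B(s)f)(x) = |Im s/(2π)|^{1/2} ∫ |x−x'|_S^{−2s} f(x') dP(x')`
(with the junk value `0` when the integral does not converge absolutely). -/
def Bop (s : ℂ) (f : ℝ → ℂ) (x : ℝ) : ℂ :=
  ((Real.sqrt (|s.im| / (2 * π)) : ℝ) : ℂ) * ∫ y, cpowR (dS x y) (-2 * s) * f y ∂muP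

/-- `|γ'(x)|` for the real Möbius transformation of `g` (junk at the pole). -/
def dMobR (g : Matrix.SpecialLinearGroup (Fin 2) ℝ) (x : ℝ) : ℝ := ((g.1 1 0 * x + g.1 1 1)⁻¹) ^ 2


/-- The semiclassical quantization
`(Op_h(a)u)(x) = (2πh)^{−1} ∬ e^{i(x−y)ξ/h} a(x,ξ) u(y) dy dξ`
(as an iterated integral, performing the `ξ`-integration first). -/
def Oph (h : ℝ) (a : ℝ × ℝ → ℂ) (u : ℝ → ℂ) (x : ℝ) : ℂ :=
  (((2 * π * h)⁻¹ : ℝ) : ℂ) *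
    ∫ y : ℝ, (∫ ξ : ℝ, Complex.exp (I * ((x - y) * ξ) / h) * a (x, ξ)) * u y

section Parametrix

open scoped ContDiff Topology FourierTransform SchwartzMap
open Filter

theorem ContDiffAt.mul_of_mem_tsupport {E : Type*} [NormedAddCommGroup E] [NormedSpace ℝ E]
    {f k : E → ℂ} {p : E} (hf : ContDiffAt ℝ ∞ f p)
    (hk : p ∈ tsupport f → ContDiffAt ℝ ∞ k p) : ContDiffAt ℝ ∞ (fun q => f q * k q) p := by
  by_cases hp : p ∈ tsupport f
  · exact hf.mul (hk hp)
  · have h0 : f =ᶠ[𝓝 p] 0 := notMem_tsupport_iff_eventuallyEq.mp hp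
    refine (contDiffAt_const (c := (0 : ℂ))).congr_of_eventuallyEq ?_
    filter_upwards [h0] with q hq
    simp [hq]

/-- The transpose of the vector field `g⁻¹ ∂₁` (up to sign). -/
def nonstatStep {E : Type*} [NormedAddCommGroup E] [NormedSpace ℝ E]
    (g : ℝ × E → ℝ) (b : ℝ × E → ℂ) (p : ℝ × E) : ℂ :=
  -(fderiv ℝ (fun q => b q * ((g q)⁻¹ : ℝ)) p (1, 0))

theorem tsupport_nonstatStep {E : Type*} [NormedAddCommGroup E] [NormedSpace ℝ E]
    (g : ℝ × E → ℝ) (b : ℝ × E → ℂ) : tsupport (nonstatStep g b) ⊆ tsupport b := by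
  intro p hp
  by_contra hn
  have h0 : b =ᶠ[𝓝 p] 0 := notMem_tsupport_iff_eventuallyEq.mp hn
  have h1 : (fun q => b q * ((g q)⁻¹ : ℝ)) =ᶠ[𝓝 p] fun _ => (0 : ℂ) := by
    filter_upwards [h0] with q hq
    simp [hq]
  refine (notMem_tsupport_iff_eventuallyEq.mpr ?_) hp
  filter_upwards [h1.fderiv (𝕜 := ℝ)] with q hq
  simp only [nonstatStep]
  rw [hq]
  simp

theorem integral_nonstatStep {E : Type*} [NormedAddCommGroup E] [NormedSpace ℝ E]
    {A B : ℝ} {b : ℝ × E → ℂ} {g : ℝ × E → ℝ} {θ : E}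
    (hb : ∀ x, ContDiffAt ℝ ∞ b (x, θ))
    (hbs : ∀ x, (x, θ) ∈ tsupport b → x ∈ Icc A B)
    (hg : ∀ x, (x, θ) ∈ tsupport b → ContDiffAt ℝ ∞ g (x, θ) ∧ g (x, θ) ≠ 0)
    {l : ℝ} (hl : l ≠ 0) {e : ℝ → ℂ}
    (he : ∀ x, (x, θ) ∈ tsupport b → HasDerivAt e (I * l * g (x, θ) * e x) x) :
    ∫ x, e x * b (x, θ) = (I * l)⁻¹ * ∫ x, e x * nonstatStep g b (x, θ) := by
  have hq : ∀ x, ContDiffAt ℝ ∞ (fun q => b q * ((g q)⁻¹ : ℝ)) (x, θ) := fun x =>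
    (hb x).mul_of_mem_tsupport fun hx =>
      ofRealCLM.contDiff.contDiffAt.comp _ ((hg x hx).1.inv (hg x hx).2)
  have hqs : ∀ x, ContDiffAt ℝ ∞ (nonstatStep g b) (x, θ) := fun x =>
    (((hq x).fderiv_right (m := ∞) (by simp)).clm_apply contDiffAt_const).neg
  have hpair : ∀ x : ℝ, HasDerivAt (fun t : ℝ => (t, θ)) ((1 : ℝ), (0 : E)) x := fun x =>
    (hasDerivAt_id x).prodMk (hasDerivAt_const x θ)
  have hqd : ∀ x, HasDerivAt (fun t : ℝ => b (t, θ) * ((g (t, θ))⁻¹ : ℝ))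
      (-nonstatStep g b (x, θ)) x := fun x => by
    have h1 := ((hq x).differentiableAt (by simp)).hasFDerivAt.comp_hasDerivAt x (hpair x)
    simpa [nonstatStep, Function.comp_def] using h1
  have hcs : ∀ x, x ∉ Icc A B → ∀ᶠ t in 𝓝 x, b (t, θ) = 0 := fun x hx => by
    have h0 : b =ᶠ[𝓝 (x, θ)] 0 :=
      notMem_tsupport_iff_eventuallyEq.mp fun h => hx (hbs x h)
    exact (hpair x).continuousAt.eventually h0
  have hcs0 : ∀ x, (x, θ) ∉ tsupport b → ∀ᶠ t in 𝓝 x, b (t, θ) = 0 := fun x hx =>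
    (hpair x).continuousAt.eventually (notMem_tsupport_iff_eventuallyEq.mp hx)
  have hF : ∀ x, HasDerivAt (fun t => e t * (b (t, θ) * ((g (t, θ))⁻¹ : ℝ)))
      (I * l * (e x * b (x, θ)) - e x * nonstatStep g b (x, θ)) x := fun x => by
    by_cases hx : (x, θ) ∈ tsupport b
    · have h1 := (he x hx).mul (hqd x)
      refine h1.congr_deriv ?_
      have h2 : (g (x, θ) : ℂ) ≠ 0 := by exact_mod_cast (hg x hx).2
      push_cast
      field_simp
      ring
    · have h2 : b (x, θ) = 0 := (hcs0 x hx).self_of_nhds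
      have h3 : nonstatStep g b (x, θ) = 0 :=
        image_eq_zero_of_notMem_tsupport fun h => hx (tsupport_nonstatStep g b h)
      rw [h2, h3]
      simp only [mul_zero, sub_zero]
      refine (hasDerivAt_const x (0 : ℂ)).congr_of_eventuallyEq ?_
      filter_upwards [hcs0 x hx] with t ht
      simp [ht]
  have hcont : ∀ c : ℝ × E → ℂ, tsupport c ⊆ tsupport b → (∀ x, ContDiffAt ℝ ∞ c (x, θ)) →
      Integrable fun x => e x * c (x, θ) := by
    intro c hc1 hc2
    refine Continuous.integrable_of_hasCompactSupport ?_ ?_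
    · refine continuous_iff_continuousAt.mpr fun x => ?_
      by_cases hx : (x, θ) ∈ tsupport b
      · exact (he x hx).continuousAt.mul
          (ContinuousAt.comp (f := fun t : ℝ => (t, θ)) (hc2 x).continuousAt (hpair x).continuousAt)
      · have h0 : c =ᶠ[𝓝 (x, θ)] 0 :=
          notMem_tsupport_iff_eventuallyEq.mp fun h => hx (hc1 h)
        refine (continuousAt_const (y := (0 : ℂ))).congr ?_
        filter_upwards [(hpair x).continuousAt.eventually h0] with t ht
        simp only [Pi.zero_apply] at ht
        simp [ht]
    · refine HasCompactSupport.intro (isCompact_Icc (a := A) (b := B)) fun x hx => ?_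
      rw [image_eq_zero_of_notMem_tsupport (f := c) fun h => hx (hbs x (hc1 h)), mul_zero]
  have i1 := hcont b subset_rfl hb
  have i2 := hcont _ (tsupport_nonstatStep g b) hqs
  have i3 := hcont (fun q => b q * ((g q)⁻¹ : ℝ)) (tsupport_mul_subset_left) hq
  have h0 := integral_eq_zero_of_hasDerivAt_of_integrable hF ((i1.const_mul _).sub i2) i3
  rw [integral_sub (i1.const_mul _) i2, integral_const_mul] at h0
  have hl' : (I * l : ℂ) ≠ 0 := mul_ne_zero I_ne_zero (by exact_mod_cast hl)
  rw [← sub_eq_zero.mp h0, inv_mul_cancel_left₀ hl']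

/-- Nonstationary phase with parameters: an oscillating factor `e` with `e' = iλ g e`, where `g`
does not vanish on the support of the amplitude, yields rapid decay in `λ`, uniformly in
parameters from a compact set. -/
theorem nonstationary_phase {E : Type*} [NormedAddCommGroup E] [NormedSpace ℝ E]
    {Θ : Set E} (hΘ : IsCompact Θ) {A B : ℝ} {g : ℝ × E → ℝ} (N : ℕ) :
    ∀ b : ℝ × E → ℂ,
    (∀ p : ℝ × E, p.2 ∈ Θ → ContDiffAt ℝ ∞ b p) →
    (∀ p : ℝ × E, p.2 ∈ Θ → p ∈ tsupport b → p.1 ∈ Icc A B) →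
    (∀ p : ℝ × E, p.2 ∈ Θ → p ∈ tsupport b → ContDiffAt ℝ ∞ g p ∧ g p ≠ 0) →
    ∃ C : ℝ, 0 ≤ C ∧ ∀ θ ∈ Θ, ∀ l : ℝ, l ≠ 0 → ∀ e : ℝ → ℂ,
      (∀ x, (x, θ) ∈ tsupport b → HasDerivAt e (I * l * g (x, θ) * e x) x) →
      (∀ x, (x, θ) ∈ tsupport b → ‖e x‖ ≤ 1) →
      ‖∫ x, e x * b (x, θ)‖ ≤ C / |l| ^ N := by
  induction N with
  | zero =>
    intro b hb hbs hg
    obtain ⟨C, hC⟩ := ((isCompact_Icc (a := A) (b := B)).prod hΘ).exists_bound_of_continuousOn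
      (f := b) (fun p hp => (hb p hp.2).continuousAt.continuousWithinAt)
    refine ⟨max C 0 * volume.real (Icc A B), by positivity, fun θ hθ l hl e he he1 => ?_⟩
    rw [pow_zero, div_one]
    have h0 : ∀ x, (x, θ) ∉ tsupport b → e x * b (x, θ) = 0 := fun x hx => by
      rw [image_eq_zero_of_notMem_tsupport hx, mul_zero]
    rw [← setIntegral_eq_integral_of_forall_compl_eq_zero (s := Icc A B)
      fun x hx => h0 x fun h => hx (hbs _ hθ h)]
    refine norm_setIntegral_le_of_norm_le_const measure_Icc_lt_top fun x hx => ?_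
    by_cases hx' : (x, θ) ∈ tsupport b
    · rw [norm_mul]
      calc _ ≤ 1 * C := by
            gcongr
            · exact he1 x hx'
            · exact hC _ ⟨hx, hθ⟩
        _ ≤ _ := by simp
    · rw [h0 x hx']; simp
  | succ N ih =>
    intro b hb hbs hg
    have hsub := tsupport_nonstatStep g b
    obtain ⟨C, hC0, hC⟩ := ih (nonstatStep g b)
      (fun p hp => by
        refine ((ContDiffAt.fderiv_right (m := ∞) (n := ∞) (f := fun q => b q * ((g q)⁻¹ : ℝ))
          ?_ (by simp)).clm_apply contDiffAt_const).neg
        exact (hb p hp).mul_of_mem_tsupport fun hx =>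
          ofRealCLM.contDiff.contDiffAt.comp _ ((hg p hp hx).1.inv (hg p hp hx).2))
      (fun p hp h => hbs p hp (hsub h)) (fun p hp h => hg p hp (hsub h))
    refine ⟨C, hC0, fun θ hθ l hl e he he1 => ?_⟩
    rw [integral_nonstatStep (fun x => hb _ hθ) (fun x => hbs (x, θ) hθ) (fun x => hg (x, θ) hθ)
      hl he]
    have := hC θ hθ l hl e (fun x h => he x (hsub h)) (fun x h => he1 x (hsub h))
    rw [norm_mul, norm_inv, norm_mul, norm_I, one_mul, norm_real, Real.norm_eq_abs, pow_succ,
      ← div_div, div_eq_inv_mul (_ / _)]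
    gcongr

theorem integral_fourier_mul_Lp (φ : 𝓢(ℝ, ℂ)) (u : Lp ℂ 2 (volume : Measure ℝ)) :
    ∫ y, 𝓕 (φ : ℝ → ℂ) y * u y = ∫ η, φ η * (𝓕 u : Lp ℂ 2 (volume : Measure ℝ)) η := by
  have h := congrArg (fun T => T φ) (Lp.fourier_toTemperedDistribution_eq u)
  simpa [TemperedDistribution.fourier_apply, Lp.toTemperedDistribution_apply,
    SchwartzMap.fourier_coe, smul_eq_mul] using h

/-- The plane wave `x ↦ exp (2πixη) a(x, 2πhη)` of frequency `2πhη` at scale `h`. -/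
def wave (h : ℝ) (a : ℝ × ℝ → ℂ) (η x : ℝ) : ℂ :=
  cexp ((2 * π * x * η : ℝ) * I) * a (x, 2 * π * h * η)

theorem Oph_eq_integral_wave {h : ℝ} (hh : 0 < h) {a : ℝ × ℝ → ℂ} (has : ContDiff ℝ ∞ a)
    (hac : HasCompactSupport a) (u : Lp ℂ 2 (volume : Measure ℝ)) (x : ℝ) :
    Oph h a u x = ∫ η, wave h a η x * (𝓕 u : Lp ℂ 2 (volume : Measure ℝ)) η := by
  have hpos : 0 < 2 * π * h := by positivity
  have hsm : ContDiff ℝ ∞ fun η : ℝ => wave h a η x := by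
    unfold wave
    refine ContDiff.mul (ContDiff.cexp (ContDiff.mul (ofRealCLM.contDiff.comp
      (show ContDiff ℝ ∞ fun η : ℝ => 2 * π * x * η by fun_prop)) contDiff_const)) (has.comp (by fun_prop))
  have hcs : HasCompactSupport fun η : ℝ => wave h a η x := by
    have h1 : HasCompactSupport fun η : ℝ => a (x, 2 * π * h * η) := by
      obtain ⟨R, hR⟩ := hac.isCompact.isBounded.subset_closedBall 0
      refine HasCompactSupport.intro (isCompact_Icc (a := -(R / (2 * π * h)))
        (b := R / (2 * π * h))) fun η hη => ?_
      by_contra hne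
      have h2 := hR (subset_tsupport _ hne)
      rw [mem_closedBall_zero_iff, Prod.norm_def, max_le_iff] at h2
      have h3 := abs_le.mp h2.2
      refine hη ⟨?_, ?_⟩
      · rw [← neg_div, div_le_iff₀ hpos]; linarith
      · rw [le_div_iff₀ hpos]; linarith
    exact h1.mul_left
  have key := integral_fourier_mul_Lp (hcs.toSchwartzMap hsm) u
  refine Eq.trans ?_ key
  rw [Oph, ← integral_const_mul]
  congr 1
  ext y
  rw [← mul_assoc]
  congr 1
  rw [Real.fourier_real_eq_integral_exp_smul]
  have h1 := Measure.integral_comp_mul_left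
    (fun ξ : ℝ => cexp (I * ((x - y) * ξ) / h) * a (x, ξ)) (2 * π * h)
  have h2 : ∀ η : ℝ, cexp (↑(-2 * π * η * y) * I) • (hcs.toSchwartzMap hsm) η =
      (fun ξ : ℝ => cexp (I * ((x - y) * ξ) / h) * a (x, ξ)) (2 * π * h * η) := fun η => by
    simp only [HasCompactSupport.toSchwartzMap_toFun, wave, smul_eq_mul, ← mul_assoc, ← Complex.exp_add]
    congr 2
    have : (h : ℂ) ≠ 0 := by exact_mod_cast hh.ne'
    push_cast
    field_simp
    ring
  simp_rw [h2]
  rw [h1, abs_of_pos (by positivity), Complex.real_smul]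

/-- A cutoff `Ω` seen in the coordinate `τ = 1/(y-x)` centred at `x`, extended by `1` to `τ = 0`. -/
def recipCut (Ω : ℝ → ℝ) (p : ℝ × ℝ) : ℝ := if p.2 = 0 then 1 else Ω (p.1 + p.2⁻¹)

theorem recipCut_of_ne {Ω : ℝ → ℝ} {x t : ℝ} (ht : t ≠ 0) : recipCut Ω (x, t) = Ω (x + t⁻¹) := by
  simp [recipCut, ht]

theorem recipCut_contDiff {Ω : ℝ → ℝ} {A B : ℝ} (hΩ : ContDiff ℝ ∞ Ω)
    (h1 : ∀ x, x ∉ Icc A B → Ω x = 1) : ContDiff ℝ ∞ (recipCut Ω) := by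
  refine contDiff_iff_contDiffAt.mpr fun p => ?_
  by_cases hp : p.2 = 0
  · have hev : ∀ᶠ q : ℝ × ℝ in 𝓝 p, recipCut Ω q = 1 := by
      have hM : ∀ᶠ q : ℝ × ℝ in 𝓝 p, (|q.1| + |A| + |B| + 1) * |q.2| < 1 := by
        have hc : Continuous fun q : ℝ × ℝ => (|q.1| + |A| + |B| + 1) * |q.2| := by fun_prop
        exact hc.continuousAt.eventually (gt_mem_nhds (by simp [hp]))
      filter_upwards [hM] with q hq
      by_cases hq0 : q.2 = 0
      · simp [recipCut, hq0]
      · rw [recipCut, if_neg hq0]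
        refine h1 _ fun hmem => ?_
        have h2 : |q.1 + q.2⁻¹| ≤ |A| + |B| := by
          rw [abs_le]
          constructor
          · linarith [hmem.1, neg_abs_le A, abs_nonneg B]
          · linarith [hmem.2, le_abs_self B, abs_nonneg A]
        have h3 : |q.2⁻¹| ≤ |q.1 + q.2⁻¹| + |q.1| := by
          have := abs_sub (q.1 + q.2⁻¹) q.1
          simpa using this
        have h4 : |q.2⁻¹| * |q.2| = 1 := by rw [← abs_mul, inv_mul_cancel₀ hq0, abs_one]
        have h5 : 0 < |q.2| := abs_pos.mpr hq0
        nlinarith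
    exact contDiffAt_const.congr_of_eventuallyEq hev
  · have hev : recipCut Ω =ᶠ[𝓝 p] fun q => Ω (q.1 + q.2⁻¹) := by
      filter_upwards [continuousAt_snd.eventually_ne hp] with q hq
      simp [recipCut, hq]
    refine ContDiffAt.congr_of_eventuallyEq ?_ hev
    exact hΩ.contDiffAt.comp p (contDiffAt_fst.add (contDiffAt_snd.inv hp))

/-- The pairs `(x,τ)` with `x ∈ [x₀,x₁]` and `x + 1/τ` outside `(x₀-δ, x₁+δ)`. -/
def goodSet (x₀ x₁ δ : ℝ) : Set (ℝ × ℝ) :=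
  {p | p.1 ∈ Icc x₀ x₁ ∧ p.2 * (x₁ + δ - p.1) ≤ 1 ∧ p.2 * (x₀ - δ - p.1) ≤ 1}

theorem goodSet_isCompact {x₀ x₁ δ : ℝ} (hδ : 0 < δ) : IsCompact (goodSet x₀ x₁ δ) := by
  refine IsCompact.of_isClosed_subset
    ((isCompact_Icc (a := x₀) (b := x₁)).prod (isCompact_Icc (a := -δ⁻¹) (b := δ⁻¹))) ?_ ?_
  · refine IsClosed.inter (isClosed_Icc.preimage continuous_fst) (IsClosed.inter ?_ ?_)
    · exact isClosed_le (f := fun p : ℝ × ℝ => p.2 * (x₁ + δ - p.1)) (g := fun _ => 1)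
        (by fun_prop) continuous_const
    · exact isClosed_le (f := fun p : ℝ × ℝ => p.2 * (x₀ - δ - p.1)) (g := fun _ => 1)
        (by fun_prop) continuous_const
  · rintro ⟨x, t⟩ ⟨hx, h1, h2⟩
    refine ⟨hx, ?_, ?_⟩ <;> simp only [mem_Icc] at *
    · rw [← neg_le_neg_iff, neg_neg, ← one_div, le_div_iff₀ hδ]
      by_cases ht : 0 ≤ t <;> nlinarith
    · rw [← one_div, le_div_iff₀ hδ]
      by_cases ht : 0 ≤ t <;> nlinarith

theorem goodSet_pos {x₀ x₁ δ : ℝ} (hδ : 0 < δ) {x t x' : ℝ} (h : (x, t) ∈ goodSet x₀ x₁ δ)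
    (hx' : x' ∈ Icc x₀ x₁) : 0 < 1 - t * (x' - x) := by
  obtain ⟨hx, h1, h2⟩ := h
  simp only [mem_Icc] at *
  rcases lt_trichotomy t 0 with ht | rfl | ht
  · nlinarith
  · simp
  · nlinarith

theorem mem_goodSet_of_mem_tsupport {Ω : ℝ → ℝ} {x₀ x₁ δ : ℝ} (hδ : 0 < δ)
    (h0 : ∀ y ∈ Ioo (x₀ - δ) (x₁ + δ), Ω y = 0) {x t : ℝ} (hx : x ∈ Icc x₀ x₁)
    (ht : (x, t) ∈ tsupport (recipCut Ω)) : (x, t) ∈ goodSet x₀ x₁ δ := by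
  by_contra hn
  refine (notMem_tsupport_iff_eventuallyEq.mpr ?_) ht
  have ht0 : t ≠ 0 := by
    rintro rfl
    exact hn ⟨hx, by simp, by simp⟩
  have hmem : x + t⁻¹ ∈ Ioo (x₀ - δ) (x₁ + δ) := by
    have h4 : t * t⁻¹ = 1 := mul_inv_cancel₀ ht0
    simp only [goodSet, mem_ofPred_eq, not_and_or, not_le] at hn
    rcases hn with h | h | h
    · exact absurd hx h
    · have htp : 0 < t := by
        by_contra hc
        nlinarith [hx.1, hx.2]
      have h5 : 0 < t⁻¹ := inv_pos.mpr htp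
      constructor
      · linarith [hx.1]
      · have : t * t⁻¹ < t * (x₁ + δ - x) := by linarith
        linarith [lt_of_mul_lt_mul_left this htp.le]
    · have htn : t < 0 := by
        by_contra hc
        nlinarith [hx.1, hx.2]
      have h5 : t⁻¹ < 0 := inv_lt_zero.mpr htn
      constructor
      · have : t * t⁻¹ < t * (x₀ - δ - x) := by linarith
        linarith [(mul_lt_mul_left_of_neg htn).mp this]
      · linarith [hx.2]
  have hc : ContinuousAt (fun q : ℝ × ℝ => q.1 + q.2⁻¹) (x, t) :=
    continuousAt_fst.add (continuousAt_snd.inv₀ ht0)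
  filter_upwards [hc.eventually (isOpen_Ioo.mem_nhds hmem),
    continuousAt_snd.eventually_ne (show ((x, t) : ℝ × ℝ).2 ≠ 0 from ht0)] with q hq hq0
  simp [recipCut, hq0, h0 _ hq]

theorem recipCut_eq_one {Ω : ℝ → ℝ} {x₀ x₁ K : ℝ} (hK : 0 < K) (hKI : 10 * K * (x₁ - x₀) ≤ 1)
    (h1 : ∀ x, x ∉ Icc (x₀ - 1 / (10 * K)) (x₁ + 1 / (10 * K)) → Ω x = 1) {x t : ℝ}
    (hx : x ∈ Icc x₀ x₁) (ht : |t| < 5 * K) : recipCut Ω (x, t) = 1 := by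
  by_cases ht0 : t = 0
  · simp [recipCut, ht0]
  · rw [recipCut_of_ne ht0]
    refine h1 _ fun hm => ?_
    have h2 : |t⁻¹| ≤ 1 / (5 * K) := by
      have e1 : x₁ - x₀ ≤ 1 / (10 * K) := by
        rw [le_div_iff₀ (by positivity)]; linarith
      have e2 : 1 / (5 * K) = 1 / (10 * K) + 1 / (10 * K) := by field_simp; norm_num
      rw [e2, abs_le]
      constructor <;> linarith [hm.1, hm.2, hx.1, hx.2]
    rw [abs_inv, ← one_div, div_le_div_iff₀ (abs_pos.mpr ht0) (by positivity)] at h2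
    linarith

theorem integral_recip (F : ℝ → ℂ) (x : ℝ) :
    ∫ y, F y = ∫ t : ℝ, ((t ^ 2)⁻¹ : ℝ) * F (x + t⁻¹) := by
  have himg : (fun t : ℝ => x + t⁻¹) '' {0}ᶜ = {x}ᶜ := by
    ext y
    simp only [mem_image, mem_compl_iff, mem_singleton_iff]
    constructor
    · rintro ⟨t, ht, rfl⟩ h
      exact ht (by simpa using h)
    · intro hy
      exact ⟨(y - x)⁻¹, inv_ne_zero (sub_ne_zero.mpr hy), by simp⟩
  have h := integral_image_eq_integral_abs_deriv_smul (s := {0}ᶜ) (f := fun t : ℝ => x + t⁻¹)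
    (f' := fun t => -(t ^ 2)⁻¹) (measurableSet_singleton _).compl
    (fun t ht => ((hasDerivAt_inv ht).const_add x).hasDerivWithinAt)
    (fun s hs t ht hst => by simpa using hst) F
  rw [himg] at h
  have hr : ∀ z : ℝ, (volume : Measure ℝ).restrict {z}ᶜ = volume := fun z =>
    Measure.restrict_eq_self_of_ae_mem (compl_mem_ae_iff.mpr (by simp))
  rw [hr, hr] at h
  rw [h]
  refine integral_congr_ae (Eventually.of_forall fun t => ?_)
  simp only [abs_neg, Complex.real_smul]
  rw [abs_of_nonneg (by positivity)]

theorem jap_pos (x : ℝ) : 0 < jap x := Real.sqrt_pos.mpr (by positivity)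

theorem jap_sq (x : ℝ) : jap x ^ 2 = 1 + x ^ 2 := Real.sq_sqrt (by positivity)

theorem one_le_jap (x : ℝ) : 1 ≤ jap x := by
  rw [jap, Real.one_le_sqrt]; nlinarith [sq_nonneg x]

theorem jap_contDiff : ContDiff ℝ ∞ jap := by
  refine contDiff_iff_contDiffAt.mpr fun x => ?_
  exact (contDiffAt_const.add (contDiffAt_id.pow 2)).sqrt (by positivity)

theorem hasDerivAt_log_jap (x : ℝ) :
    HasDerivAt (fun t => Real.log (jap t)) (x / (1 + x ^ 2)) x := by
  have h1 : HasDerivAt (fun t : ℝ => 1 / 2 * Real.log (1 + t ^ 2))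
      (1 / 2 * (2 * x / (1 + x ^ 2))) x := by
    have h2 : HasDerivAt (fun t : ℝ => 1 + t ^ 2) (2 * x) x := by
      simpa using (hasDerivAt_pow 2 x).const_add 1
    exact (h2.log (by positivity)).const_mul _
  have e : (fun t => Real.log (jap t)) = fun t : ℝ => 1 / 2 * Real.log (1 + t ^ 2) := by
    funext t
    rw [jap, Real.log_sqrt (by positivity)]
    ring
  rw [e]
  convert h1 using 1
  ring

theorem cpowR_add (t : ℝ) (w w' : ℂ) : cpowR t (w + w') = cpowR t w * cpowR t w' := by
  rw [cpowR, cpowR, cpowR, ← Complex.exp_add, add_mul]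

theorem cpowR_mul {s t : ℝ} (hs : s ≠ 0) (ht : t ≠ 0) (w : ℂ) :
    cpowR (s * t) w = cpowR s w * cpowR t w := by
  rw [cpowR, cpowR, cpowR, ← Complex.exp_add, Real.log_mul hs ht]
  push_cast
  ring_nf

theorem cpowR_neg_left (t : ℝ) (w : ℂ) : cpowR (-t) w = cpowR t w := by
  rw [cpowR, cpowR, Real.log_neg_eq_log]

theorem cpowR_abs (t : ℝ) (w : ℂ) : cpowR |t| w = cpowR t w := by
  rw [cpowR, cpowR, Real.log_abs]

theorem cpowR_inv (t : ℝ) (w : ℂ) : cpowR t⁻¹ w = cpowR t (-w) := by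
  rw [cpowR, cpowR, Real.log_inv]
  push_cast
  ring_nf

theorem cpowR_zero (t : ℝ) : cpowR t 0 = 1 := by simp [cpowR]

theorem cpowR_natCast {t : ℝ} (ht : 0 < t) (n : ℕ) : cpowR t n = (t : ℂ) ^ n := by
  rw [cpowR, Complex.exp_nat_mul, ← Complex.ofReal_exp, Real.exp_log ht]

theorem norm_cpowR (t : ℝ) (w : ℂ) : ‖cpowR t w‖ = Real.exp (w.re * Real.log t) := by
  rw [cpowR, Complex.norm_exp]
  simp

theorem ContDiffAt.cpowR {E : Type*} [NormedAddCommGroup E] [NormedSpace ℝ E] {f : E → ℝ} {p : E}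
    (hf : ContDiffAt ℝ ∞ f p) (h0 : f p ≠ 0) (w : ℂ) :
    ContDiffAt ℝ ∞ (fun q => cpowR (f q) w) p :=
  (contDiffAt_const.mul (ofRealCLM.contDiff.contDiffAt.comp p (hf.log h0))).cexp

theorem continuousAt_cpowR {E : Type*} [TopologicalSpace E] {f : E → ℝ} {w : E → ℂ} {p : E}
    (hf : ContinuousAt f p) (hw : ContinuousAt w p) (h0 : f p ≠ 0) :
    ContinuousAt (fun q => _root_.cpowR (f q) (w q)) p :=
  (hw.mul (continuous_ofReal.continuousAt.comp (hf.log h0))).cexp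

theorem hasDerivAt_cexp_I_mul {φ : ℝ → ℝ} {c x : ℝ} {d : ℝ} (h : HasDerivAt φ d x)
    {G : ℝ} (hd : d = c * G) :
    HasDerivAt (fun t => cexp (I * (φ t : ℝ))) (I * c * G * cexp (I * (φ x : ℝ))) x := by
  have h1 : HasDerivAt (fun t => (φ t : ℂ)) (d : ℂ) x := h.ofReal_comp
  convert (h1.const_mul I).cexp using 1
  rw [hd]
  push_cast
  ring

theorem image_fst_tsupport {a : ℝ × ℝ → ℂ} {E : Type*} [TopologicalSpace E] {f : E → ℝ × ℝ}
    (hf : Continuous f) {k : E → ℂ} {p : E} (hp : p ∈ tsupport fun q => a (f q) * k q) :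
    f p ∈ tsupport a :=
  tsupport_comp_subset_preimage a hf (tsupport_mul_subset_left hp)

section Nonstationary

variable {ν K x₀ x₁ : ℝ} {a : ℝ × ℝ → ℂ}

theorem norm_integral_far_le (ν : ℝ) (hK : 10 ≤ K) (has : ContDiff ℝ ∞ a)
    (hasupp : tsupport a ⊆ Ioo x₀ x₁ ×ˢ Ioo (-(2 * K)) (2 * K)) (N : ℕ) :
    ∃ C, 0 ≤ C ∧ ∀ h > 0, ∀ η, |2 * π * h * η| ≤ 2 * K → ∀ τ, 5 * K ≤ |τ| →
      ‖∫ x' : ℝ, cexp (-(2 * I / h) * (τ * x')) *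
        (cpowR (jap x') (2 * ν - 2 * I / h - 1) * wave h a η x')‖ ≤ C * (h / |τ|) ^ N := by
  set b : ℝ × (ℝ × ℝ) → ℂ := fun p => a (p.1, p.2.2) * cpowR (jap p.1) (2 * ν - 1 : ℝ) with hb
  set G : ℝ × (ℝ × ℝ) → ℝ := fun p => -2 + p.2.1 * (p.2.2 - 2 * (p.1 / (1 + p.1 ^ 2))) with hG
  have hcont : Continuous fun p : ℝ × (ℝ × ℝ) => (p.1, p.2.2) := by fun_prop
  have hx0 : ∀ x : ℝ, |x / (1 + x ^ 2)| ≤ 1 / 2 := fun x => by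
    rw [abs_div, abs_of_pos (show 0 < 1 + x ^ 2 by positivity), div_le_iff₀ (by positivity)]
    nlinarith [sq_nonneg (|x| - 1), sq_abs x]
  obtain ⟨C, hC0, hC⟩ := nonstationary_phase (Θ := Icc (-(1 / (5 * K))) (1 / (5 * K)) ×ˢ
      Icc (-(2 * K)) (2 * K)) (isCompact_Icc.prod isCompact_Icc) (A := x₀) (B := x₁) (g := G) N b
    (fun p _ => by
      refine ContDiffAt.mul ?_ ?_
      · exact has.contDiffAt.comp p (contDiffAt_fst.prodMk (contDiffAt_snd.comp p contDiffAt_snd))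
      · exact ContDiffAt.cpowR (jap_contDiff.contDiffAt.comp p contDiffAt_fst) (jap_pos _).ne' _)
    (fun p _ hp => Ioo_subset_Icc_self (hasupp (image_fst_tsupport hcont hp)).1)
    (fun p hp _ => by
      constructor
      · refine contDiffAt_const.add (ContDiffAt.mul (by fun_prop) (ContDiffAt.sub (by fun_prop)
          (contDiffAt_const.mul (ContDiffAt.div (by fun_prop) (by fun_prop) (by positivity)))))
      · have h1 : |p.2.1| ≤ 1 / (5 * K) := abs_le.mpr hp.1
        have h2 : |p.2.2| ≤ 2 * K := abs_le.mpr hp.2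
        have h3 : |p.2.2 - 2 * (p.1 / (1 + p.1 ^ 2))| ≤ 2 * K + 1 := by
          refine (abs_sub _ _).trans ?_
          rw [abs_mul, abs_two]
          linarith [hx0 p.1]
        have h4 : |p.2.1 * (p.2.2 - 2 * (p.1 / (1 + p.1 ^ 2)))| < 2 := by
          rw [abs_mul]
          refine (mul_le_mul h1 h3 (abs_nonneg _) (by positivity)).trans_lt ?_
          rw [div_mul_eq_mul_div, div_lt_iff₀ (by positivity)]
          linarith
        have := (abs_lt.mp h4).2
        simp only [hG]
        linarith)
  refine ⟨C, hC0, fun h hh η hη τ hτ => ?_⟩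
  have hτ0 : τ ≠ 0 := by
    rintro rfl
    simp at hτ
    linarith
  have hl : τ / h ≠ 0 := div_ne_zero hτ0 hh.ne'
  have := hC (τ⁻¹, 2 * π * h * η) ⟨abs_le.mp (by
      rw [abs_inv, ← one_div]
      exact one_div_le_one_div_of_le (by positivity) hτ), abs_le.mp hη⟩ (τ / h) hl
    (fun x => cexp (I * ((-(2 / h) * (τ * x) - 2 / h * Real.log (jap x) + 2 * π * x * η : ℝ))))
    (fun x _ => hasDerivAt_cexp_I_mul (d := -(2 / h) * τ - 2 / h * (x / (1 + x ^ 2)) + 2 * π * η)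
      (by
        refine HasDerivAt.add (HasDerivAt.sub ?_ ((hasDerivAt_log_jap x).const_mul _)) ?_
        · simpa using ((hasDerivAt_id x).const_mul τ).const_mul (-(2 / h))
        · simpa using ((hasDerivAt_id x).const_mul (2 * π)).mul_const η)
      (by
        simp only [hG]
        field_simp
        ring))
    (fun x _ => by rw [mul_comm, Complex.norm_exp_ofReal_mul_I])
  rw [abs_div, abs_of_pos hh] at this
  convert this using 1
  · congr 2
    funext x
    have e1 : cpowR (jap x) (2 * ν - 2 * I / h - 1) =
        cpowR (jap x) (2 * ν - 1 : ℝ) * cexp (-(2 * I / h) * Real.log (jap x)) := by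
      rw [show (2 * ν - 2 * I / h - 1 : ℂ) = ((2 * ν - 1 : ℝ) : ℂ) + (-(2 * I / h)) by
        push_cast; ring, cpowR_add]
      rfl
    have e2 : cexp (I * ((-(2 / h) * (τ * x) - 2 / h * Real.log (jap x) + 2 * π * x * η : ℝ))) =
        cexp (-(2 * I / h) * (τ * x)) * cexp (-(2 * I / h) * Real.log (jap x)) *
          cexp ((2 * π * x * η : ℝ) * I) := by
      rw [← Complex.exp_add, ← Complex.exp_add]
      congr 1
      push_cast
      ring
    rw [e1, e2, hb, wave]
    ring
  · rw [div_pow, div_pow]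
    field_simp

theorem norm_integral_interp_le (ν : ℝ) (hK : 10 ≤ K) (hKI : 10 * K * (x₁ - x₀) ≤ 1)
    (has : ContDiff ℝ ∞ a) (hasupp : tsupport a ⊆ Ioo x₀ x₁ ×ˢ Ioo (-(2 * K)) (2 * K))
    {δ : ℝ} (hδ : 0 < δ) (N : ℕ) :
    ∃ C, 0 ≤ C ∧ ∀ h > 0, ∀ η, |2 * π * h * η| ≤ 2 * K → ∀ x τ, (x, τ) ∈ goodSet x₀ x₁ δ →
      5 * K ≤ |τ| → ∀ ρ ∈ Icc (0 : ℝ) 1, ∀ σ ∈ Icc (0 : ℝ) 1,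
      ‖∫ x' : ℝ, cexp ((1 - σ) * (-(2 * I / h) * (τ * (x' - x)))
          + σ * (-(2 * ν - 2 * I / h) * Real.log (1 - τ * (x' - x)))) *
        ((1 - ρ * (τ * (x' - x)) : ℝ) : ℂ)⁻¹ *
        (cpowR (jap x') (2 * ν - 2 * I / h - 1) * wave h a η x')‖ ≤ C * h ^ N := by
  set k : ℝ × ((ℝ × ℝ) × (ℝ × ℝ) × ℝ) → ℂ := fun p =>
    cpowR (jap p.1) (2 * ν - 1 : ℝ) *
      cexp (-(2 * ν) * (p.2.2.1.2 * Real.log (1 - p.2.1.2 * (p.1 - p.2.1.1)))) *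
      (((1 - p.2.2.1.1 * (p.2.1.2 * (p.1 - p.2.1.1)) : ℝ) : ℂ))⁻¹ with hk
  set G : ℝ × ((ℝ × ℝ) × (ℝ × ℝ) × ℝ) → ℝ := fun p =>
    -2 * (1 - p.2.2.1.2) * p.2.1.2
      - 2 * p.2.2.1.2 * (p.2.1.2 / (1 - p.2.1.2 * (p.1 - p.2.1.1)))
      - 2 * (p.1 / (1 + p.1 ^ 2)) + p.2.2.2 with hG
  have hcont : Continuous fun p : ℝ × ((ℝ × ℝ) × (ℝ × ℝ) × ℝ) => (p.1, p.2.2.2) := by fun_prop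
  have hx0 : ∀ x : ℝ, |x / (1 + x ^ 2)| ≤ 1 / 2 := fun x => by
    rw [abs_div, abs_of_pos (show 0 < 1 + x ^ 2 by positivity), div_le_iff₀ (by positivity)]
    nlinarith [sq_nonneg (|x| - 1), sq_abs x]
  have hΘ : IsCompact (((goodSet x₀ x₁ δ ∩ {p | 5 * K ≤ |p.2|}) ×ˢ
      (Icc (0 : ℝ) 1 ×ˢ Icc (0 : ℝ) 1) ×ˢ Icc (-(2 * K)) (2 * K) :
      Set ((ℝ × ℝ) × (ℝ × ℝ) × ℝ))) :=
    ((goodSet_isCompact hδ).inter_right (isClosed_le continuous_const (by fun_prop))).prod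
      ((isCompact_Icc.prod isCompact_Icc).prod isCompact_Icc)
  have hρ : ∀ s ρ : ℝ, 0 < 1 - s → ρ ∈ Icc (0 : ℝ) 1 → 0 < 1 - ρ * s := by
    intro s ρ hs hρ
    rcases le_or_gt s 0 with h | h
    · nlinarith [hρ.1]
    · nlinarith [hρ.2]
  obtain ⟨C, hC0, hC⟩ := nonstationary_phase hΘ (A := x₀) (B := x₁) (g := G) N
    (fun p => a (p.1, p.2.2.2) * k p)
    (fun p hpΘ => by
      refine ContDiffAt.mul_of_mem_tsupport ?_ fun hp => ?_
      · exact has.contDiffAt.comp p (by fun_prop)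
      have hp' := (hasupp (tsupport_comp_subset_preimage a hcont hp)).1
      have hpos := goodSet_pos hδ hpΘ.1.1 (Ioo_subset_Icc_self hp')
      refine ContDiffAt.mul (ContDiffAt.mul ?_ ?_) (ContDiffAt.inv ?_ ?_)
      · exact ContDiffAt.cpowR (jap_contDiff.contDiffAt.comp p contDiffAt_fst) (jap_pos _).ne' _
      · refine (contDiffAt_const.mul (ContDiffAt.mul ?_ ?_)).cexp
        · exact ofRealCLM.contDiff.contDiffAt.comp p (by fun_prop)
        · exact ofRealCLM.contDiff.contDiffAt.comp p (ContDiffAt.log (by fun_prop) hpos.ne')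
      · exact ofRealCLM.contDiff.contDiffAt.comp (f := fun p : ℝ × ((ℝ × ℝ) × (ℝ × ℝ) × ℝ) =>
          (1 - p.2.2.1.1 * (p.2.1.2 * (p.1 - p.2.1.1)) : ℝ)) p (by fun_prop)
      · exact ofReal_ne_zero.mpr (hρ _ _ hpos hpΘ.2.1.1).ne')
    (fun p _ hp => Ioo_subset_Icc_self (hasupp (image_fst_tsupport hcont hp)).1)
    (fun p hpΘ hp => by
      have hp' := Ioo_subset_Icc_self (hasupp (image_fst_tsupport hcont hp)).1
      have hpos := goodSet_pos hδ hpΘ.1.1 hp'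
      constructor
      · refine ContDiffAt.add (ContDiffAt.sub (ContDiffAt.sub (by fun_prop)
          (ContDiffAt.mul (by fun_prop) (ContDiffAt.div (by fun_prop) (by fun_prop) hpos.ne')))
          (contDiffAt_const.mul (ContDiffAt.div (by fun_prop) (by fun_prop) (by positivity))))
          (by fun_prop)
      · obtain ⟨y, ⟨x, τ⟩, ⟨ρ, σ⟩, ξ⟩ := p
        obtain ⟨⟨hg, hτ⟩, ⟨-, hσ⟩, hξ⟩ := hpΘ
        have hx := hg.1
        simp only [mem_Icc, mem_ofPred_eq] at *
        have h1 := abs_le.mp (hx0 y)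
        have hz : |y - x| ≤ 1 / (10 * K) := by
          have : x₁ - x₀ ≤ 1 / (10 * K) := by
            rw [le_div_iff₀ (by positivity)]; linarith
          rw [abs_le]; constructor <;> linarith [hp'.1, hp'.2, hx.1, hx.2]
        have hz' := abs_le.mp hz
        have hKi : K * (1 / (10 * K)) = 1 / 10 := by field_simp
        simp only [hG]
        rcases le_or_gt 0 τ with h0 | h0
        · rw [abs_of_nonneg h0] at hτ
          have hm : 10 * K / 3 ≤ τ / (1 - τ * (y - x)) := by
            rw [le_div_iff₀ hpos]
            have h3 : 10 * K / 3 * (1 - τ * (y - x)) ≤ 10 * K / 3 * (1 + τ * (1 / (10 * K))) := by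
              gcongr; nlinarith
            have h4 : 10 * K / 3 * (1 + τ * (1 / (10 * K))) = 10 * K / 3 + τ / 3 := by
              field_simp
            linarith
          have : σ * (10 * K / 3) ≤ σ * (τ / (1 - τ * (y - x))) :=
            mul_le_mul_of_nonneg_left hm hσ.1
          have : (1 - σ) * (5 * K) ≤ (1 - σ) * τ :=
            mul_le_mul_of_nonneg_left hτ (by linarith [hσ.2])
          apply ne_of_lt
          nlinarith [hξ.2, h1.1, hσ.1, hσ.2]
        · rw [abs_of_neg h0] at hτ
          have hm : 10 * K / 3 ≤ -(τ / (1 - τ * (y - x))) := by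
            rw [← neg_div, le_div_iff₀ hpos]
            have h3 : 10 * K / 3 * (1 - τ * (y - x)) ≤ 10 * K / 3 * (1 + -τ * (1 / (10 * K))) := by
              gcongr; nlinarith
            have h4 : 10 * K / 3 * (1 + -τ * (1 / (10 * K))) = 10 * K / 3 + -τ / 3 := by
              field_simp
            linarith
          have : σ * (10 * K / 3) ≤ σ * -(τ / (1 - τ * (y - x))) :=
            mul_le_mul_of_nonneg_left hm hσ.1
          have : (1 - σ) * (5 * K) ≤ (1 - σ) * -τ :=
            mul_le_mul_of_nonneg_left hτ (by linarith [hσ.2])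
          apply ne_of_gt
          nlinarith [hξ.1, h1.2, hσ.1, hσ.2])
  refine ⟨C, hC0, fun h hh η hη x τ hg hτ ρ hρm σ hσm => ?_⟩
  have := hC ((x, τ), (ρ, σ), 2 * π * h * η) ⟨⟨hg, hτ⟩, ⟨hρm, hσm⟩, abs_le.mp hη⟩ (1 / h)
    (by positivity)
    (fun y => cexp (I * ((-(2 / h) * (1 - σ) * (τ * (y - x))
      + 2 / h * σ * Real.log (1 - τ * (y - x)) - 2 / h * Real.log (jap y) + 2 * π * y * η : ℝ))))
    (fun y hy => hasDerivAt_cexp_I_mul (d := -(2 / h) * (1 - σ) * τ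
        + 2 / h * σ * (-τ / (1 - τ * (y - x))) - 2 / h * (y / (1 + y ^ 2)) + 2 * π * η)
      (by
        have hpos := goodSet_pos hδ hg
          (Ioo_subset_Icc_self (hasupp (image_fst_tsupport hcont hy)).1)
        have hd : HasDerivAt (fun y => τ * (y - x)) τ y := by
          simpa using ((hasDerivAt_id y).sub_const x).const_mul τ
        refine HasDerivAt.add (HasDerivAt.sub (HasDerivAt.add ?_ ?_)
          ((hasDerivAt_log_jap y).const_mul _)) ?_
        · exact hd.const_mul _
        · exact ((hd.const_sub 1).log hpos.ne').const_mul _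
        · simpa using ((hasDerivAt_id y).const_mul (2 * π)).mul_const η)
      (by
        simp only [hG]
        field_simp
        ring))
    (fun x _ => by rw [mul_comm, Complex.norm_exp_ofReal_mul_I])
  rw [abs_of_pos (by positivity), one_div, inv_pow, div_inv_eq_mul] at this
  convert this using 1
  congr 2
  funext y
  have e1 : cpowR (jap y) (2 * ν - 2 * I / h - 1) =
      cpowR (jap y) (2 * ν - 1 : ℝ) * cexp (-(2 * I / h) * Real.log (jap y)) := by
    rw [show (2 * ν - 2 * I / h - 1 : ℂ) = ((2 * ν - 1 : ℝ) : ℂ) + (-(2 * I / h)) by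
      push_cast; ring, cpowR_add]
    rfl
  have e2 : cexp (I * ((-(2 / h) * (1 - σ) * (τ * (y - x))
      + 2 / h * σ * Real.log (1 - τ * (y - x)) - 2 / h * Real.log (jap y) + 2 * π * y * η : ℝ))) *
        cexp (-(2 * ν) * (σ * Real.log (1 - τ * (y - x)))) =
      cexp ((1 - σ) * (-(2 * I / h) * (τ * (y - x)))
          + σ * (-(2 * ν - 2 * I / h) * Real.log (1 - τ * (y - x)))) *
        cexp (-(2 * I / h) * Real.log (jap y)) * cexp ((2 * π * y * η : ℝ) * I) := by
    rw [← Complex.exp_add, ← Complex.exp_add, ← Complex.exp_add]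
    congr 1
    push_cast
    ring
  rw [e1, hk, wave]
  linear_combination (-(cpowR (jap y) (2 * ν - 1 : ℝ)) *
    ((1 - ρ * (τ * (y - x)) : ℝ) : ℂ)⁻¹ * a (y, 2 * π * h * η)) * e2

end Nonstationary

theorem le_div_one_add_sq {A C₀ C₂ l : ℝ} (hl : l ≠ 0) (h0 : A ≤ C₀ / |l| ^ 0)
    (h2 : A ≤ C₂ / |l| ^ 2) : A ≤ (C₀ + C₂) / (1 + l ^ 2) := by
  have hl2 : 0 < l ^ 2 := by positivity
  rw [pow_zero, div_one] at h0
  rw [sq_abs, le_div_iff₀ hl2] at h2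
  rw [le_div_iff₀ (by positivity)]
  linarith

theorem norm_symbol_kernel_le {a : ℝ × ℝ → ℂ} (has : ContDiff ℝ ∞ a) (hac : HasCompactSupport a) :
    ∃ C, 0 ≤ C ∧ ∀ h : ℝ, 0 < h → ∀ x y : ℝ, x ≠ y →
      ‖∫ ξ : ℝ, cexp (I * ((x - y) * ξ) / h) * a (x, ξ)‖ ≤ C / (1 + ((x - y) / h) ^ 2) := by
  obtain ⟨R, hR⟩ := hac.isCompact.isBounded.subset_closedBall 0
  have hR' : ∀ p ∈ tsupport a, p.1 ∈ Icc (-R) R ∧ p.2 ∈ Icc (-R) R := fun p hp => by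
    have h1 := hR hp
    rw [mem_closedBall_zero_iff, Prod.norm_def, max_le_iff] at h1
    exact ⟨abs_le.mp h1.1, abs_le.mp h1.2⟩
  have key : ∀ N : ℕ, ∃ C, 0 ≤ C ∧ ∀ h : ℝ, 0 < h → ∀ x y : ℝ, x ≠ y →
      ‖∫ ξ : ℝ, cexp (I * ((x - y) * ξ) / h) * a (x, ξ)‖ ≤ C / |(x - y) / h| ^ N := by
    intro N
    have hcont : Continuous fun p : ℝ × ℝ => (p.2, p.1) := by fun_prop
    obtain ⟨C, hC0, hC⟩ := nonstationary_phase (isCompact_Icc (a := -R) (b := R)) (A := -R) (B := R)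
      (g := fun _ : ℝ × ℝ => (1 : ℝ)) N (fun p => a (p.2, p.1))
      (fun p _ => has.contDiffAt.comp p (by fun_prop))
      (fun p _ hp => (hR' _ (tsupport_comp_subset_preimage a hcont hp)).2)
      (fun p _ _ => ⟨contDiffAt_const, one_ne_zero⟩)
    refine ⟨C, hC0, fun h hh x y hxy => ?_⟩
    by_cases hx : x ∈ Icc (-R) R
    · have := hC x hx ((x - y) / h) (div_ne_zero (sub_ne_zero.mpr hxy) hh.ne')
        (fun ξ => cexp (I * (((x - y) / h * ξ : ℝ))))
        (fun ξ _ => hasDerivAt_cexp_I_mul (d := (x - y) / h)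
          (by simpa using (hasDerivAt_id ξ).const_mul ((x - y) / h)) (by ring))
        (fun ξ _ => by rw [mul_comm, Complex.norm_exp_ofReal_mul_I])
      convert this using 4
      congr 2
      push_cast
      ring
    · have : ∀ ξ, a (x, ξ) = 0 := fun ξ => by
        by_contra hne
        exact hx (hR' (x, ξ) (subset_tsupport _ hne)).1
      simp only [this, mul_zero, integral_zero, norm_zero]
      positivity
  obtain ⟨C₀, hC₀, h0⟩ := key 0
  obtain ⟨C₂, hC₂, h2⟩ := key 2
  exact ⟨C₀ + C₂, by positivity, fun h hh x y hxy => le_div_one_add_sq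
    (div_ne_zero (sub_ne_zero.mpr hxy) hh.ne') (h0 h hh x y hxy) (h2 h hh x y hxy)⟩

theorem norm_gram_kernel_le {Ω : ℝ → ℝ} {A B x₀ x₁ δ : ℝ} (ν : ℝ) (hΩ : ContDiff ℝ ∞ Ω)
    (h1 : ∀ x, x ∉ Icc A B → Ω x = 1) (hδ : 0 < δ)
    (h0 : ∀ y ∈ Ioo (x₀ - δ) (x₁ + δ), Ω y = 0) :
    ∃ C, 0 ≤ C ∧ ∀ h : ℝ, 0 < h → ∀ x ∈ Icc x₀ x₁, ∀ y ∈ Icc x₀ x₁, y ≠ x →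
      ‖∫ t : ℝ, (recipCut Ω (x, t) : ℂ) * cpowR (t ^ 2 + (x * t + 1) ^ 2) (2 * ν) *
        cpowR (1 - t * (y - x)) (-(2 * ν - 2 * I / h) - 1)‖ ≤ C / (1 + ((y - x) / h) ^ 2) := by
  set b : ℝ × (ℝ × ℝ) → ℂ := fun p => (recipCut Ω (p.2.1, p.1) : ℂ) *
    (cpowR (p.1 ^ 2 + (p.2.1 * p.1 + 1) ^ 2) (2 * ν) *
        cpowR (1 - p.1 * (p.2.2 - p.2.1)) (-(2 * ν) - 1)) with hb
  set G : ℝ × (ℝ × ℝ) → ℝ := fun p => -2 / (1 - p.1 * (p.2.2 - p.2.1)) with hG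
  have hcont : Continuous fun p : ℝ × (ℝ × ℝ) => (p.2.1, p.1) := by fun_prop
  have hcut := recipCut_contDiff hΩ h1
  have hsupp : ∀ p : ℝ × (ℝ × ℝ), p.2 ∈ Icc x₀ x₁ ×ˢ Icc x₀ x₁ →
      p ∈ tsupport (fun p : ℝ × (ℝ × ℝ) => (recipCut Ω (p.2.1, p.1) : ℂ)) →
      (p.2.1, p.1) ∈ goodSet x₀ x₁ δ := fun p hp hps => by
    refine mem_goodSet_of_mem_tsupport hδ h0 hp.1 ?_
    have := tsupport_comp_subset_preimage (fun q => (recipCut Ω q : ℂ)) hcont hps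
    exact (closure_mono (fun q hq => by simpa using hq)) this
  have hpos : ∀ p : ℝ × (ℝ × ℝ), p.2 ∈ Icc x₀ x₁ ×ˢ Icc x₀ x₁ →
      p ∈ tsupport (fun p : ℝ × (ℝ × ℝ) => (recipCut Ω (p.2.1, p.1) : ℂ)) →
      0 < 1 - p.1 * (p.2.2 - p.2.1) := fun p hp hps => goodSet_pos hδ (hsupp p hp hps) hp.2
  have hq : ∀ x t : ℝ, 0 < t ^ 2 + (x * t + 1) ^ 2 := fun x t => by
    by_cases ht : t = 0
    · simp [ht]
    · positivity
  have key : ∀ N : ℕ, ∃ C, 0 ≤ C ∧ ∀ h : ℝ, 0 < h → ∀ x ∈ Icc x₀ x₁, ∀ y ∈ Icc x₀ x₁, y ≠ x →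
      ‖∫ t : ℝ, (recipCut Ω (x, t) : ℂ) * cpowR (t ^ 2 + (x * t + 1) ^ 2) (2 * ν) *
        cpowR (1 - t * (y - x)) (-(2 * ν - 2 * I / h) - 1)‖ ≤ C / |(y - x) / h| ^ N := by
    intro N
    obtain ⟨C, hC0, hC⟩ := nonstationary_phase ((isCompact_Icc (a := x₀) (b := x₁)).prod
        (isCompact_Icc (a := x₀) (b := x₁))) (A := -δ⁻¹) (B := δ⁻¹) (g := G) N b
      (fun p hp => by
        refine ContDiffAt.mul_of_mem_tsupport ?_ fun hps => ?_
        · exact (ofRealCLM.contDiff.contDiffAt.comp _ hcut.contDiffAt).comp p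
            (f := fun p : ℝ × (ℝ × ℝ) => (p.2.1, p.1)) (by fun_prop)
        · exact ContDiffAt.mul (ContDiffAt.cpowR (f := fun p : ℝ × (ℝ × ℝ) =>
            p.1 ^ 2 + (p.2.1 * p.1 + 1) ^ 2) (by fun_prop) (hq _ _).ne' _)
            (ContDiffAt.cpowR (f := fun p : ℝ × (ℝ × ℝ) => 1 - p.1 * (p.2.2 - p.2.1)) (by fun_prop)
              (hpos p hp hps).ne' _))
      (fun p hp hps => by
        obtain ⟨hx, h1, h2⟩ := hsupp p hp (tsupport_mul_subset_left hps)
        simp only [mem_Icc] at *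
        constructor
        · rw [← neg_le_neg_iff, neg_neg, ← one_div, le_div_iff₀ hδ]
          by_cases ht : 0 ≤ p.1 <;> nlinarith
        · rw [← one_div, le_div_iff₀ hδ]
          by_cases ht : 0 ≤ p.1 <;> nlinarith)
      (fun p hp hps => by
        have := hpos p hp (tsupport_mul_subset_left hps)
        exact ⟨contDiffAt_const.div (by fun_prop) this.ne',
          div_ne_zero (by norm_num) this.ne'⟩)
    refine ⟨C, hC0, fun h hh x hx y hy hxy => ?_⟩
    have := hC (x, y) ⟨hx, hy⟩ ((y - x) / h) (div_ne_zero (sub_ne_zero.mpr hxy) hh.ne')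
      (fun t => cexp (I * ((2 / h * Real.log (1 - t * (y - x)) : ℝ))))
      (fun t ht => hasDerivAt_cexp_I_mul (d := 2 / h * (-(y - x) / (1 - t * (y - x))))
        (by
          have hp := hpos _ ⟨hx, hy⟩ (tsupport_mul_subset_left ht)
          have hd : HasDerivAt (fun t => t * (y - x)) (y - x) t := by
            simpa using (hasDerivAt_id t).mul_const (y - x)
          exact ((hd.const_sub 1).log hp.ne').const_mul _)
        (by
          simp only [hG]
          ring))
      (fun x _ => by rw [mul_comm, Complex.norm_exp_ofReal_mul_I])
    convert this using 4 with t
    have e1 : cpowR (1 - t * (y - x)) (-(2 * ν - 2 * I / h) - 1) =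
        cpowR (1 - t * (y - x)) (-(2 * ν) - 1) *
          cexp (I * ((2 / h * Real.log (1 - t * (y - x)) : ℝ))) := by
      rw [show (-(2 * ν - 2 * I / h) - 1 : ℂ) = (-(2 * ν) - 1) + I * (2 / h) by ring, cpowR_add]
      congr 1
      rw [cpowR]
      push_cast
      ring_nf
    rw [e1, hb]
    ring
  obtain ⟨C₀, hC₀, k0⟩ := key 0
  obtain ⟨C₂, hC₂, k2⟩ := key 2
  exact ⟨C₀ + C₂, by positivity, fun h hh x hx y hy hxy => le_div_one_add_sq
    (div_ne_zero (sub_ne_zero.mpr hxy) hh.ne') (k0 h hh x hx y hy hxy) (k2 h hh x hx y hy hxy)⟩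

theorem ENNReal.mul_le_sq_add_sq (a b : ENNReal) : a * b ≤ a ^ 2 + b ^ 2 := by
  rcases le_total a b with h | h
  · exact (mul_le_mul_left h b).trans (by rw [← sq]; exact le_add_self)
  · exact (mul_le_mul_right h a).trans (by rw [← sq]; exact le_self_add)

theorem lintegral_lintegral_schur_le {w f : ℝ → ENNReal} (hw : Measurable w)
    (hf : AEMeasurable f volume) :
    ∫⁻ x, ∫⁻ y, f x * w (x - y) * f y ≤ 2 * (∫⁻ z, w z) * ∫⁻ x, f x ^ 2 := by
  have hwl : ∀ x : ℝ, ∫⁻ y, w (x - y) = ∫⁻ z, w z := fun x => lintegral_sub_left_eq_self w x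
  have hwr : ∀ y : ℝ, ∫⁻ x, w (x - y) = ∫⁻ z, w z := fun y => lintegral_sub_right_eq_self w y
  have hfm : AEMeasurable (fun p : ℝ × ℝ => f p.2 ^ 2) (volume.prod volume) := by
    exact (hf.comp_quasiMeasurePreserving Measure.quasiMeasurePreserving_snd).pow_const 2
  have hwm : Measurable fun p : ℝ × ℝ => w (p.1 - p.2) := hw.comp (by fun_prop)
  have hwfm : AEMeasurable (fun p : ℝ × ℝ => w (p.1 - p.2) * f p.2 ^ 2) (volume.prod volume) :=
    hwm.aemeasurable.mul hfm
  calc ∫⁻ x, ∫⁻ y, f x * w (x - y) * f y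
      ≤ ∫⁻ x, ∫⁻ y, (f x ^ 2 * w (x - y) + w (x - y) * f y ^ 2) := by
        refine lintegral_mono fun x => lintegral_mono fun y => ?_
        calc f x * w (x - y) * f y = w (x - y) * (f x * f y) := by ring
          _ ≤ w (x - y) * (f x ^ 2 + f y ^ 2) := by gcongr; exact ENNReal.mul_le_sq_add_sq _ _
          _ = _ := by ring
    _ = ∫⁻ x, ((∫⁻ z, w z) * f x ^ 2 + ∫⁻ y, w (x - y) * f y ^ 2) := by
        refine lintegral_congr fun x => ?_
        have hm : Measurable fun y => w (x - y) := hw.comp (by fun_prop)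
        rw [lintegral_add_left (by fun_prop), lintegral_const_mul _ hm, hwl, mul_comm]
    _ = (∫⁻ z, w z) * (∫⁻ x, f x ^ 2) + ∫⁻ y, ∫⁻ x, w (x - y) * f y ^ 2 := by
        rw [lintegral_add_left' ((hf.pow_const 2).const_mul _),
          lintegral_const_mul'' _ (hf.pow_const 2),
          lintegral_lintegral_swap (μ := volume) (ν := volume)
            (f := fun x y => w (x - y) * f y ^ 2) (by exact hwfm)]
    _ = 2 * (∫⁻ z, w z) * ∫⁻ x, f x ^ 2 := by
        have : ∀ y, ∫⁻ x, w (x - y) * f y ^ 2 = (∫⁻ z, w z) * f y ^ 2 := fun y => by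
          have hm : Measurable fun x => w (x - y) := hw.comp (by fun_prop)
          rw [lintegral_mul_const _ hm, hwr]
        simp_rw [this]
        rw [lintegral_const_mul'' _ (hf.pow_const 2)]
        ring

theorem lintegral_convolution_sq_le {w f : ℝ → ENNReal} (hw : Measurable w)
    (hf : AEMeasurable f volume) :
    ∫⁻ x, (∫⁻ y, w (x - y) * f y) ^ 2 ≤ 2 * (∫⁻ z, w z) ^ 2 * ∫⁻ x, f x ^ 2 := by
  have hwl : ∀ x : ℝ, ∫⁻ y, w (x - y) = ∫⁻ z, w z := fun x => lintegral_sub_left_eq_self w x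
  have hwr : ∀ y : ℝ, ∫⁻ x, w (x - y) = ∫⁻ z, w z := fun y => lintegral_sub_right_eq_self w y
  have hfm : AEMeasurable (fun p : ℝ × ℝ => f p.2 ^ 2) (volume.prod volume) := by
    exact (hf.comp_quasiMeasurePreserving Measure.quasiMeasurePreserving_snd).pow_const 2
  have hwm : Measurable fun p : ℝ × ℝ => w (p.1 - p.2) := hw.comp (by fun_prop)
  have hwfm : AEMeasurable (fun p : ℝ × ℝ => w (p.1 - p.2) * f p.2 ^ 2) (volume.prod volume) :=
    hwm.aemeasurable.mul hfm
  have hm : ∀ x, Measurable fun y => w (x - y) := fun x => hw.comp (by fun_prop)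
  have hm' : ∀ y, Measurable fun x => w (x - y) := fun y => hw.comp (by fun_prop)
  have key : ∀ x, (∫⁻ y, w (x - y) * f y) ^ 2 ≤
      2 * (∫⁻ z, w z) * ∫⁻ y, w (x - y) * f y ^ 2 := by
    intro x
    have hwf : AEMeasurable (fun y => w (x - y) * f y) volume := (hm x).aemeasurable.mul hf
    have hwf2 : AEMeasurable (fun y => w (x - y) * f y ^ 2) volume :=
      (hm x).aemeasurable.mul (hf.pow_const 2)
    calc (∫⁻ y, w (x - y) * f y) ^ 2
        = ∫⁻ y, ∫⁻ z, (w (x - y) * f y) * (w (x - z) * f z) := by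
          simp_rw [lintegral_const_mul'' _ hwf]
          rw [lintegral_mul_const'' _ hwf, sq]
      _ ≤ ∫⁻ y, ∫⁻ z, ((w (x - y) * f y ^ 2) * w (x - z) + w (x - y) * (w (x - z) * f z ^ 2)) := by
          refine lintegral_mono fun y => lintegral_mono fun z => ?_
          calc (w (x - y) * f y) * (w (x - z) * f z)
              = w (x - y) * w (x - z) * (f y * f z) := by ring
            _ ≤ w (x - y) * w (x - z) * (f y ^ 2 + f z ^ 2) := by
              gcongr; exact ENNReal.mul_le_sq_add_sq _ _
            _ = _ := by ring
      _ = ∫⁻ y, ((w (x - y) * f y ^ 2) * (∫⁻ z, w z) +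
            w (x - y) * ∫⁻ z, w (x - z) * f z ^ 2) := by
          refine lintegral_congr fun y => ?_
          rw [lintegral_add_left ((hm x).const_mul _), lintegral_const_mul _ (hm x), hwl,
            lintegral_const_mul'' _ hwf2]
      _ = _ := by
          rw [lintegral_add_left' (hwf2.mul_const _), lintegral_mul_const'' _ hwf2,
            lintegral_mul_const _ (hm x), hwl]
          ring
  calc ∫⁻ x, (∫⁻ y, w (x - y) * f y) ^ 2
      ≤ ∫⁻ x, 2 * (∫⁻ z, w z) * ∫⁻ y, w (x - y) * f y ^ 2 := lintegral_mono key
    _ = 2 * (∫⁻ z, w z) * ∫⁻ x, ∫⁻ y, w (x - y) * f y ^ 2 :=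
        lintegral_const_mul'' _ hwfm.lintegral_prod_right'
    _ = 2 * (∫⁻ z, w z) * ∫⁻ y, ∫⁻ x, w (x - y) * f y ^ 2 := by
        rw [lintegral_lintegral_swap (μ := volume) (ν := volume)
            (f := fun x y => w (x - y) * f y ^ 2) (by exact hwfm)]
    _ = _ := by
        have : ∀ y, ∫⁻ x, w (x - y) * f y ^ 2 = (∫⁻ z, w z) * f y ^ 2 := fun y => by
          rw [lintegral_mul_const _ (hm' y), hwr]
        simp_rw [this]
        rw [lintegral_const_mul'' _ (hf.pow_const 2)]
        ring

theorem lintegral_ofReal_div_one_add_sq {C h : ℝ} (hC : 0 ≤ C) (hh : 0 < h) :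
    ∫⁻ z : ℝ, ENNReal.ofReal (C / (1 + (z / h) ^ 2)) = ENNReal.ofReal (C * π * h) := by
  have hkint : Integrable (fun z : ℝ => C / (1 + (z / h) ^ 2)) := by
    simpa [div_eq_mul_inv] using
      ((integrable_inv_one_add_sq).comp_div hh.ne').const_mul C
  rw [← ofReal_integral_eq_lintegral_ofReal hkint (Eventually.of_forall fun z => by positivity)]
  congr 1
  have := Measure.integral_comp_div (fun z : ℝ => C / (1 + z ^ 2)) h
  rw [this, abs_of_pos hh]
  simp only [div_eq_mul_inv, integral_const_mul, integral_univ_inv_one_add_sq, smul_eq_mul]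
  ring

theorem lintegral_Oph_sq_le {a : ℝ × ℝ → ℂ} (has : ContDiff ℝ ∞ a) (hac : HasCompactSupport a) :
    ∃ C, 0 ≤ C ∧ ∀ h : ℝ, 0 < h → ∀ u : ℝ → ℂ, AEMeasurable u volume →
      ∫⁻ x, ‖Oph h a u x‖ₑ ^ 2 ≤ ENNReal.ofReal C * ∫⁻ x, ‖u x‖ₑ ^ 2 := by
  obtain ⟨C, hC0, hC⟩ := norm_symbol_kernel_le has hac
  refine ⟨C ^ 2 / 2, by positivity, fun h hh u hu => ?_⟩
  set C' := C / (2 * π * h) with hC'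
  have hC'0 : 0 ≤ C' := by positivity
  have hm : Measurable fun z : ℝ => ENNReal.ofReal (C' / (1 + (z / h) ^ 2)) := by fun_prop
  calc ∫⁻ x, ‖Oph h a u x‖ₑ ^ 2
      ≤ ∫⁻ x, (∫⁻ y, ENNReal.ofReal (C' / (1 + ((x - y) / h) ^ 2)) * ‖u y‖ₑ) ^ 2 := by
        refine lintegral_mono fun x => ?_
        gcongr
        rw [Oph, ← integral_const_mul]
        refine (enorm_integral_le_lintegral_enorm _).trans (lintegral_mono_ae ?_)
        filter_upwards [Measure.ae_ne volume x] with y hy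
        rw [enorm_mul, enorm_mul, ← mul_assoc, ← enorm_mul]
        gcongr
        rw [← ofReal_norm]
        refine ENNReal.ofReal_le_ofReal ?_
        rw [norm_mul, Complex.norm_real, Real.norm_of_nonneg (by positivity)]
        calc _ ≤ (2 * π * h)⁻¹ * (C / (1 + ((x - y) / h) ^ 2)) := by
              gcongr
              exact hC h hh x y hy.symm
          _ = _ := by rw [hC']; field_simp
    _ ≤ _ := lintegral_convolution_sq_le hm hu.enorm
    _ = _ := by
        rw [lintegral_ofReal_div_one_add_sq hC'0 hh]
        congr 1
        rw [show (2 : ENNReal) = ENNReal.ofReal 2 by simp, ← ENNReal.ofReal_pow (by positivity),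
          ← ENNReal.ofReal_mul (by positivity)]
        congr 1
        rw [hC']
        field_simp

theorem cexp_sub_cexp_eq (p q : ℂ) :
    cexp q - cexp p = (q - p) * ∫ σ in Icc (0 : ℝ) 1, cexp ((1 - σ) * p + σ * q) := by
  have h : ∀ σ : ℝ, HasDerivAt (fun σ : ℝ => cexp ((1 - σ) * p + σ * q))
      ((q - p) * cexp ((1 - σ) * p + σ * q)) σ := fun σ => by
    have h1 : HasDerivAt (fun σ : ℝ => ((1 - σ) * p + σ * q : ℂ)) (q - p) σ := by
      have h0 : HasDerivAt (fun σ : ℝ => (σ : ℂ)) 1 σ := ofRealCLM.hasDerivAt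
      exact (((h0.const_sub 1).mul_const p).add (h0.mul_const q)).congr_deriv (by ring)
    exact h1.cexp.congr_deriv (by ring)
  rw [integral_Icc_eq_integral_Ioc, ← intervalIntegral.integral_of_le zero_le_one,
    ← intervalIntegral.integral_const_mul,
    intervalIntegral.integral_eq_sub_of_hasDerivAt (fun σ _ => h σ)
      (Continuous.intervalIntegrable (by fun_prop) _ _)]
  simp

theorem one_sub_mul_pos {s ρ : ℝ} (hs : 0 < 1 - s) (hρ : ρ ∈ Icc (0 : ℝ) 1) : 0 < 1 - ρ * s := by
  rcases le_or_gt s 0 with h | h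
  · nlinarith [hρ.1]
  · nlinarith [hρ.2]

theorem log_diff_eq {s : ℝ} (hs : 0 < 1 - s) (α β : ℂ) :
    -α * Real.log (1 - s) - β * s =
      s * ∫ ρ in Icc (0 : ℝ) 1, (α * ((1 - ρ * s : ℝ) : ℂ)⁻¹ - β) := by
  have h : ∀ ρ ∈ uIcc (0 : ℝ) 1, HasDerivAt
      (fun ρ : ℝ => -α * (Real.log (1 - ρ * s) : ℂ) - β * s * ρ)
      (s * (α * ((1 - ρ * s : ℝ) : ℂ)⁻¹ - β)) ρ := fun ρ hρ => by
    rw [uIcc_of_le zero_le_one] at hρ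
    have h0 : HasDerivAt (fun ρ : ℝ => (ρ : ℂ)) 1 ρ := ofRealCLM.hasDerivAt
    have h1 : HasDerivAt (fun ρ : ℝ => 1 - ρ * s) (-s) ρ := by
      simpa using ((hasDerivAt_id ρ).mul_const s).const_sub 1
    have h2 := ((h1.log (one_sub_mul_pos hs hρ).ne').ofReal_comp.const_mul (-α)).sub
      (h0.const_mul (β * s))
    exact h2.congr_deriv (by push_cast; ring)
  have hc : ContinuousOn (fun ρ : ℝ => s * (α * ((1 - ρ * s : ℝ) : ℂ)⁻¹ - β)) (uIcc 0 1) := by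
    rw [uIcc_of_le zero_le_one]
    refine continuousOn_const.mul ((continuousOn_const.mul (ContinuousOn.inv₀ (by fun_prop) ?_)).sub
      continuousOn_const)
    exact fun ρ hρ => ofReal_ne_zero.mpr (one_sub_mul_pos hs hρ).ne'
  rw [integral_Icc_eq_integral_Ioc, ← intervalIntegral.integral_of_le zero_le_one,
    ← intervalIntegral.integral_const_mul,
    intervalIntegral.integral_eq_sub_of_hasDerivAt h hc.intervalIntegrable]
  simp

theorem setIntegral_swap_of_continuousOn {X Y : Type*} [TopologicalSpace X] [TopologicalSpace Y]
    [MeasurableSpace X] [MeasurableSpace Y] [OpensMeasurableSpace (X × Y)] [T2Space X] [T2Space Y]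
    [BorelSpace X] [BorelSpace Y] [SecondCountableTopology X]
    {μ : Measure X} {μ' : Measure Y} [IsFiniteMeasureOnCompacts μ] [SFinite μ]
    [IsFiniteMeasureOnCompacts μ'] [SFinite μ'] [IsFiniteMeasureOnCompacts (μ.prod μ')]
    {S : Set X} {J : Set Y} (hS : IsCompact S) (hJ : IsCompact J)
    {F : X → Y → ℂ} (hF : ContinuousOn (Function.uncurry F) (S ×ˢ J)) :
    ∫ x in S, ∫ y in J, F x y ∂μ' ∂μ = ∫ y in J, ∫ x in S, F x y ∂μ ∂μ' := by
  refine integral_integral_swap ?_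
  rw [Measure.prod_restrict]
  exact hF.integrableOn_compact (hS.prod hJ)

theorem cpowR_neg_sub_one {t : ℝ} (ht : 0 < t) (w : ℂ) :
    cpowR t (-w - 1) = cpowR t (-w) * (t : ℂ)⁻¹ := by
  rw [sub_eq_add_neg, cpowR_add, ← cpowR_inv t 1, show (1 : ℂ) = ((1 : ℕ) : ℂ) by simp,
    cpowR_natCast (inv_pos.mpr ht)]
  simp

theorem hasDerivAt_kernel_diff {t z : ℝ} (hp : 0 < 1 - t * z) (α β : ℂ) :
    HasDerivAt (fun t : ℝ => cpowR (1 - t * z) (-α) - cexp (β * (t * z : ℝ)))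
      (z * (α * cpowR (1 - t * z) (-α - 1) - β * cexp (β * (t * z : ℝ)))) t := by
  have hd : HasDerivAt (fun t => t * z) z t := by simpa using (hasDerivAt_id t).mul_const z
  have h1 : HasDerivAt (fun t => cpowR (1 - t * z) (-α))
      (cpowR (1 - t * z) (-α) * (-α * (-z / (1 - t * z) : ℝ))) t :=
    (((hd.const_sub 1).log hp.ne').ofReal_comp.const_mul (-α)).cexp
  have h2 : HasDerivAt (fun t : ℝ => cexp (β * (t * z : ℝ)))
      (cexp (β * (t * z : ℝ)) * (β * z)) t := (hd.ofReal_comp.const_mul β).cexp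
  refine (h1.sub h2).congr_deriv ?_
  rw [cpowR_neg_sub_one hp]
  push_cast
  ring

theorem continuous_mul_of_tsupport {f k : ℝ → ℂ} (hf : Continuous f)
    (hk : ∀ t ∈ tsupport f, ContinuousAt k t) : Continuous fun t => f t * k t :=
  continuous_of_tsupport fun t ht => hf.continuousAt.mul (hk t (tsupport_mul_subset_left ht))

theorem integral_mul_deriv_eq_of_tsupport {k : ℝ → ℝ} (hk : ContDiff ℝ ∞ k)
    (hkc : HasCompactSupport k) {z : ℝ} (hz : z ≠ 0) {D D' : ℝ → ℂ}
    (hDd : ∀ t ∈ tsupport k, HasDerivAt D (z * D' t) t)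
    (hD'c : ∀ t ∈ tsupport k, ContinuousAt D' t) :
    ∫ t, (k t : ℂ) * D' t = -∫ t, ((deriv k t : ℝ) : ℂ) * (D t / z) := by
  have hs1 : tsupport (fun t => (k t : ℂ)) ⊆ tsupport k :=
    closure_mono fun q hq => by simpa using hq
  have hs2 : tsupport (fun t => ((deriv k t : ℝ) : ℂ)) ⊆ tsupport k :=
    (closure_mono fun q hq => by simpa using hq).trans (tsupport_deriv_subset (f := k))
  have hkd : Continuous (deriv k) := hk.continuous_deriv (by simp)
  have c0 : Continuous fun t => (k t : ℂ) * D t :=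
    continuous_mul_of_tsupport (continuous_ofReal.comp hk.continuous)
      fun t ht => (hDd t (hs1 ht)).continuousAt
  have c1 : Continuous fun t => (k t : ℂ) * D' t :=
    continuous_mul_of_tsupport (continuous_ofReal.comp hk.continuous) fun t ht => hD'c t (hs1 ht)
  have c2 : Continuous fun t => ((deriv k t : ℝ) : ℂ) * D t :=
    continuous_mul_of_tsupport (continuous_ofReal.comp hkd)
      fun t ht => (hDd t (hs2 ht)).continuousAt
  have hcs : ∀ {f F : ℝ → ℂ}, tsupport f ⊆ tsupport k → Continuous (fun t => f t * F t) →
      Integrable fun t => f t * F t := fun hf hc =>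
    hc.integrable_of_hasCompactSupport
      (hkc.isCompact.of_isClosed_subset (isClosed_tsupport _) (tsupport_mul_subset_left.trans hf))
  have hder : ∀ t, HasDerivAt (fun t => (k t : ℂ) * D t)
      (((deriv k t : ℝ) : ℂ) * D t + z * ((k t : ℂ) * D' t)) t := fun t => by
    have hkt : HasDerivAt (fun t => (k t : ℂ)) ((deriv k t : ℝ) : ℂ) t :=
      ((hk.differentiable (by simp)) t).hasDerivAt.ofReal_comp
    by_cases ht : t ∈ tsupport k
    · exact (hkt.mul (hDd t ht)).congr_deriv (by ring)
    · have h0 := notMem_tsupport_iff_eventuallyEq.mp ht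
      have e1 : deriv k t = 0 := by rw [h0.deriv_eq]; simp
      rw [e1, h0.eq_of_nhds]
      simp only [Pi.zero_apply, ofReal_zero, zero_mul, mul_zero, add_zero]
      refine (hasDerivAt_const t (0 : ℂ)).congr_of_eventuallyEq ?_
      filter_upwards [h0] with s hs
      simp [hs]
  have i1 := hcs hs1 c1
  have i2 := hcs hs2 c2
  have h0 := integral_eq_zero_of_hasDerivAt_of_integrable hder (i2.add (i1.const_mul _))
    (hcs hs1 c0)
  rw [integral_add i2 (i1.const_mul _), integral_const_mul] at h0
  have hz' : (z : ℂ) ≠ 0 := ofReal_ne_zero.mpr hz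
  simp_rw [← mul_div_assoc]
  rw [integral_div, ← neg_div, eq_div_iff hz']
  linear_combination h0

theorem integral_mul_kernel_diff {k : ℝ → ℝ} (hk : ContDiff ℝ ∞ k) (hkc : HasCompactSupport k)
    {z : ℝ} (hz : z ≠ 0) (hpos : ∀ t ∈ tsupport k, 0 < 1 - t * z) (α β : ℂ) :
    ∫ t, (k t : ℂ) * (α * cpowR (1 - t * z) (-α - 1) - β * cexp (β * (t * z : ℝ))) =
      -∫ t, ((deriv k t : ℝ) : ℂ) * ((cpowR (1 - t * z) (-α) - cexp (β * (t * z : ℝ))) / z) := by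
  refine integral_mul_deriv_eq_of_tsupport hk hkc hz
    (fun t ht => hasDerivAt_kernel_diff (hpos t ht) α β) fun t ht => ?_
  refine ContinuousAt.sub (ContinuousAt.mul continuousAt_const ?_) (by fun_prop)
  exact continuousAt_cpowR (f := fun t => 1 - t * z) (w := fun _ => -α - 1) (by fun_prop)
    continuousAt_const (hpos t ht).ne'

theorem kernel_diff_div_eq {t z : ℝ} (hz : z ≠ 0) (hp : 0 < 1 - t * z) (α β : ℂ) :
    (cpowR (1 - t * z) (-α) - cexp (β * (t * z : ℝ))) / z =
      t * ((∫ ρ in Icc (0 : ℝ) 1, (α * ((1 - ρ * (t * z) : ℝ) : ℂ)⁻¹ - β)) *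
        ∫ σ in Icc (0 : ℝ) 1, cexp ((1 - σ) * (β * (t * z : ℝ))
          + σ * (-α * Real.log (1 - t * z)))) := by
  have hz' : (z : ℂ) ≠ 0 := ofReal_ne_zero.mpr hz
  rw [cpowR, cexp_sub_cexp_eq, log_diff_eq hp, div_eq_iff hz']
  push_cast
  ring

/-- The kernel obtained by interpolating between `exp (β t z)` and `(1 - t z)^(-α)`. -/
def interpKer (α β : ℂ) (z : ℝ) (q : ℝ × ℝ × ℝ) : ℂ :=
  q.1 * ((α * ((1 - q.2.1 * (q.1 * z) : ℝ) : ℂ)⁻¹ - β) *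
    cexp ((1 - q.2.2) * (β * (q.1 * z : ℝ)) + q.2.2 * (-α * Real.log (1 - q.1 * z))))

theorem continuousAt_interpKer {z : ℝ} {q : ℝ × ℝ × ℝ} (hp : 0 < 1 - q.1 * z)
    (hq : q.2.1 ∈ Icc (0 : ℝ) 1) (α β : ℂ) :
    ContinuousAt (fun p : ℝ × (ℝ × ℝ × ℝ) => interpKer α β p.1 p.2) (z, q) := by
  have h1 : ContinuousAt (fun p : ℝ × (ℝ × ℝ × ℝ) => (p.2.1 : ℂ)) (z, q) := by fun_prop
  have h2 : ContinuousAt (fun p : ℝ × (ℝ × ℝ × ℝ) =>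
      ((1 - p.2.2.1 * (p.2.1 * p.1) : ℝ) : ℂ)⁻¹) (z, q) :=
    ContinuousAt.inv₀ (by fun_prop) (ofReal_ne_zero.mpr (one_sub_mul_pos hp hq).ne')
  have h3 : ContinuousAt (fun p : ℝ × (ℝ × ℝ × ℝ) => (Real.log (1 - p.2.1 * p.1) : ℂ)) (z, q) :=
    continuous_ofReal.continuousAt.comp (ContinuousAt.log (by fun_prop) hp.ne')
  exact h1.mul (((continuousAt_const.mul h2).sub continuousAt_const).mul
    (ContinuousAt.cexp (ContinuousAt.add (by fun_prop)
      (ContinuousAt.mul (by fun_prop) (continuousAt_const.mul h3)))))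

theorem setIntegral_interpKer {S : Set ℝ} (hS : IsCompact S) {z : ℝ} (hz : z ≠ 0)
    (hpos : ∀ t ∈ S, 0 < 1 - t * z) (α β : ℂ) {k : ℝ → ℂ} (hk : Continuous k) :
    ∫ t in S, k t * ((cpowR (1 - t * z) (-α) - cexp (β * (t * z : ℝ))) / z) =
      ∫ q in S ×ˢ (Icc (0 : ℝ) 1 ×ˢ Icc (0 : ℝ) 1), k q.1 * interpKer α β z q := by
  have hS' := hS.prod ((isCompact_Icc (a := (0 : ℝ)) (b := 1)).prod
    (isCompact_Icc (a := (0 : ℝ)) (b := 1)))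
  have hcont : ContinuousOn (fun q : ℝ × ℝ × ℝ => k q.1 * interpKer α β z q)
      (S ×ˢ (Icc (0 : ℝ) 1 ×ˢ Icc (0 : ℝ) 1)) := by
    intro q hq
    refine ContinuousAt.continuousWithinAt (ContinuousAt.mul (by fun_prop) ?_)
    exact (continuousAt_interpKer (hpos _ hq.1) hq.2.1 α β).comp
      (f := fun q : ℝ × ℝ × ℝ => (z, q)) (by fun_prop)
  have hkint : IntegrableOn (fun q : ℝ × ℝ × ℝ => k q.1 * interpKer α β z q)
      (S ×ˢ (Icc (0 : ℝ) 1 ×ˢ Icc (0 : ℝ) 1)) (volume.prod volume) :=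
    hcont.integrableOn_compact hS'
  rw [Measure.volume_eq_prod, setIntegral_prod _ hkint]
  refine setIntegral_congr_fun hS.measurableSet fun t ht => ?_
  simp only [interpKer]
  rw [integral_const_mul, integral_const_mul, kernel_diff_div_eq hz (hpos t ht),
    Measure.volume_eq_prod, ← setIntegral_prod_mul]

theorem norm_setIntegral_mul_kernel_diff_le {x₀ x₁ δ x K : ℝ} (hδ : 0 < δ) (hx : x ∈ Icc x₀ x₁)
    {k : ℝ → ℝ} (hk : ContDiff ℝ ∞ k) (hks : ∀ t ∈ tsupport k, (x, t) ∈ goodSet x₀ x₁ δ)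
    (hk1 : ∀ t, |t| < K → deriv k t = 0) {M : ℝ} (hM : ∀ t, |deriv k t| ≤ M)
    {g : ℝ → ℂ} (hg : Continuous g) (hg0 : ∀ y, y ∉ Icc x₀ x₁ → g y = 0) {α β : ℂ} {b : ℝ} (hb0 : 0 ≤ b)
    (hb : ∀ t, (x, t) ∈ goodSet x₀ x₁ δ → K ≤ |t| → ∀ ρ ∈ Icc (0 : ℝ) 1, ∀ σ ∈ Icc (0 : ℝ) 1,
      ‖∫ y : ℝ, cexp ((1 - σ) * (β * (t * (y - x) : ℝ))
          + σ * (-α * Real.log (1 - t * (y - x)))) *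
        ((1 - ρ * (t * (y - x)) : ℝ) : ℂ)⁻¹ * g y‖ ≤ b) :
    ‖∫ t, (k t : ℂ) * ∫ y, (α * cpowR (1 - t * (y - x)) (-α - 1)
        - β * cexp (β * (t * (y - x) : ℝ))) * g y‖ ≤
      M * (δ⁻¹ * ((‖α‖ + ‖β‖) * b)) * (2 * δ⁻¹) := by
  set S : Set ℝ := {t | (x, t) ∈ goodSet x₀ x₁ δ} with hSdef
  have hSsub : S ⊆ Icc (-δ⁻¹) δ⁻¹ := by
    rintro t ⟨-, h1, h2⟩
    simp only [mem_Icc] at *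
    constructor
    · rw [← neg_le_neg_iff, neg_neg, ← one_div, le_div_iff₀ hδ]
      by_cases ht : 0 ≤ t <;> nlinarith
    · rw [← one_div, le_div_iff₀ hδ]
      by_cases ht : 0 ≤ t <;> nlinarith
  have hS : IsCompact S := isCompact_Icc.of_isClosed_subset
    ((goodSet_isCompact hδ).isClosed.preimage (by fun_prop : Continuous fun t : ℝ => (x, t))) hSsub
  have hJ : IsCompact (Icc x₀ x₁) := isCompact_Icc
  have hpos : ∀ t ∈ S, ∀ y ∈ Icc x₀ x₁, 0 < 1 - t * (y - x) := fun t ht y hy => goodSet_pos hδ ht hy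
  have hkS : ∀ t ∉ S, k t = 0 := fun t ht => image_eq_zero_of_notMem_tsupport fun h => ht (hks t h)
  have hkdS : ∀ t ∉ S, deriv k t = 0 := fun t ht =>
    image_eq_zero_of_notMem_tsupport fun h => ht (hks t (tsupport_deriv_subset h))
  have hkc : HasCompactSupport k := hS.of_isClosed_subset (isClosed_tsupport _) hks
  have hkd : Continuous (deriv k) := hk.continuous_deriv (by simp)
  have hkC : Continuous fun t => (k t : ℂ) := continuous_ofReal.comp hk.continuous
  have hkdC : Continuous fun t => ((deriv k t : ℝ) : ℂ) := continuous_ofReal.comp hkd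
  have hS' := hS.prod ((isCompact_Icc (a := (0 : ℝ)) (b := 1)).prod
    (isCompact_Icc (a := (0 : ℝ)) (b := 1)))
  set T := S ×ˢ (Icc (0 : ℝ) 1 ×ˢ Icc (0 : ℝ) 1) with hT
  have e1 : ∫ t, (k t : ℂ) * ∫ y, (α * cpowR (1 - t * (y - x)) (-α - 1)
        - β * cexp (β * (t * (y - x) : ℝ))) * g y =
      ∫ t in S, ∫ y in Icc x₀ x₁, k t * ((α * cpowR (1 - t * (y - x)) (-α - 1)
        - β * cexp (β * (t * (y - x) : ℝ))) * g y) := by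
    rw [← setIntegral_eq_integral_of_forall_compl_eq_zero (s := S)
      (fun t ht => by rw [hkS t ht]; simp)]
    refine setIntegral_congr_fun hS.measurableSet fun t _ => ?_
    rw [integral_const_mul, setIntegral_eq_integral_of_forall_compl_eq_zero
      (fun y hy => by rw [hg0 y hy, mul_zero])]
  have e2 : ∫ t in S, ∫ y in Icc x₀ x₁, (k t : ℂ) * ((α * cpowR (1 - t * (y - x)) (-α - 1)
        - β * cexp (β * (t * (y - x) : ℝ))) * g y) =
      ∫ y in Icc x₀ x₁, ∫ t in S, (k t : ℂ) * ((α * cpowR (1 - t * (y - x)) (-α - 1)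
        - β * cexp (β * (t * (y - x) : ℝ))) * g y) := by
    refine setIntegral_swap_of_continuousOn hS hJ fun p hp => ContinuousAt.continuousWithinAt ?_
    have c1 : ContinuousAt (fun p : ℝ × ℝ => cpowR (1 - p.1 * (p.2 - x)) (-α - 1)) p :=
      continuousAt_cpowR (f := fun p : ℝ × ℝ => 1 - p.1 * (p.2 - x)) (w := fun _ => -α - 1)
        (by fun_prop) continuousAt_const (hpos _ hp.1 _ hp.2).ne'
    have c2 : ContinuousAt (fun p : ℝ × ℝ => β * cexp (β * (p.1 * (p.2 - x) : ℝ))) p := by fun_prop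
    have c3 : ContinuousAt (fun p : ℝ × ℝ => (k p.1 : ℂ)) p :=
      (hkC.comp continuous_fst).continuousAt
    have c4 : ContinuousAt (fun p : ℝ × ℝ => g p.2) p := by fun_prop
    exact c3.mul (((continuousAt_const.mul c1).sub c2).mul c4)
  have e3 : ∫ y in Icc x₀ x₁, ∫ t in S, (k t : ℂ) * ((α * cpowR (1 - t * (y - x)) (-α - 1)
        - β * cexp (β * (t * (y - x) : ℝ))) * g y) =
      ∫ y in Icc x₀ x₁, ∫ q in T, -(((deriv k q.1 : ℝ) : ℂ) * interpKer α β (y - x) q * g y) := by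
    refine integral_congr_ae ?_
    rw [Filter.EventuallyEq, ae_restrict_iff' measurableSet_Icc]
    filter_upwards [Measure.ae_ne volume x] with y hyx hy
    have hz : y - x ≠ 0 := sub_ne_zero.mpr hyx
    rw [integral_neg, integral_mul_const, ← setIntegral_interpKer hS hz
      (fun t ht => hpos t ht y hy) α β hkdC]
    simp_rw [← mul_assoc]
    rw [integral_mul_const, ← neg_mul]
    congr 1
    rw [setIntegral_eq_integral_of_forall_compl_eq_zero (fun t ht => by rw [hkS t ht]; simp),
      setIntegral_eq_integral_of_forall_compl_eq_zero (fun t ht => by rw [hkdS t ht]; simp),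
      integral_mul_kernel_diff hk hkc hz (fun t ht => hpos t (hks t ht) y hy)]
  have e4 : ∫ y in Icc x₀ x₁, ∫ q in T, -(((deriv k q.1 : ℝ) : ℂ) * interpKer α β (y - x) q * g y) =
      ∫ q in T, ∫ y in Icc x₀ x₁, -(((deriv k q.1 : ℝ) : ℂ) * interpKer α β (y - x) q * g y) := by
    refine setIntegral_swap_of_continuousOn hJ hS' fun p hp => ContinuousAt.continuousWithinAt ?_
    have c1 : ContinuousAt (fun p : ℝ × (ℝ × ℝ × ℝ) => interpKer α β (p.1 - x) p.2) p :=
      (continuousAt_interpKer (hpos _ hp.2.1 _ hp.1) hp.2.2.1 α β).comp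
        (f := fun p : ℝ × (ℝ × ℝ × ℝ) => (p.1 - x, p.2)) (by fun_prop)
    have c3 : ContinuousAt (fun p : ℝ × (ℝ × ℝ × ℝ) => ((deriv k p.2.1 : ℝ) : ℂ)) p :=
      (hkdC.comp (continuous_fst.comp continuous_snd)).continuousAt
    have c4 : ContinuousAt (fun p : ℝ × (ℝ × ℝ × ℝ) => g p.1) p := by fun_prop
    exact ((c3.mul c1).mul c4).neg
  rw [e1, e2, e3, e4]
  have hM0 : 0 ≤ M := (abs_nonneg _).trans (hM 0)
  have hvol : (volume T).toReal ≤ 2 * δ⁻¹ := by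
    rw [hT, Measure.volume_eq_prod, Measure.prod_prod, Measure.volume_eq_prod, Measure.prod_prod]
    simp only [Real.volume_Icc, sub_zero, ENNReal.ofReal_one, mul_one]
    refine ENNReal.toReal_le_of_le_ofReal (by positivity) ((measure_mono hSsub).trans ?_)
    rw [Real.volume_Icc]
    exact ENNReal.ofReal_le_ofReal (by linarith)
  have hpt : ∀ q ∈ T, ‖∫ y in Icc x₀ x₁, -(((deriv k q.1 : ℝ) : ℂ) * interpKer α β (y - x) q * g y)‖
      ≤ M * (δ⁻¹ * ((‖α‖ + ‖β‖) * b)) := by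
    rintro ⟨t, ρ, σ⟩ ⟨htS, hρ, hσ⟩
    simp only at htS hρ hσ
    by_cases htK : |t| < K
    · simp only [hk1 t htK, ofReal_zero, zero_mul, neg_zero, integral_zero, norm_zero]
      positivity
    · rw [not_lt] at htK
      set E : ℝ → ℝ → ℂ := fun r y => cexp ((1 - σ) * (β * (t * (y - x) : ℝ))
          + σ * (-α * Real.log (1 - t * (y - x)))) *
        ((1 - r * (t * (y - x)) : ℝ) : ℂ)⁻¹ * g y with hE
      have hEi : ∀ r ∈ Icc (0 : ℝ) 1, Integrable (E r) := fun r hr => by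
        have hc : ContinuousOn (E r) (Icc x₀ x₁) := fun y hy => by
          have hp := hpos t htS y hy
          have h2 : ContinuousAt (fun y : ℝ => ((1 - r * (t * (y - x)) : ℝ) : ℂ)⁻¹) y :=
            ContinuousAt.inv₀ (by fun_prop) (ofReal_ne_zero.mpr (one_sub_mul_pos hp hr).ne')
          have h3 : ContinuousAt (fun y : ℝ => (Real.log (1 - t * (y - x)) : ℂ)) y :=
            continuous_ofReal.continuousAt.comp (ContinuousAt.log (by fun_prop) hp.ne')
          exact (((ContinuousAt.add (by fun_prop)
            (continuousAt_const.mul (continuousAt_const.mul h3))).cexp.mul h2).mul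
              hg.continuousAt).continuousWithinAt
        rw [← integrableOn_iff_integrable_of_support_subset (s := Icc x₀ x₁)]
        · exact hc.integrableOn_compact hJ
        · intro y hy
          by_contra hn
          exact hy (by simp only [hE, hg0 y hn, mul_zero])
      have key : ∫ y in Icc x₀ x₁, -(((deriv k t : ℝ) : ℂ) * interpKer α β (y - x) (t, ρ, σ) * g y)
          = -((deriv k t : ℝ) : ℂ) * t * (α * (∫ y, E ρ y) - β * ∫ y, E 0 y) := by
        rw [setIntegral_eq_integral_of_forall_compl_eq_zero
          (fun y hy => by rw [hg0 y hy, mul_zero, neg_zero]), ← integral_const_mul,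
          ← integral_const_mul, ← integral_sub ((hEi ρ hρ).const_mul _)
            ((hEi 0 (by simp)).const_mul _), ← integral_const_mul]
        congr 1
        funext y
        simp only [hE, interpKer]
        push_cast
        ring
      rw [key, norm_mul, norm_mul, norm_neg, Complex.norm_real, Complex.norm_real, mul_assoc]
      gcongr
      · exact hM t
      · exact abs_le.mpr (hSsub htS)
      · refine (norm_sub_le _ _).trans ?_
        rw [norm_mul, norm_mul, add_mul]
        gcongr
        · exact hb t htS htK ρ hρ σ hσ
        · exact hb t htS htK 0 (by simp) σ hσ
  refine (norm_setIntegral_le_of_norm_le_const hS'.measure_lt_top hpt).trans ?_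
  gcongr
  exact hvol

theorem integrable_modulated_fourier {g : ℝ → ℂ} (hg : ContDiff ℝ ∞ g) (hgc : HasCompactSupport g)
    {h : ℝ} (hh : 0 < h) (x : ℝ) :
    Integrable (fun t : ℝ => ∫ y : ℝ, cexp (-(2 * I / h) * (t * (y - x) : ℝ)) * g y) ∧
      ∫ t : ℝ, ∫ y : ℝ, cexp (-(2 * I / h) * (t * (y - x) : ℝ)) * g y = π * h * g x := by
  have hh' : (h : ℂ) ≠ 0 := by exact_mod_cast hh.ne'
  have hπ : (π : ℂ) ≠ 0 := by exact_mod_cast Real.pi_ne_zero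
  have hph : 0 < π * h := by positivity
  have hF : Integrable (𝓕 g) volume := by
    have := (𝓕 (hgc.toSchwartzMap hg)).integrable (μ := volume)
    rwa [SchwartzMap.fourier_coe] at this
  have hinv : ∫ v : ℝ, cexp ((2 * π * (v * x) : ℝ) * I) * 𝓕 g v = g x := by
    have h1 := congrFun (hg.continuous.fourierInv_fourier_eq
      (hg.continuous.integrable_of_hasCompactSupport hgc) hF) x
    rw [Real.fourierInv_eq'] at h1
    rw [← h1]
    refine integral_congr_ae (Eventually.of_forall fun v => ?_)
    simp [mul_comm x v]
  have hFx : Integrable (fun v : ℝ => cexp ((2 * π * (v * x) : ℝ) * I) * 𝓕 g v) := by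
    refine hF.bdd_mul (c := 1) (by fun_prop : Continuous fun v : ℝ =>
      cexp ((2 * π * (v * x) : ℝ) * I)).aestronglyMeasurable (Eventually.of_forall fun v => ?_)
    rw [Complex.norm_exp_ofReal_mul_I]
  have key : (fun t : ℝ => ∫ y : ℝ, cexp (-(2 * I / h) * (t * (y - x) : ℝ)) * g y) =
      fun t => (fun v : ℝ => cexp ((2 * π * (v * x) : ℝ) * I) * 𝓕 g v) (t / (π * h)) := by
    ext t
    simp only
    rw [Real.fourier_real_eq_integral_exp_smul, ← integral_const_mul]
    refine integral_congr_ae (Eventually.of_forall fun y => ?_)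
    simp only [smul_eq_mul, ← mul_assoc, ← Complex.exp_add]
    congr 2
    push_cast
    field_simp
    ring
  rw [key]
  refine ⟨hFx.comp_div hph.ne', ?_⟩
  rw [Measure.integral_comp_div (fun v : ℝ => cexp ((2 * π * (v * x) : ℝ) * I) * 𝓕 g v), hinv,
    abs_of_pos hph, Complex.real_smul]
  push_cast
  ring

theorem norm_integral_cut_sub_le {k : ℝ → ℝ} (hk : Continuous k) {L M : ℝ} (hL : 1 ≤ L)
    (hk1 : ∀ t, |t| < L → k t = 1) (hM : ∀ t, |k t| ≤ M) {G : ℝ → ℂ} (hG : Integrable G)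
    {C h : ℝ} (hh : 0 < h) {N : ℕ} (hC : 0 ≤ C)
    (hb : ∀ t, L ≤ |t| → ‖G t‖ ≤ C * (h / |t|) ^ (N + 2)) :
    Integrable (fun t => (k t : ℂ) * G t) ∧
    ‖(∫ t, (k t : ℂ) * G t) - ∫ t, G t‖ ≤ (M + 1) * (C * h ^ (N + 2)) * 2 * π := by
  have hM0 : 0 ≤ M := (abs_nonneg _).trans (hM 0)
  have hkG : Integrable fun t => (k t : ℂ) * G t :=
    hG.bdd_mul (c := M) (continuous_ofReal.comp hk).aestronglyMeasurable
      (Eventually.of_forall fun t => by simpa using hM t)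
  refine ⟨hkG, ?_⟩
  rw [← integral_sub hkG hG]
  have hkint : Integrable fun t : ℝ => (M + 1) * (C * h ^ (N + 2)) * 2 * (1 + t ^ 2)⁻¹ :=
    integrable_inv_one_add_sq.const_mul _
  refine (norm_integral_le_of_norm_le hkint (Eventually.of_forall fun t => ?_)).trans ?_
  · by_cases ht : |t| < L
    · rw [hk1 t ht]
      simp only [ofReal_one, one_mul, sub_self, norm_zero]
      positivity
    · rw [not_lt] at ht
      have ht1 : 1 ≤ |t| := hL.trans ht
      rw [← sub_one_mul, norm_mul]
      have e1 : ‖(k t : ℂ) - 1‖ ≤ M + 1 := by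
        refine (norm_sub_le _ _).trans ?_
        simpa using hM t
      have e2 : C * (h / |t|) ^ (N + 2) ≤ C * h ^ (N + 2) * 2 * (1 + t ^ 2)⁻¹ := by
        rw [div_pow, mul_div_assoc', mul_assoc (C * h ^ (N + 2)), div_eq_mul_inv]
        refine mul_le_mul_of_nonneg_left ?_ (by positivity)
        have e3 : |t| ^ 2 ≤ |t| ^ (N + 2) := pow_le_pow_right₀ ht1 (by omega)
        rw [← div_eq_mul_inv, inv_eq_one_div, div_le_div_iff₀ (by positivity) (by positivity)]
        nlinarith [sq_abs t]
      calc ‖(k t : ℂ) - 1‖ * ‖G t‖ ≤ (M + 1) * (C * h ^ (N + 2) * 2 * (1 + t ^ 2)⁻¹) :=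
            mul_le_mul e1 ((hb t ht).trans e2) (norm_nonneg _) (by positivity)
        _ = _ := by ring
  · rw [integral_const_mul, integral_univ_inv_one_add_sq]

section RecipCut

variable {Ω : ℝ → ℝ} {A B x₀ x₁ δ K : ℝ}

theorem hasDerivAt_recipCut_slice (hΩ : ContDiff ℝ ∞ Ω) (h1 : ∀ x, x ∉ Icc A B → Ω x = 1) (x t : ℝ) :
    HasDerivAt (fun t => recipCut Ω (x, t)) (fderiv ℝ (recipCut Ω) (x, t) (0, 1)) t := by
  have hd := ((recipCut_contDiff hΩ h1).differentiable (by simp) (x, t)).hasFDerivAt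
  exact hd.comp_hasDerivAt t ((hasDerivAt_const t x).prodMk (hasDerivAt_id t))

theorem recipCut_slice_mem_goodSet (hδ : 0 < δ) (h0 : ∀ y ∈ Ioo (x₀ - δ) (x₁ + δ), Ω y = 0)
    {x : ℝ} (hx : x ∈ Icc x₀ x₁) {t : ℝ} (ht : t ∈ tsupport fun t => recipCut Ω (x, t)) :
    (x, t) ∈ goodSet x₀ x₁ δ :=
  mem_goodSet_of_mem_tsupport hδ h0 hx
    (tsupport_comp_subset_preimage (recipCut Ω) (f := fun t : ℝ => (x, t)) (by fun_prop) ht)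

theorem recipCut_bounds (hΩ : ContDiff ℝ ∞ Ω) (h1 : ∀ x, x ∉ Icc A B → Ω x = 1) (hδ : 0 < δ)
    (h0 : ∀ y ∈ Ioo (x₀ - δ) (x₁ + δ), Ω y = 0) :
    ∃ M, ∀ x ∈ Icc x₀ x₁, ∀ t, |recipCut Ω (x, t)| ≤ M ∧
      |deriv (fun t => recipCut Ω (x, t)) t| ≤ M := by
  have hsm := recipCut_contDiff hΩ h1
  have hc : Continuous fun p : ℝ × ℝ => fderiv ℝ (recipCut Ω) p (0, 1) :=
    (hsm.continuous_fderiv (by simp)).clm_apply continuous_const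
  obtain ⟨M₁, hM₁⟩ := (goodSet_isCompact (x₀ := x₀) (x₁ := x₁) hδ).exists_bound_of_continuousOn
    hsm.continuous.continuousOn
  obtain ⟨M₂, hM₂⟩ := (goodSet_isCompact (x₀ := x₀) (x₁ := x₁) hδ).exists_bound_of_continuousOn
    hc.continuousOn
  refine ⟨max 0 (max M₁ M₂), fun x hx t => ⟨?_, ?_⟩⟩
  · by_cases ht : (x, t) ∈ goodSet x₀ x₁ δ
    · exact (hM₁ _ ht).trans ((le_max_left _ _).trans (le_max_right _ _))
    · rw [image_eq_zero_of_notMem_tsupport (f := recipCut Ω)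
        fun h => ht (mem_goodSet_of_mem_tsupport hδ h0 hx h)]
      simp
  · by_cases ht : (x, t) ∈ goodSet x₀ x₁ δ
    · rw [(hasDerivAt_recipCut_slice hΩ h1 x t).deriv]
      exact (hM₂ _ ht).trans ((le_max_right _ _).trans (le_max_right _ _))
    · rw [image_eq_zero_of_notMem_tsupport (f := deriv fun t => recipCut Ω (x, t))
        fun h => ht (recipCut_slice_mem_goodSet hδ h0 hx (tsupport_deriv_subset h))]
      simp

theorem deriv_recipCut_slice_eq_zero (hK : 0 < K) (hKI : 10 * K * (x₁ - x₀) ≤ 1)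
    (h1 : ∀ x, x ∉ Icc (x₀ - 1 / (10 * K)) (x₁ + 1 / (10 * K)) → Ω x = 1) {x t : ℝ}
    (hx : x ∈ Icc x₀ x₁) (ht : |t| < 5 * K) : deriv (fun t => recipCut Ω (x, t)) t = 0 := by
  have : (fun t => recipCut Ω (x, t)) =ᶠ[𝓝 t] fun _ => 1 := by
    filter_upwards [(isOpen_lt continuous_abs continuous_const).mem_nhds ht] with s hs
    exact recipCut_eq_one hK hKI h1 hx hs
  rw [this.deriv_eq, deriv_const]

end RecipCut

theorem goodSet_slice_isCompact {x₀ x₁ δ : ℝ} (hδ : 0 < δ) (x : ℝ) :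
    IsCompact {t : ℝ | (x, t) ∈ goodSet x₀ x₁ δ} := by
  have h := (goodSet_isCompact (x₀ := x₀) (x₁ := x₁) hδ)
  have h2 := (h.inter_right (isClosed_singleton.preimage continuous_fst : IsClosed
    (Prod.fst ⁻¹' {x} : Set (ℝ × ℝ)))).image continuous_snd
  convert h2 using 1
  ext t
  simp

section WaveError

variable {ν K x₀ x₁ : ℝ} {a : ℝ × ℝ → ℂ}

theorem contDiff_weighted_wave (has : ContDiff ℝ ∞ a) (w : ℂ) (h η : ℝ) :
    ContDiff ℝ ∞ fun y : ℝ => cpowR (jap y) w * wave h a η y := by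
  refine ContDiff.mul (contDiff_iff_contDiffAt.mpr fun y => ContDiffAt.cpowR (f := jap)
    jap_contDiff.contDiffAt (jap_pos _).ne' _) ?_
  unfold wave
  exact ContDiff.mul (ContDiff.cexp (ContDiff.mul (ofRealCLM.contDiff.comp
      (show ContDiff ℝ ∞ fun x : ℝ => 2 * π * x * η by fun_prop)) contDiff_const))
      (has.comp (by fun_prop))

theorem wave_eq_zero (hasupp : tsupport a ⊆ Ioo x₀ x₁ ×ˢ Ioo (-(2 * K)) (2 * K)) {h η y : ℝ}
    (hy : ¬ (y ∈ Icc x₀ x₁ ∧ |2 * π * h * η| ≤ 2 * K)) : wave h a η y = 0 := by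
  rw [wave, image_eq_zero_of_notMem_tsupport (f := a) fun hm => hy ?_, mul_zero]
  have := hasupp hm
  exact ⟨Ioo_subset_Icc_self this.1, abs_le.mpr ⟨this.2.1.le, this.2.2.le⟩⟩

theorem norm_exponent_le (hν : ν ∈ Icc (0 : ℝ) (1 / 2)) {h : ℝ} (hh : 0 < h) (hh1 : h ≤ 1) :
    ‖(2 * ν - 2 * I / h : ℂ)‖ ≤ 3 / h := by
  have e1 : ‖(2 * ν : ℂ)‖ ≤ 1 := by
    rw [norm_mul, norm_real, Real.norm_of_nonneg hν.1]
    norm_num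
    linarith [hν.2]
  have e2 : ‖(2 * I / h : ℂ)‖ = 2 / h := by
    rw [norm_div, norm_mul, norm_real, Real.norm_of_nonneg hh.le]
    simp
  have e3 : 1 ≤ 1 / h := by rw [le_div_iff₀ hh]; linarith
  calc _ ≤ 1 + 2 / h := (norm_sub_le _ _).trans (add_le_add e1 e2.le)
    _ ≤ 1 / h + 2 / h := by linarith
    _ = 3 / h := by ring

theorem norm_wave_error_le (hν : ν ∈ Icc (0 : ℝ) (1 / 2)) (hK : 10 ≤ K)
    (hKI : 10 * K * (x₁ - x₀) ≤ 1) (has : ContDiff ℝ ∞ a)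
    (hasupp : tsupport a ⊆ Ioo x₀ x₁ ×ˢ Ioo (-(2 * K)) (2 * K))
    {Ω : ℝ → ℝ} (hΩ : ContDiff ℝ ∞ Ω)
    (h1 : ∀ x, x ∉ Icc (x₀ - 1 / (10 * K)) (x₁ + 1 / (10 * K)) → Ω x = 1)
    {δ : ℝ} (hδ : 0 < δ) (h0 : ∀ y ∈ Ioo (x₀ - δ) (x₁ + δ), Ω y = 0) (N : ℕ) :
    ∃ C, 0 ≤ C ∧ ∀ h : ℝ, 0 < h → h ≤ 1 → ∀ η : ℝ, |2 * π * h * η| ≤ 2 * K → ∀ x ∈ Icc x₀ x₁,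
      ‖(2 * ν - 2 * I / h : ℂ) * (∫ t : ℝ, (recipCut Ω (x, t) : ℂ) * ∫ y : ℝ,
          cpowR (1 - t * (y - x)) (-(2 * ν - 2 * I / h : ℂ) - 1) *
            (cpowR (jap y) (2 * ν - 2 * I / h - 1) * wave h a η y))
        + 2 * π * I * (cpowR (jap x) (2 * ν - 2 * I / h - 1) * wave h a η x)‖ ≤ C * h ^ N := by
  obtain ⟨M, hM⟩ := recipCut_bounds hΩ h1 hδ h0
  obtain ⟨C₁, hC₁0, hC₁⟩ := norm_integral_interp_le ν hK hKI has hasupp hδ (N + 1)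
  obtain ⟨C₂, hC₂0, hC₂⟩ := norm_integral_far_le ν hK has hasupp (N + 2)
  refine ⟨|M| * (δ⁻¹ * (5 * C₁)) * (2 * δ⁻¹) + 2 * ((|M| + 1) * C₂ * 2 * π), by positivity,
    fun h hh hh1 η hη x hx => ?_⟩
  have hM' : ∀ t, |deriv (fun t => recipCut Ω (x, t)) t| ≤ |M| :=
    fun t => (hM x hx t).2.trans (le_abs_self _)
  have hM'' : ∀ t, |recipCut Ω (x, t)| ≤ |M| := fun t => (hM x hx t).1.trans (le_abs_self _)
  generalize hα : (2 * ν - 2 * I / h : ℂ) = α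
  generalize hβ : -(2 * I / h : ℂ) = β
  have hαn : ‖α‖ ≤ 3 / h := hα ▸ norm_exponent_le hν hh hh1
  have hβn : ‖β‖ = 2 / h := by
    rw [← hβ, norm_neg, norm_div, norm_mul, norm_real, Real.norm_of_nonneg hh.le]; simp
  generalize hgdef : (fun y : ℝ => cpowR (jap y) (α - 1) * wave h a η y) = g
  have hgy : ∀ y, cpowR (jap y) (α - 1) * wave h a η y = g y := fun y => by rw [← hgdef]
  simp only [hgy]
  have hgsm : ContDiff ℝ ∞ g := hgdef ▸ contDiff_weighted_wave has (α - 1) h η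
  have hg0 : ∀ y, y ∉ Icc x₀ x₁ → g y = 0 := fun y hy => by
    rw [← hgy, wave_eq_zero hasupp fun hm => hy hm.1, mul_zero]
  have hgc : HasCompactSupport g := HasCompactSupport.intro isCompact_Icc hg0
  generalize hkdef : (fun t => recipCut Ω (x, t)) = k at hM'
  have hkt : ∀ t, recipCut Ω (x, t) = k t := fun t => by rw [← hkdef]
  simp only [hkt] at hM'' ⊢
  have hk : ContDiff ℝ ∞ k := hkdef ▸ (recipCut_contDiff hΩ h1).comp (by fun_prop)
  have hks : ∀ t ∈ tsupport k, (x, t) ∈ goodSet x₀ x₁ δ :=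
    fun t ht => recipCut_slice_mem_goodSet hδ h0 hx (hkdef ▸ ht)
  have hK0 : 0 < K := by linarith
  -- the part with the interpolated kernels
  have hA := norm_setIntegral_mul_kernel_diff_le (K := 5 * K) hδ hx hk hks
    (fun t ht => by rw [← hkdef]; exact deriv_recipCut_slice_eq_zero hK0 hKI h1 hx ht) hM'
    hgsm.continuous hg0 (α := α) (β := β) (b := C₁ * h ^ (N + 1)) (by positivity)
    (fun t ht htK ρ hρ σ hσ => by
      have := hC₁ h hh η hη x t ht htK ρ hρ σ hσ
      rw [hα, hβ] at this
      simp only [hgy] at this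
      convert this using 8
      push_cast
      ring)
  -- the part with the exponential kernel
  obtain ⟨hGi, hGv⟩ := integrable_modulated_fourier hgsm hgc hh x
  rw [hβ] at hGi hGv
  obtain ⟨hkG, hB⟩ := norm_integral_cut_sub_le hk.continuous (L := 5 * K) (by linarith)
    (fun t ht => by rw [← hkt]; exact recipCut_eq_one hK0 hKI h1 hx ht) hM'' hGi hh
    (N := N) (C := C₂) hC₂0 (fun t ht => by
      have := hC₂ h hh η hη t ht
      rw [hα, hβ] at this
      simp only [hgy] at this
      refine le_of_eq_of_le ?_ this
      have e : ∀ y : ℝ, cexp (β * (t * (y - x) : ℝ)) * g y =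
          cexp (-(β * (t * x : ℝ))) * (cexp (β * (t * y)) * g y) := fun y => by
        rw [← mul_assoc, ← Complex.exp_add]
        congr 2
        push_cast
        ring
      simp only [e]
      rw [integral_const_mul, norm_mul]
      have : -(β * (t * x : ℝ)) = (2 / h * (t * x) : ℝ) * I := by
        rw [← hβ]
        push_cast
        ring
      rw [this, Complex.norm_exp_ofReal_mul_I, one_mul])
  rw [hGv] at hB
  set S : Set ℝ := {t | (x, t) ∈ goodSet x₀ x₁ δ} with hSdef
  have hS : IsCompact S := goodSet_slice_isCompact hδ x
  have hkS : ∀ t, t ∉ S → k t = 0 := fun t ht =>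
    image_eq_zero_of_notMem_tsupport fun h => ht (hks t h)
  have hPc : ∀ t ∈ S, ∀ y ∈ Icc x₀ x₁, ContinuousAt
      (fun p : ℝ × ℝ => cpowR (1 - p.1 * (p.2 - x)) (-α - 1)) (t, y) := fun t ht y hy =>
    continuousAt_cpowR (f := fun p : ℝ × ℝ => 1 - p.1 * (p.2 - x)) (w := fun _ => -α - 1)
      (by fun_prop) continuousAt_const (goodSet_pos hδ ht hy).ne'
  have hgI : ∀ F : ℝ → ℂ, ∫ y, F y * g y = ∫ y in Icc x₀ x₁, F y * g y := fun F =>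
    (setIntegral_eq_integral_of_forall_compl_eq_zero fun y hy => by rw [hg0 y hy, mul_zero]).symm
  have hPint : Integrable fun t => (k t : ℂ) * ∫ y, cpowR (1 - t * (y - x)) (-α - 1) * g y := by
    simp only [hgI]
    have hon : IntegrableOn (fun t => (k t : ℂ) * ∫ y in Icc x₀ x₁,
        cpowR (1 - t * (y - x)) (-α - 1) * g y) S := by
      simp only [← integral_const_mul]
      have hc : ContinuousOn (fun p : ℝ × ℝ => (k p.1 : ℂ) *
          (cpowR (1 - p.1 * (p.2 - x)) (-α - 1) * g p.2)) (S ×ˢ Icc x₀ x₁) := by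
        intro p hp
        refine ContinuousAt.continuousWithinAt (ContinuousAt.mul ?_
          ((hPc p.1 hp.1 p.2 hp.2).mul ?_))
        · exact (continuous_ofReal.comp (hk.continuous.comp continuous_fst)).continuousAt
        · exact (hgsm.continuous.comp continuous_snd).continuousAt
      have := hc.integrableOn_compact (μ := volume.prod volume) (hS.prod isCompact_Icc)
      rw [IntegrableOn, ← Measure.prod_restrict] at this
      exact this.integral_prod_left
    exact (integrableOn_iff_integrable_of_support_subset fun t ht => by
      by_contra hn
      exact ht (by simp [hkS t hn])).mp hon
  have hsplit : ∫ t, (k t : ℂ) * ∫ y, (α * cpowR (1 - t * (y - x)) (-α - 1)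
        - β * cexp (β * (t * (y - x) : ℝ))) * g y =
      α * (∫ t, (k t : ℂ) * ∫ y, cpowR (1 - t * (y - x)) (-α - 1) * g y) -
        β * ∫ t, (k t : ℂ) * ∫ y : ℝ, cexp (β * (t * (y - x) : ℝ)) * g y := by
    rw [← integral_const_mul, ← integral_const_mul, ← integral_sub (hPint.const_mul _)
      (hkG.const_mul _)]
    refine integral_congr_ae (Eventually.of_forall fun t => ?_)
    simp only
    by_cases ht : t ∈ S
    · have i1 : Integrable fun y => cpowR (1 - t * (y - x)) (-α - 1) * g y := by
        refine (integrableOn_iff_integrable_of_support_subset (s := Icc x₀ x₁) fun y hy => by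
          by_contra hn
          exact hy (by simp [hg0 y hn])).mp (ContinuousOn.integrableOn_compact isCompact_Icc ?_)
        intro y hy
        exact (((hPc t ht y hy).comp (f := fun y : ℝ => (t, y)) (by fun_prop)).mul
          hgsm.continuous.continuousAt).continuousWithinAt
      have i2 : Integrable fun y : ℝ => cexp (β * (t * (y - x) : ℝ)) * g y := by
        refine Continuous.integrable_of_hasCompactSupport ?_ hgc.mul_left
        exact (by fun_prop : Continuous fun y : ℝ => cexp (β * (t * (y - x) : ℝ))).mul
          hgsm.continuous
      simp only [sub_mul, mul_assoc]
      rw [integral_sub (i1.const_mul _) (i2.const_mul _), integral_const_mul, integral_const_mul]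
      ring
    · simp [hkS t ht]
  rw [hsplit] at hA
  have hβπ : β * (π * h * g x) = -(2 * π * I * g x) := by
    have : (h : ℂ) ≠ 0 := by exact_mod_cast hh.ne'
    rw [← hβ]
    field_simp
  generalize (∫ t, (k t : ℂ) * ∫ y, cpowR (1 - t * (y - x)) (-α - 1) * g y) = P at hA ⊢
  generalize (∫ t, (k t : ℂ) * ∫ y : ℝ, cexp (β * (t * (y - x) : ℝ)) * g y) = E at hA hB
  have hid : α * P + 2 * π * I * g x = (α * P - β * E) + β * (E - π * h * g x) := by
    rw [mul_sub, hβπ]; ring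
  rw [hid, add_mul]
  refine (norm_add_le _ _).trans (add_le_add (hA.trans ?_) ?_)
  · have : (‖α‖ + ‖β‖) * (C₁ * h ^ (N + 1)) ≤ 5 * C₁ * h ^ N := by
      calc _ ≤ (3 / h + 2 / h) * (C₁ * h ^ (N + 1)) := by
            rw [hβn]; gcongr
        _ = _ := by field_simp; ring
    calc _ ≤ |M| * (δ⁻¹ * (5 * C₁ * h ^ N)) * (2 * δ⁻¹) := by gcongr
      _ = _ := by ring
  · rw [norm_mul, hβn]
    calc _ ≤ 2 / h * ((|M| + 1) * (C₂ * h ^ (N + 2)) * 2 * π) := by gcongr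
      _ = 2 * ((|M| + 1) * C₂ * 2 * π) * h ^ N * h := by field_simp; ring
      _ ≤ 2 * ((|M| + 1) * C₂ * 2 * π) * h ^ N * 1 := by gcongr
      _ = _ := mul_one _

end WaveError

theorem integrable_mul_of_continuousOn {X Y : Type*} [TopologicalSpace X] [TopologicalSpace Y]
    [MeasureSpace X] [MeasureSpace Y] [OpensMeasurableSpace X] [OpensMeasurableSpace Y]
    [SecondCountableTopologyEither X Y] [T2Space X] [T2Space Y]
    [SFinite (volume : Measure X)] [SFinite (volume : Measure Y)]
    [IsFiniteMeasureOnCompacts (volume : Measure X)]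
    {T : Set X} {J : Set Y} (hT : IsCompact T) (hJ : IsCompact J) {Φ : X × Y → ℂ}
    (hΦ : ContinuousOn Φ (T ×ˢ J)) {f : Y → ℂ} (hf : IntegrableOn f J) :
    Integrable (fun q : X × Y => Φ q * f q.2)
      ((volume.restrict T).prod (volume.restrict J)) := by
  have : IsFiniteMeasure (volume.restrict T : Measure X) :=
    ⟨by rw [Measure.restrict_apply_univ]; exact hT.measure_lt_top⟩
  have h1 : Integrable (fun q : X × Y => f q.2)
      ((volume.restrict T).prod (volume.restrict J)) := hf.comp_snd _
  obtain ⟨M, hM⟩ := (hT.prod hJ).exists_bound_of_continuousOn hΦ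
  have hmeas : MeasurableSet (T ×ˢ J) := hT.measurableSet.prod hJ.measurableSet
  refine h1.bdd_mul (c := M) ?_ ?_
  · rw [Measure.prod_restrict]
    exact hΦ.aestronglyMeasurable hmeas
  · rw [Measure.prod_restrict]
    exact (ae_restrict_iff' hmeas).mpr (Eventually.of_forall hM)

theorem setIntegral_Icc_norm_le {f : Lp ℂ 2 (volume : Measure ℝ)} {L : ℝ} (hL : 1 ≤ 2 * L) :
    IntegrableOn f (Icc (-L) L) ∧ ∫ η in Icc (-L) L, ‖f η‖ ≤ 2 * L * ‖f‖ := by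
  have hm : MemLp f 2 (volume.restrict (Icc (-L) L)) := (Lp.memLp f).restrict _
  have hi : IntegrableOn f (Icc (-L) L) := hm.integrable (by norm_num)
  refine ⟨hi, ?_⟩
  have h1 := eLpNorm_le_eLpNorm_mul_rpow_measure_univ (p := 1) (q := 2)
    (μ := volume.restrict (Icc (-L) L)) (by norm_num) hi.aestronglyMeasurable
  have h2 : eLpNorm f 2 (volume.restrict (Icc (-L) L)) ≤ ENNReal.ofReal ‖f‖ := by
    rw [Lp.norm_def, ENNReal.ofReal_toReal (Lp.eLpNorm_ne_top f)]
    exact eLpNorm_mono_measure _ Measure.restrict_le_self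
  have h3 : (volume.restrict (Icc (-L) L)) univ ^ (1 / (1 : ENNReal).toReal - 1 / (2 : ENNReal).toReal)
      ≤ ENNReal.ofReal (2 * L) := by
    rw [Measure.restrict_apply_univ, Real.volume_Icc, sub_neg_eq_add, ← two_mul]
    refine (ENNReal.rpow_le_rpow_of_exponent_le ?_ ?_).trans (ENNReal.rpow_one _).le
    · rw [← ENNReal.ofReal_one]
      exact ENNReal.ofReal_le_ofReal hL
    · norm_num
  have h4 := h1.trans (mul_le_mul' h2 h3)
  rw [← ENNReal.ofReal_mul (norm_nonneg _), eLpNorm_one_eq_lintegral_enorm] at h4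
  rw [integral_norm_eq_lintegral_enorm hi.aestronglyMeasurable]
  refine ENNReal.toReal_le_of_le_ofReal (by positivity) (h4.trans_eq ?_)
  rw [mul_comm]

section WaveReduction

variable {ν K x₀ x₁ : ℝ} {a : ℝ × ℝ → ℂ}

theorem abs_le_iff_mem_Icc_div {h : ℝ} (hh : 0 < h) (K η : ℝ) :
    |2 * π * h * η| ≤ 2 * K ↔ η ∈ Icc (-(K / (π * h))) (K / (π * h)) := by
  have hp : 0 < π * h := by positivity
  rw [abs_le, mem_Icc, ← neg_div, div_le_iff₀ hp, le_div_iff₀ hp]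
  constructor <;> rintro ⟨h1, h2⟩ <;> constructor <;> linarith

theorem Oph_eq_setIntegral_wave {h : ℝ} (hh : 0 < h) (has : ContDiff ℝ ∞ a)
    (hac : HasCompactSupport a)
    (hasupp : tsupport a ⊆ Ioo x₀ x₁ ×ˢ Ioo (-(2 * K)) (2 * K))
    (u : Lp ℂ 2 (volume : Measure ℝ)) (y : ℝ) :
    Oph h a u y = ∫ η in Icc (-(K / (π * h))) (K / (π * h)),
      wave h a η y * (𝓕 u : Lp ℂ 2 (volume : Measure ℝ)) η := by
  rw [Oph_eq_integral_wave hh has hac, setIntegral_eq_integral_of_forall_compl_eq_zero]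
  intro η hη
  rw [wave_eq_zero hasupp fun hm => hη ((abs_le_iff_mem_Icc_div hh K η).mp hm.2), zero_mul]

theorem continuous_wave_prod (has : ContDiff ℝ ∞ a) (h : ℝ) :
    Continuous fun p : ℝ × ℝ => wave h a p.2 p.1 := by
  have := has.continuous
  unfold wave
  fun_prop

theorem norm_Oph_error_le (hν : ν ∈ Icc (0 : ℝ) (1 / 2)) (hK : 10 ≤ K)
    (hKI : 10 * K * (x₁ - x₀) ≤ 1) (has : ContDiff ℝ ∞ a) (hac : HasCompactSupport a)
    (hasupp : tsupport a ⊆ Ioo x₀ x₁ ×ˢ Ioo (-(2 * K)) (2 * K))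
    {Ω : ℝ → ℝ} (hΩ : ContDiff ℝ ∞ Ω)
    (h1 : ∀ x, x ∉ Icc (x₀ - 1 / (10 * K)) (x₁ + 1 / (10 * K)) → Ω x = 1)
    {δ : ℝ} (hδ : 0 < δ) (h0 : ∀ y ∈ Ioo (x₀ - δ) (x₁ + δ), Ω y = 0) (N : ℕ) :
    ∃ C, 0 ≤ C ∧ ∀ h : ℝ, 0 < h → h ≤ 1 → ∀ u : Lp ℂ 2 (volume : Measure ℝ), ∀ x ∈ Icc x₀ x₁,
      ‖(2 * ν - 2 * I / h : ℂ) * (∫ t : ℝ, (recipCut Ω (x, t) : ℂ) * ∫ y : ℝ,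
          cpowR (1 - t * (y - x)) (-(2 * ν - 2 * I / h : ℂ) - 1) *
            (cpowR (jap y) (2 * ν - 2 * I / h - 1) * Oph h a u y))
        + 2 * π * I * (cpowR (jap x) (2 * ν - 2 * I / h - 1) * Oph h a u x)‖ ≤
        C * h ^ N * ‖u‖ := by
  obtain ⟨C, hC0, hC⟩ := norm_wave_error_le hν hK hKI has hasupp hΩ h1 hδ h0 (N + 1)
  refine ⟨C * (2 * (K / π)), by positivity, fun h hh hh1 u x hx => ?_⟩
  generalize hα : (2 * ν - 2 * I / h : ℂ) = α
  have hC' := hC h hh hh1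
  rw [hα] at hC'
  generalize hf : (𝓕 u : Lp ℂ 2 (volume : Measure ℝ)) = f
  have hfn : ‖f‖ = ‖u‖ := by rw [← hf, Lp.norm_fourier_eq]
  have hOph := Oph_eq_setIntegral_wave hh has hac hasupp u
  rw [hf] at hOph
  generalize hL : K / (π * h) = L at hOph
  have hLmem : ∀ η, |2 * π * h * η| ≤ 2 * K ↔ η ∈ Icc (-L) L := fun η => by
    rw [abs_le_iff_mem_Icc_div hh, hL]
  have hJ : IsCompact (Icc (-L) L) := isCompact_Icc
  have hL1 : 1 ≤ 2 * L := by
    rw [← hL, mul_div_assoc', le_div_iff₀ (by positivity)]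
    nlinarith [Real.pi_le_four, Real.pi_pos]
  obtain ⟨hfi, hfle⟩ := setIntegral_Icc_norm_le (f := f) hL1
  set S : Set ℝ := {t | (x, t) ∈ goodSet x₀ x₁ δ} with hSdef
  have hS : IsCompact S := goodSet_slice_isCompact hδ x
  set T : Set (ℝ × ℝ) := S ×ˢ Icc x₀ x₁ with hTdef
  have hT : IsCompact T := hS.prod isCompact_Icc
  have hk : ContDiff ℝ ∞ fun t => recipCut Ω (x, t) := (recipCut_contDiff hΩ h1).comp (by fun_prop)
  have hkS : ∀ t, t ∉ S → recipCut Ω (x, t) = 0 := fun t ht =>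
    image_eq_zero_of_notMem_tsupport (f := fun t => recipCut Ω (x, t)) fun h =>
      ht (recipCut_slice_mem_goodSet hδ h0 hx h)
  set A : ℝ × ℝ → ℂ := fun p => (recipCut Ω (x, p.1) : ℂ) *
    (cpowR (1 - p.1 * (p.2 - x)) (-α - 1) * cpowR (jap p.2) (α - 1)) with hA
  have hAc : ContinuousOn A T := by
    rintro ⟨t, y⟩ ⟨ht, hy⟩
    refine ContinuousAt.continuousWithinAt (ContinuousAt.mul ?_ (ContinuousAt.mul ?_ ?_))
    · exact (continuous_ofReal.comp (hk.continuous.comp continuous_fst)).continuousAt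
    · exact continuousAt_cpowR (f := fun p : ℝ × ℝ => 1 - p.1 * (p.2 - x)) (w := fun _ => -α - 1)
        (by fun_prop) continuousAt_const (goodSet_pos hδ ht hy).ne'
    · exact continuousAt_cpowR (f := fun p : ℝ × ℝ => jap p.2) (w := fun _ => α - 1)
        (jap_contDiff.continuous.comp continuous_snd).continuousAt continuousAt_const
        (jap_pos _).ne'
  have hwc := continuous_wave_prod has h
  have hiter : ∀ F : ℝ → ℂ, (∀ y, y ∉ Icc x₀ x₁ → F y = 0) →
      IntegrableOn (fun p : ℝ × ℝ => A p * F p.2) T →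
      ∫ t : ℝ, (recipCut Ω (x, t) : ℂ) * ∫ y : ℝ, cpowR (1 - t * (y - x)) (-α - 1) *
        (cpowR (jap y) (α - 1) * F y) = ∫ p in T, A p * F p.2 := by
    intro F hF hkint
    rw [hTdef, Measure.volume_eq_prod, setIntegral_prod _ hkint,
      ← setIntegral_eq_integral_of_forall_compl_eq_zero (s := S)
        (fun t ht => by rw [hkS t ht]; simp)]
    refine setIntegral_congr_fun hS.measurableSet fun t _ => ?_
    simp only [hA, mul_assoc]
    rw [integral_const_mul, setIntegral_eq_integral_of_forall_compl_eq_zero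
      (s := Icc x₀ x₁) (fun y hy => by rw [hF y hy]; simp)]
  have hΦ : ContinuousOn (fun q : (ℝ × ℝ) × ℝ => A q.1 * wave h a q.2 q.1.2) (T ×ˢ Icc (-L) L) := by
    refine ContinuousOn.mul (hAc.comp continuousOn_fst fun q hq => hq.1) ?_
    exact (hwc.comp (by fun_prop : Continuous fun q : (ℝ × ℝ) × ℝ => (q.1.2, q.2))).continuousOn
  have hkint := integrable_mul_of_continuousOn hT hJ hΦ hfi
  have hwave0 : ∀ η y, y ∉ Icc x₀ x₁ → wave h a η y = 0 := fun η y hy =>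
    wave_eq_zero hasupp fun hm => hy hm.1
  have hOph0 : ∀ y, y ∉ Icc x₀ x₁ → Oph h a u y = 0 := fun y hy => by
    rw [hOph]
    simp [hwave0 _ y hy]
  have hAO : ∀ p, A p * Oph h a u p.2 =
      ∫ η in Icc (-L) L, A p * wave h a η p.2 * f η := fun p => by
    rw [hOph, ← integral_const_mul]
    simp only [mul_assoc]
  have hOint : IntegrableOn (fun p : ℝ × ℝ => A p * Oph h a u p.2) T := by
    simp only [hAO]
    exact hkint.integral_prod_left
  have hmain : ∫ t : ℝ, (recipCut Ω (x, t) : ℂ) * ∫ y : ℝ, cpowR (1 - t * (y - x)) (-α - 1) *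
        (cpowR (jap y) (α - 1) * Oph h a u y) =
      ∫ η in Icc (-L) L, (∫ t : ℝ, (recipCut Ω (x, t) : ℂ) * ∫ y : ℝ,
        cpowR (1 - t * (y - x)) (-α - 1) * (cpowR (jap y) (α - 1) * wave h a η y)) * f η := by
    rw [hiter _ hOph0 hOint, integral_congr_ae (Eventually.of_forall hAO),
      integral_integral_swap hkint]
    refine setIntegral_congr_fun measurableSet_Icc fun η hη => ?_
    rw [integral_mul_const, hiter _ (hwave0 η)]
    exact (hΦ.comp (f := fun p : ℝ × ℝ => (p, η)) (by fun_prop)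
      fun p hp => ⟨hp, hη⟩).integrableOn_compact hT
  have hint2 : IntegrableOn (fun η => (∫ t : ℝ, (recipCut Ω (x, t) : ℂ) * ∫ y : ℝ,
        cpowR (1 - t * (y - x)) (-α - 1) * (cpowR (jap y) (α - 1) * wave h a η y)) * f η)
      (Icc (-L) L) := by
    refine (integrableOn_congr_fun (fun η hη => ?_) measurableSet_Icc).mpr hkint.integral_prod_right
    simp only
    rw [integral_mul_const, hiter _ (hwave0 η)]
    exact (hΦ.comp (f := fun p : ℝ × ℝ => (p, η)) (by fun_prop)
      fun p hp => ⟨hp, hη⟩).integrableOn_compact hT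
  have hint3 : IntegrableOn (fun η => cpowR (jap x) (α - 1) * (wave h a η x * f η))
      (Icc (-L) L) := by
    refine Integrable.const_mul ?_ _
    exact hfi.continuousOn_mul (hwc.comp (by fun_prop : Continuous fun η : ℝ => (x, η))).continuousOn
      isCompact_Icc
  rw [hmain, hOph, ← integral_const_mul, ← integral_const_mul, ← integral_const_mul,
    ← integral_add (hint2.const_mul _) (hint3.const_mul _)]
  have hbound : ∀ η ∈ Icc (-L) L, ‖α * ((∫ t : ℝ, (recipCut Ω (x, t) : ℂ) * ∫ y : ℝ,
        cpowR (1 - t * (y - x)) (-α - 1) * (cpowR (jap y) (α - 1) * wave h a η y)) * f η) +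
        2 * π * I * (cpowR (jap x) (α - 1) * (wave h a η x * f η))‖ ≤
      C * h ^ (N + 1) * ‖f η‖ := fun η hη => by
    refine le_trans (le_of_eq ?_) (mul_le_mul_of_nonneg_right
      (hC' η ((hLmem η).mpr hη) x hx) (norm_nonneg _))
    rw [← norm_mul]
    congr 1
    ring
  refine (norm_integral_le_of_norm_le (hfi.norm.const_mul (C * h ^ (N + 1)))
    ((ae_restrict_iff' measurableSet_Icc).mpr (Eventually.of_forall hbound))).trans ?_
  rw [integral_const_mul, ← hfn]
  calc _ ≤ C * h ^ (N + 1) * (2 * L * ‖f‖) := by gcongr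
    _ = _ := by
      rw [← hL]
      field_simp
      ring

end WaveReduction

theorem lintegral_recip (F : ℝ → ENNReal) (x : ℝ) :
    ∫⁻ y, F y = ∫⁻ t : ℝ, ENNReal.ofReal (t ^ 2)⁻¹ * F (x + t⁻¹) := by
  have himg : (fun t : ℝ => x + t⁻¹) '' {0}ᶜ = {x}ᶜ := by
    ext y
    simp only [mem_image, mem_compl_iff, mem_singleton_iff]
    constructor
    · rintro ⟨t, ht, rfl⟩ h
      exact ht (by simpa using h)
    · intro hy
      exact ⟨(y - x)⁻¹, inv_ne_zero (sub_ne_zero.mpr hy), by simp⟩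
  have h := lintegral_image_eq_lintegral_abs_deriv_mul (s := {0}ᶜ) (f := fun t : ℝ => x + t⁻¹)
    (f' := fun t => -(t ^ 2)⁻¹) (measurableSet_singleton _).compl
    (fun t ht => ((hasDerivAt_inv ht).const_add x).hasDerivWithinAt)
    (fun s hs t ht hst => by simpa using hst) F
  rw [himg] at h
  have hr : ∀ z : ℝ, (volume : Measure ℝ).restrict {z}ᶜ = volume := fun z =>
    Measure.restrict_eq_self_of_ae_mem (compl_mem_ae_iff.mpr (by simp))
  rw [hr, hr] at h
  rw [h]
  refine lintegral_congr fun t => ?_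
  rw [abs_neg, abs_of_nonneg (by positivity)]

theorem conj_cpowR (t : ℝ) (w : ℂ) : (starRingEnd ℂ) (cpowR t w) = cpowR t ((starRingEnd ℂ) w) := by
  rw [cpowR, cpowR, ← Complex.exp_conj, map_mul, conj_ofReal]

theorem cpowR_one (w : ℂ) : cpowR 1 w = 1 := by simp [cpowR]

theorem cpowR_two_right {t : ℝ} (ht : t ≠ 0) : cpowR t 2 = (t : ℂ) ^ 2 := by
  have := cpowR_natCast (abs_pos.mpr ht) 2
  rw [cpowR_abs, ← ofReal_pow, sq_abs] at this
  exact_mod_cast this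

theorem cpowR_ofReal {t : ℝ} (ht : 0 < t) (r : ℝ) : cpowR t r = (t ^ r : ℝ) := by
  rw [cpowR, Real.rpow_def_of_pos ht, mul_comm]
  push_cast
  rfl

theorem measurable_cpowR (w : ℂ) : Measurable fun t : ℝ => cpowR t w :=
  (((Complex.measurable_ofReal.comp Real.measurable_log).const_mul w)).cexp

theorem cpowR_shift_recip {c t y z : ℝ} (ht : t ≠ 0) (hp : 0 < 1 - t * z) (hz : z = y - c) (w : ℂ) :
    cpowR (c + t⁻¹ - y) w = cpowR t⁻¹ w * cpowR (1 - t * z) w := by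
  rw [← cpowR_mul (inv_ne_zero ht) hp.ne', hz]
  congr 1
  field_simp
  ring

theorem weight_recip {c t : ℝ} (ht : t ≠ 0) {ν : ℝ} {w₁ w₂ : ℂ} (hw : w₁ + w₂ = -(4 * ν) - 2) :
    ((t ^ 2)⁻¹ : ℝ) * (cpowR (1 + (c + t⁻¹) ^ 2) (2 * ν) * (cpowR t⁻¹ w₁ * cpowR t⁻¹ w₂)) =
      cpowR (t ^ 2 + (c * t + 1) ^ 2) (2 * ν) := by
  have e1 : t ^ 2 + (c * t + 1) ^ 2 = t * t * (1 + (c + t⁻¹) ^ 2) := by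
    field_simp
  have e2 : (0 : ℝ) < 1 + (c + t⁻¹) ^ 2 := by positivity
  have ht' : (t : ℂ) ≠ 0 := by exact_mod_cast ht
  rw [e1, cpowR_mul (mul_ne_zero ht ht) e2.ne', cpowR_mul ht ht, ← cpowR_add, ← cpowR_add,
    cpowR_inv, hw, show -(-(4 * (ν : ℂ)) - 2) = (2 * ν + 2 * ν) + 2 by ring, cpowR_add,
    cpowR_two_right ht]
  push_cast
  field_simp

section Gram

variable {Ω : ℝ → ℝ} {A B x₀ x₁ δ : ℝ}

theorem integral_gram_eq (hδ : 0 < δ) (h0 : ∀ y ∈ Ioo (x₀ - δ) (x₁ + δ), Ω y = 0) {ν : ℝ}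
    {w₁ w₂ : ℂ} (hw : w₁ + w₂ = -(4 * ν) - 2) {c x x' : ℝ} (hc : c ∈ Icc x₀ x₁)
    (hx : x ∈ Icc x₀ x₁) (hx' : x' ∈ Icc x₀ x₁) :
    ∫ t : ℝ, (recipCut Ω (c, t) : ℂ) * cpowR (t ^ 2 + (c * t + 1) ^ 2) (2 * ν) *
        (cpowR (1 - t * (x - c)) w₁ * cpowR (1 - t * (x' - c)) w₂) =
      ∫ y, (Ω y : ℂ) * cpowR (1 + y ^ 2) (2 * ν) * (cpowR (y - x) w₁ * cpowR (y - x') w₂) := by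
  refine Eq.trans ?_ (integral_recip _ c).symm
  refine integral_congr_ae ?_
  filter_upwards [Measure.ae_ne volume 0] with t ht
  by_cases hk : recipCut Ω (c, t) = 0
  · rw [← recipCut_of_ne (Ω := Ω) (x := c) ht, hk]
    simp
  · have hg := mem_goodSet_of_mem_tsupport hδ h0 hc (subset_tsupport _ hk)
    rw [cpowR_shift_recip ht (goodSet_pos hδ hg hx) rfl,
      cpowR_shift_recip ht (goodSet_pos hδ hg hx') rfl, ← recipCut_of_ne (Ω := Ω) (x := c) ht, ← weight_recip ht hw]
    ring

theorem integral_cpowR_shift_recip (hδ : 0 < δ) {v : ℝ → ℂ} (hv : ∀ y, y ∉ Icc x₀ x₁ → v y = 0)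
    {c t : ℝ} (ht : t ≠ 0) (hg : (c, t) ∈ goodSet x₀ x₁ δ) {w : ℂ} :
    ∫ z, cpowR (c + t⁻¹ - z) w * v z =
      cpowR t⁻¹ w * ∫ z, cpowR (1 - t * (z - c)) w * v z := by
  rw [← integral_const_mul]
  refine integral_congr_ae (Eventually.of_forall fun z => ?_)
  simp only
  by_cases hz : z ∈ Icc x₀ x₁
  · rw [cpowR_shift_recip ht (goodSet_pos hδ hg hz) rfl, mul_assoc]
  · rw [hv z hz]; simp

theorem lintegral_enorm_gram_recip (hδ : 0 < δ) (h0 : ∀ y ∈ Ioo (x₀ - δ) (x₁ + δ), Ω y = 0)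
    {ν : ℝ} {w : ℂ} (hw : (starRingEnd ℂ) w + w = -(4 * ν) - 2) {v : ℝ → ℂ}
    (hv : ∀ y, y ∉ Icc x₀ x₁ → v y = 0) {c : ℝ} (hc : c ∈ Icc x₀ x₁) :
    ∫⁻ y, ‖(Ω y : ℂ) * cpowR (1 + y ^ 2) (2 * ν) * ((starRingEnd ℂ) (∫ z, cpowR (y - z) w * v z) *
        ∫ z, cpowR (y - z) w * v z)‖ₑ =
      ∫⁻ t, ‖(recipCut Ω (c, t) : ℂ) * cpowR (t ^ 2 + (c * t + 1) ^ 2) (2 * ν) *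
        ((starRingEnd ℂ) (∫ z, cpowR (1 - t * (z - c)) w * v z) *
          ∫ z, cpowR (1 - t * (z - c)) w * v z)‖ₑ := by
  rw [lintegral_recip _ c]
  refine lintegral_congr_ae ?_
  filter_upwards [Measure.ae_ne volume 0] with t ht
  by_cases hk : recipCut Ω (c, t) = 0
  · rw [← recipCut_of_ne (Ω := Ω) (x := c) ht, hk]
    simp
  · have hg := mem_goodSet_of_mem_tsupport hδ h0 hc (subset_tsupport _ hk)
    have e2 : ENNReal.ofReal (t ^ 2)⁻¹ = ‖(((t ^ 2)⁻¹ : ℝ) : ℂ)‖ₑ := by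
      rw [← ofReal_norm, norm_real, Real.norm_of_nonneg (by positivity)]
    rw [integral_cpowR_shift_recip hδ hv ht hg, ← recipCut_of_ne (Ω := Ω) (x := c) ht, ← weight_recip ht hw, e2, ← enorm_mul, map_mul, conj_cpowR]
    congr 1
    ring

theorem lintegral_enorm_gram_le (ν : ℝ) (hΩ : ContDiff ℝ ∞ Ω) (hΩ0 : ∀ y, 0 ≤ Ω y)
    (h1 : ∀ x, x ∉ Icc A B → Ω x = 1) (hδ : 0 < δ)
    (h0 : ∀ y ∈ Ioo (x₀ - δ) (x₁ + δ), Ω y = 0) (hI : x₀ ≤ x₁) :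
    ∃ C, 0 ≤ C ∧ ∀ h : ℝ, 0 < h → ∀ v : ℝ → ℂ, (∀ y, y ∉ Icc x₀ x₁ → v y = 0) →
      Integrable v →
      ∫⁻ y, ‖(Ω y : ℂ) * cpowR (1 + y ^ 2) (2 * ν) * ((starRingEnd ℂ)
          (∫ z, cpowR (y - z) (-(2 * ν - 2 * I / h) - 1) * v z) *
          ∫ z, cpowR (y - z) (-(2 * ν - 2 * I / h) - 1) * v z)‖ₑ ≤
        ENNReal.ofReal (C * h) * ∫⁻ x, ‖v x‖ₑ ^ 2 := by
  obtain ⟨C, hC0, hC⟩ := norm_gram_kernel_le ν hΩ h1 hδ h0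
  refine ⟨2 * (C * π), by positivity, fun h hh v hv hvi => ?_⟩
  have hC' := hC h hh
  have hw : (starRingEnd ℂ) (-(2 * ν - 2 * I / h) - 1) + (-(2 * ν - 2 * I / h) - 1 : ℂ)
      = -(4 * ν) - 2 := by
    simp only [map_sub, map_neg, map_mul, map_div₀, conj_ofReal, conj_I, map_one, map_ofNat]
    ring
  generalize (-(2 * ν - 2 * I / h) - 1 : ℂ) = w at hw hC' ⊢
  have hx₀ : x₀ ∈ Icc x₀ x₁ := ⟨le_rfl, hI⟩
  rw [lintegral_enorm_gram_recip hδ h0 hw hv hx₀]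
  set S : Set ℝ := {t | (x₀, t) ∈ goodSet x₀ x₁ δ} with hSdef
  have hS : IsCompact S := goodSet_slice_isCompact hδ x₀
  have hk : ContDiff ℝ ∞ fun t => recipCut Ω (x₀, t) := (recipCut_contDiff hΩ h1).comp (by fun_prop)
  have hkS : ∀ t, t ∉ S → recipCut Ω (x₀, t) = 0 := fun t ht =>
    image_eq_zero_of_notMem_tsupport (f := fun t => recipCut Ω (x₀, t)) fun h =>
      ht (recipCut_slice_mem_goodSet hδ h0 hx₀ h)
  have hk0 : ∀ t, 0 ≤ recipCut Ω (x₀, t) := fun t => by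
    unfold recipCut
    split_ifs
    · exact zero_le_one
    · exact hΩ0 _
  have hq : ∀ t : ℝ, 0 < t ^ 2 + (x₀ * t + 1) ^ 2 := fun t => by
    rcases eq_or_ne t 0 with rfl | ht
    · norm_num
    · positivity
  set Φ : ℝ × (ℝ × ℝ) → ℂ := fun q => (recipCut Ω (x₀, q.1) : ℂ) *
    cpowR (q.1 ^ 2 + (x₀ * q.1 + 1) ^ 2) (2 * ν) *
      (cpowR (1 - q.1 * (q.2.1 - x₀)) ((starRingEnd ℂ) w) * cpowR (1 - q.1 * (q.2.2 - x₀)) w) with hΦ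
  have hΦc : ContinuousOn Φ (S ×ˢ (Icc x₀ x₁ ×ˢ Icc x₀ x₁)) := by
    rintro ⟨t, x, x'⟩ ⟨ht, hx, hx'⟩
    refine ContinuousAt.continuousWithinAt (ContinuousAt.mul (ContinuousAt.mul ?_ ?_)
      (ContinuousAt.mul ?_ ?_))
    · exact (continuous_ofReal.comp (hk.continuous.comp continuous_fst)).continuousAt
    · exact continuousAt_cpowR (f := fun q : ℝ × (ℝ × ℝ) => q.1 ^ 2 + (x₀ * q.1 + 1) ^ 2)
        (w := fun _ => 2 * ν) (by fun_prop) continuousAt_const (hq t).ne'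
    · exact continuousAt_cpowR (f := fun q : ℝ × (ℝ × ℝ) => 1 - q.1 * (q.2.1 - x₀))
        (w := fun _ => (starRingEnd ℂ) w) (by fun_prop) continuousAt_const
        (goodSet_pos hδ ht hx).ne'
    · exact continuousAt_cpowR (f := fun q : ℝ × (ℝ × ℝ) => 1 - q.1 * (q.2.2 - x₀))
        (w := fun _ => w) (by fun_prop) continuousAt_const (goodSet_pos hδ ht hx').ne'
  have hvc : Integrable fun x => (starRingEnd ℂ) (v x) :=
    (LinearIsometryEquiv.integrable_comp_iff Complex.conjLIE).mpr hvi
  have hvv : IntegrableOn (fun z : ℝ × ℝ => (starRingEnd ℂ) (v z.1) * v z.2)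
      (Icc x₀ x₁ ×ˢ Icc x₀ x₁) := (hvc.mul_prod hvi).integrableOn
  have hkint := integrable_mul_of_continuousOn hS (isCompact_Icc.prod isCompact_Icc) hΦc hvv
  set P : ℝ → ℂ := fun t => (recipCut Ω (x₀, t) : ℂ) *
      cpowR (t ^ 2 + (x₀ * t + 1) ^ 2) (2 * ν) *
        ((starRingEnd ℂ) (∫ z, cpowR (1 - t * (z - x₀)) w * v z) *
          ∫ z, cpowR (1 - t * (z - x₀)) w * v z) with hP
  have hPeq : ∀ t, P t = ∫ z in Icc x₀ x₁ ×ˢ Icc x₀ x₁, Φ (t, z) *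
      ((starRingEnd ℂ) (v z.1) * v z.2) := fun t => by
    simp only [hΦ, hP, mul_assoc]
    rw [integral_const_mul, integral_const_mul, ← integral_conj]
    congr 2
    rw [← setIntegral_eq_integral_of_forall_compl_eq_zero (s := Icc x₀ x₁)
      (fun y hy => by rw [hv y hy]; simp), ← setIntegral_eq_integral_of_forall_compl_eq_zero
      (s := Icc x₀ x₁) (f := fun z => cpowR (1 - t * (z - x₀)) w * v z)
      (fun y hy => by rw [hv y hy]; simp), ← setIntegral_prod_mul]
    refine integral_congr_ae (Eventually.of_forall fun z => ?_)
    simp only [map_mul, conj_cpowR]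
    ring
  have hPS : ∀ t, t ∉ S → P t = 0 := fun t ht => by simp [hP, hkS t ht]
  have hPi : Integrable P := by
    refine (integrableOn_iff_integrable_of_support_subset (s := S) fun t ht => by
      by_contra hn
      exact ht (hPS t hn)).mp ?_
    rw [funext hPeq]
    exact hkint.integral_prod_left
  set p : ℝ → ℝ := fun t => recipCut Ω (x₀, t) * (t ^ 2 + (x₀ * t + 1) ^ 2) ^ (2 * ν) *
    normSq (∫ z, cpowR (1 - t * (z - x₀)) w * v z) with hp
  have hPp : ∀ t, P t = (p t : ℂ) := fun t => by
    simp only [hP, hp]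
    rw [show (2 * ν : ℂ) = ((2 * ν : ℝ) : ℂ) by push_cast; rfl, cpowR_ofReal (hq t), mul_comm (_root_.starRingEnd ℂ _),
      mul_conj]
    push_cast
    ring
  have hp0 : ∀ t, 0 ≤ p t := fun t =>
    mul_nonneg (mul_nonneg (hk0 t) (Real.rpow_nonneg (hq t).le _)) (normSq_nonneg _)
  have hpi : Integrable p := by
    rw [funext hPp] at hPi
    simpa using hPi.re
  have hnorm : ∫⁻ t, ‖P t‖ₑ = ‖∫ t, P t‖ₑ := by
    simp only [hPp]
    rw [integral_complex_ofReal, ← ofReal_norm, norm_real,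
      Real.norm_of_nonneg (integral_nonneg hp0),
      ofReal_integral_eq_lintegral_ofReal hpi (Eventually.of_forall hp0)]
    refine lintegral_congr fun t => ?_
    rw [← ofReal_norm, norm_real, Real.norm_of_nonneg (hp0 t)]
  rw [hnorm, ← setIntegral_eq_integral_of_forall_compl_eq_zero hPS, funext hPeq,
    integral_integral_swap hkint]
  have hG : ∀ x ∈ Icc x₀ x₁, ∀ x' ∈ Icc x₀ x₁, x' ≠ x →
      ‖∫ t in S, Φ (t, (x, x'))‖ ≤ C / (1 + ((x - x') / h) ^ 2) := by
    intro x hx x' hx' hne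
    rw [setIntegral_eq_integral_of_forall_compl_eq_zero fun t ht => by simp [hΦ, hkS t ht]]
    simp only [hΦ]
    rw [integral_gram_eq hδ h0 hw hx₀ hx hx', ← integral_gram_eq hδ h0 hw hx hx hx']
    simp only [sub_self, mul_zero, sub_zero, cpowR_one, one_mul]
    refine (hC' x hx x' hx' hne).trans_eq ?_
    rw [← neg_sub x x', neg_div, neg_sq]
  have hkint' := hkint.integral_prod_right
  simp only [integral_mul_const] at hkint' ⊢
  rw [Measure.volume_eq_prod] at hkint' ⊢
  rw [setIntegral_prod _ hkint']
  refine (enorm_integral_le_lintegral_enorm _).trans ?_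
  refine (lintegral_mono fun x => enorm_integral_le_lintegral_enorm _).trans ?_
  have hwm : Measurable fun z : ℝ => ENNReal.ofReal (C / (1 + (z / h) ^ 2)) := by fun_prop
  refine le_trans ?_ (le_trans (lintegral_lintegral_schur_le hwm hvi.aestronglyMeasurable.enorm)
    ?_)
  · refine le_trans (lintegral_mono_ae (g := fun x => ∫⁻ y, ‖v x‖ₑ *
      ENNReal.ofReal (C / (1 + ((x - y) / h) ^ 2)) * ‖v y‖ₑ) ?_) (setLIntegral_le_lintegral _ _)
    filter_upwards [ae_restrict_mem measurableSet_Icc] with x hx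
    refine le_trans (lintegral_mono_ae ?_) (setLIntegral_le_lintegral _ _)
    filter_upwards [ae_restrict_mem measurableSet_Icc, ae_restrict_of_ae (Measure.ae_ne volume x)]
      with x' hx' hne
    have := ENNReal.ofReal_le_ofReal (hG x hx x' hx' hne)
    rw [ofReal_norm] at this
    rw [enorm_mul, enorm_mul, RCLike.enorm_conj, ← mul_assoc, mul_comm _ ‖v x‖ₑ]
    gcongr
  · rw [lintegral_ofReal_div_one_add_sq hC0 hh, show 2 * (C * π) * h = 2 * (C * π * h) by ring,
      ENNReal.ofReal_mul zero_le_two, ENNReal.ofReal_ofNat]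

end Gram

theorem norm_cpowR_jap_sq {α : ℂ} {ν : ℝ} (hα : α.re = 2 * ν) (y : ℝ) :
    ‖cpowR (jap y) (1 + α)‖ ^ 2 = (1 + y ^ 2) * ‖cpowR (1 + y ^ 2) (2 * ν)‖ := by
  have e : Real.log (1 + y ^ 2) = 2 * Real.log (jap y) := by
    rw [← jap_sq, Real.log_pow]; norm_num
  have e2 : (1 + y ^ 2 : ℝ) = Real.exp (2 * Real.log (jap y)) := by
    rw [← e, Real.exp_log (by positivity)]
  rw [norm_cpowR, norm_cpowR, e]
  nth_rw 1 [e2]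
  rw [← Real.exp_nat_mul, ← Real.exp_add]
  congr 1
  simp [hα]
  ring

theorem norm_cpowR_jap_le_one {w : ℂ} (hw : w.re ≤ 0) (y : ℝ) : ‖cpowR (jap y) w‖ ≤ 1 := by
  rw [norm_cpowR, Real.exp_le_one_iff]
  exact mul_nonpos_of_nonpos_of_nonneg hw (Real.log_nonneg (one_le_jap y))

theorem lintegral_muP (f : ℝ → ENNReal) :
    ∫⁻ y, f y ∂muP = ∫⁻ y, ENNReal.ofReal (2 / (1 + y ^ 2)) * f y :=
  lintegral_withDensity_eq_lintegral_mul_non_measurable _ (by fun_prop)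
    (Eventually.of_forall fun _ => ENNReal.ofReal_lt_top) _

theorem eLpNorm_two_le_of_lintegral_sq_le {f g : ℝ → ℂ} {μ : Measure ℝ} {C : ℝ}
    (h : ∫⁻ y, ‖f y‖ₑ ^ 2 ∂μ ≤ ENNReal.ofReal C * ∫⁻ x, ‖g x‖ₑ ^ 2) :
    eLpNorm f 2 μ ≤ ENNReal.ofReal (Real.sqrt C) * eLpNorm g 2 volume := by
  have key : ∀ (f : ℝ → ℂ) (μ : Measure ℝ), ∫⁻ y, ‖f y‖ₑ ^ 2 ∂μ = eLpNorm f 2 μ ^ 2 := by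
    intro f μ
    have := eLpNorm_nnreal_pow_eq_lintegral (f := f) (p := 2) (μ := μ) (by norm_num)
    simpa using this.symm
  rw [key, key] at h
  have e : ENNReal.ofReal C = ENNReal.ofReal (Real.sqrt C) ^ 2 := by
    rcases le_total 0 C with hC | hC
    · rw [← ENNReal.ofReal_pow (Real.sqrt_nonneg _), Real.sq_sqrt hC]
    · rw [Real.sqrt_eq_zero_of_nonpos hC, ENNReal.ofReal_of_nonpos hC]; simp
  rw [e, ← mul_pow] at h
  exact (ENNReal.pow_le_pow_left_iff (by norm_num)).mp h

/-- Inversion of the operator with kernel `|x - y|^(α - 1)`, weighted by powers of `⟨y⟩` and cut off by `χ`. -/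
def parametrix (c α : ℂ) (χ : ℝ → ℝ) (g : ℝ → ℂ) (y : ℝ) : ℂ :=
  c * cpowR (jap y) (1 + α) * (χ y : ℂ) *
    ∫ z : ℝ, cpowR (y - z) (-α - 1) * (cpowR (jap z) (α - 1) * g z)

theorem enorm_parametrix_sq {α : ℂ} {ν : ℝ} (hα : α.re = 2 * ν) (c : ℂ) (χ : ℝ → ℝ) (g : ℝ → ℂ)
    (y : ℝ) :
    ENNReal.ofReal (2 / (1 + y ^ 2)) * ‖parametrix c α χ g y‖ₑ ^ 2 =
      ENNReal.ofReal (2 * ‖c‖ ^ 2) * ‖((χ y ^ 2 : ℝ) : ℂ) * cpowR (1 + y ^ 2) (2 * ν) *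
        ((starRingEnd ℂ) (∫ z, cpowR (y - z) (-α - 1) * (cpowR (jap z) (α - 1) * g z)) *
          ∫ z, cpowR (y - z) (-α - 1) * (cpowR (jap z) (α - 1) * g z))‖ₑ := by
  rw [parametrix]
  generalize (∫ z, cpowR (y - z) (-α - 1) * (cpowR (jap z) (α - 1) * g z)) = T
  rw [← ofReal_norm, ← ofReal_norm, ← ENNReal.ofReal_pow (norm_nonneg _),
    ← ENNReal.ofReal_mul (by positivity), ← ENNReal.ofReal_mul (by positivity)]
  congr 1
  simp only [norm_mul, mul_pow, norm_cpowR_jap_sq hα, RCLike.norm_conj, norm_real, norm_pow,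
    Real.norm_eq_abs, sq_abs]
  have : (1 + y ^ 2) ≠ 0 := by positivity
  field_simp

section Operator

variable {ν K x₀ x₁ : ℝ} {a : ℝ × ℝ → ℂ}

theorem one_le_two_mul_div_pi_mul (hK : 10 ≤ K) {h : ℝ} (hh : 0 < h) (hh1 : h ≤ 1) :
    1 ≤ 2 * (K / (π * h)) := by
  rw [← mul_div_assoc, le_div_iff₀ (by positivity)]
  nlinarith [Real.pi_lt_four, Real.pi_pos]

theorem Oph_eq_zero (hh : ∀ y, y ∉ Icc x₀ x₁ → ∀ ξ, a (y, ξ) = 0) {h : ℝ} (u : ℝ → ℂ) {y : ℝ}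
    (hy : y ∉ Icc x₀ x₁) : Oph h a u y = 0 := by
  simp [Oph, hh y hy]

theorem integrableOn_wave_mul (hK : 10 ≤ K) (has : ContDiff ℝ ∞ a) {h : ℝ} (hh : 0 < h)
    (hh1 : h ≤ 1) (f : Lp ℂ 2 (volume : Measure ℝ)) (y : ℝ) :
    IntegrableOn (fun η => wave h a η y * f η) (Icc (-(K / (π * h))) (K / (π * h))) := by
  refine IntegrableOn.continuousOn_mul ?_
    (setIntegral_Icc_norm_le (one_le_two_mul_div_pi_mul hK hh hh1)).1 isCompact_Icc
  exact ((continuous_wave_prod has h).comp (by fun_prop : Continuous fun η => (y, η))).continuousOn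

theorem Oph_add (hK : 10 ≤ K) (has : ContDiff ℝ ∞ a) (hac : HasCompactSupport a)
    (hasupp : tsupport a ⊆ Ioo x₀ x₁ ×ˢ Ioo (-(2 * K)) (2 * K)) {h : ℝ} (hh : 0 < h)
    (hh1 : h ≤ 1) (u v : Lp ℂ 2 (volume : Measure ℝ)) (y : ℝ) :
    Oph h a (u + v : Lp ℂ 2 (volume : Measure ℝ)) y = Oph h a u y + Oph h a v y := by
  simp only [Oph_eq_setIntegral_wave hh has hac hasupp]
  rw [← integral_add (integrableOn_wave_mul hK has hh hh1 _ y)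
    (integrableOn_wave_mul hK has hh hh1 _ y), FourierTransform.fourier_add]
  refine integral_congr_ae (ae_restrict_of_ae ?_)
  filter_upwards [Lp.coeFn_add (𝓕 u : Lp ℂ 2 (volume : Measure ℝ)) (𝓕 v)] with η hη
  rw [hη, Pi.add_apply, mul_add]

theorem Oph_smul (has : ContDiff ℝ ∞ a) (hac : HasCompactSupport a)
    (hasupp : tsupport a ⊆ Ioo x₀ x₁ ×ˢ Ioo (-(2 * K)) (2 * K)) {h : ℝ} (hh : 0 < h)
    (r : ℂ) (u : Lp ℂ 2 (volume : Measure ℝ)) (y : ℝ) :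
    Oph h a (r • u : Lp ℂ 2 (volume : Measure ℝ)) y = r * Oph h a u y := by
  simp only [Oph_eq_setIntegral_wave hh has hac hasupp]
  rw [← integral_const_mul, FourierTransform.fourier_smul]
  refine integral_congr_ae (ae_restrict_of_ae ?_)
  filter_upwards [Lp.coeFn_smul r (𝓕 u : Lp ℂ 2 (volume : Measure ℝ))] with η hη
  rw [hη, Pi.smul_apply, smul_eq_mul]
  ring

theorem jap_continuous : Continuous jap := jap_contDiff.continuous

theorem symbol_eq_zero (hasupp : tsupport a ⊆ Ioo x₀ x₁ ×ˢ Ioo (-(2 * K)) (2 * K)) {y : ℝ}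
    (hy : y ∉ Icc x₀ x₁) (ξ : ℝ) : a (y, ξ) = 0 :=
  image_eq_zero_of_notMem_tsupport fun hm => hy (Ioo_subset_Icc_self (hasupp hm).1)

theorem integrable_cpowR_jap_mul_Oph (hK : 10 ≤ K) (has : ContDiff ℝ ∞ a)
    (hac : HasCompactSupport a) (hasupp : tsupport a ⊆ Ioo x₀ x₁ ×ˢ Ioo (-(2 * K)) (2 * K))
    {h : ℝ} (hh : 0 < h) (hh1 : h ≤ 1) (w : ℂ) (u : Lp ℂ 2 (volume : Measure ℝ)) :
    Integrable fun y => cpowR (jap y) w * Oph h a u y := by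
  refine (integrableOn_iff_integrable_of_support_subset (s := Icc x₀ x₁) fun y hy => by
    by_contra hn
    exact hy (by simp only [Oph_eq_zero (fun y hy => symbol_eq_zero hasupp hy) _ hn, mul_zero])).mp ?_
  have h1 : IntegrableOn (fun y => Oph h a u y) (Icc x₀ x₁) := by
    simp only [Oph_eq_setIntegral_wave hh has hac hasupp]
    exact (integrable_mul_of_continuousOn isCompact_Icc isCompact_Icc
      (continuous_wave_prod has h).continuousOn
      (setIntegral_Icc_norm_le (one_le_two_mul_div_pi_mul hK hh hh1)).1).integral_prod_left
  refine IntegrableOn.continuousOn_mul ?_ h1 isCompact_Icc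
  exact fun y _ => (continuousAt_cpowR jap_continuous.continuousAt continuousAt_const
    (jap_pos y).ne').continuousWithinAt

theorem aestronglyMeasurable_parametrix {c α : ℂ} {χ : ℝ → ℝ} (hχ : Continuous χ) {g : ℝ → ℂ}
    (hg : AEStronglyMeasurable (fun z => cpowR (jap z) (α - 1) * g z) volume) :
    AEStronglyMeasurable (parametrix c α χ g) muP := by
  refine AEStronglyMeasurable.mono_ac (withDensity_absolutelyContinuous _ _) ?_
  refine AEStronglyMeasurable.mul ?_ ?_
  · refine Measurable.aestronglyMeasurable ?_
    have h1 := (measurable_cpowR (1 + α)).comp jap_continuous.measurable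
    have h2 := Complex.measurable_ofReal.comp hχ.measurable
    exact (h1.const_mul c).mul h2
  · have h1 : AEStronglyMeasurable (fun p : ℝ × ℝ => cpowR (p.1 - p.2) (-α - 1) *
        (cpowR (jap p.2) (α - 1) * g p.2)) (volume.prod volume) :=
      (((measurable_cpowR (-α - 1)).comp
        (measurable_fst.sub measurable_snd)).aestronglyMeasurable).mul hg.comp_snd
    exact h1.integral_prod_right'

theorem parametrix_add {c α : ℂ} {χ : ℝ → ℝ} {δ : ℝ} (hδ : 0 < δ)
    (h0 : ∀ y ∈ Ioo (x₀ - δ) (x₁ + δ), χ y = 0) {g g' : ℝ → ℂ}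
    (hg0 : ∀ z, z ∉ Icc x₀ x₁ → g z = 0) (hg0' : ∀ z, z ∉ Icc x₀ x₁ → g' z = 0)
    (hg : Integrable fun z => cpowR (jap z) (α - 1) * g z)
    (hg' : Integrable fun z => cpowR (jap z) (α - 1) * g' z) (y : ℝ) :
    parametrix c α χ (fun z => g z + g' z) y = parametrix c α χ g y + parametrix c α χ g' y := by
  by_cases hy : χ y = 0
  · simp [parametrix, hy]
  have hy' : ∀ z ∈ Icc x₀ x₁, y - z ≠ 0 := fun z hz he => hy (h0 y (by
    rw [sub_eq_zero.mp he]
    exact ⟨by linarith [hz.1], by linarith [hz.2]⟩))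
  have key : ∀ g : ℝ → ℂ, (∀ z, z ∉ Icc x₀ x₁ → g z = 0) →
      Integrable (fun z => cpowR (jap z) (α - 1) * g z) →
      Integrable fun z => cpowR (y - z) (-α - 1) * (cpowR (jap z) (α - 1) * g z) := by
    intro g hg0 hg
    refine (integrableOn_iff_integrable_of_support_subset (s := Icc x₀ x₁) fun z hz => by
      by_contra hn
      exact hz (by simp only [hg0 z hn, mul_zero])).mp ?_
    refine IntegrableOn.continuousOn_mul ?_ hg.integrableOn isCompact_Icc
    exact fun z hz => (continuousAt_cpowR (f := fun z => y - z) (by fun_prop) continuousAt_const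
      (hy' z hz)).continuousWithinAt
  rw [parametrix, parametrix, parametrix, ← mul_add, ← integral_add (key g hg0 hg) (key g' hg0' hg')]
  simp only [mul_add]

theorem parametrix_const_mul (c α : ℂ) (χ : ℝ → ℝ) (r : ℂ) (g : ℝ → ℂ) (y : ℝ) :
    parametrix c α χ (fun z => r * g z) y = r * parametrix c α χ g y := by
  simp only [parametrix, mul_left_comm _ r, integral_const_mul]

/-- The normalization constant of the parametrix of `B(s)`. -/
def parametrixConst (ν h : ℝ) : ℂ :=
  ((Real.sqrt (1 / (2 * π * h)) : ℝ) * cpowR 2 (2 * ν - 2 * I / h) *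
    (-(2 * π * I) / (2 * ν - 2 * I / h)))⁻¹

theorem re_exponent (ν h : ℝ) : (2 * ν - 2 * I / h : ℂ).re = 2 * ν := by
  rw [show (2 * ν - 2 * I / h : ℂ) = ((2 * ν : ℝ) : ℂ) + ((-2 / h : ℝ) : ℂ) * I by push_cast; ring]
  simp

theorem exponent_ne_zero (ν : ℝ) {h : ℝ} (hh : 0 < h) : (2 * ν - 2 * I / h : ℂ) ≠ 0 := by
  intro he
  have := congrArg Complex.im he
  rw [show (2 * ν - 2 * I / h : ℂ) = ((2 * ν : ℝ) : ℂ) + ((-2 / h : ℝ) : ℂ) * I by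
    push_cast; ring] at this
  simp at this
  exact hh.ne' this

theorem norm_parametrixConst_sq_le (hν : ν ∈ Icc (0 : ℝ) (1 / 2)) {h : ℝ} (hh : 0 < h)
    (hh1 : h ≤ 1) : ‖parametrixConst ν h‖ ^ 2 ≤ 9 / h := by
  have h1 := norm_exponent_le hν hh hh1
  have h2 : 1 ≤ ‖cpowR 2 (2 * ν - 2 * I / h)‖ := by
    rw [norm_cpowR, re_exponent, Real.one_le_exp_iff]
    exact mul_nonneg (by linarith [hν.1]) (Real.log_nonneg (by norm_num))
  have hp := Real.pi_gt_three
  rw [parametrixConst, norm_inv, norm_mul, norm_mul, norm_div, norm_neg, norm_mul, norm_mul, norm_I,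
    norm_real, norm_real, inv_pow, mul_pow, mul_pow, Real.norm_of_nonneg (Real.sqrt_nonneg _),
    Real.sq_sqrt (by positivity), Real.norm_of_nonneg Real.pi_pos.le, Complex.norm_ofNat, mul_one]
  have h3 : 0 < ‖(2 * ν - 2 * I / h : ℂ)‖ := norm_pos_iff.mpr (exponent_ne_zero ν hh)
  generalize ‖(2 * ν - 2 * I / h : ℂ)‖ = A at *
  generalize ‖cpowR 2 (2 * ν - 2 * I / h)‖ = B at *
  rw [inv_le_comm₀ (by positivity) (by positivity), inv_div]
  have h4 : (2 * π * h / 3) ≤ 2 * π / A := by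
    rw [div_le_div_iff₀ (by norm_num) h3]
    rw [le_div_iff₀ hh] at h1
    nlinarith [mul_le_mul_of_nonneg_left h1 (by positivity : 0 ≤ 2 * π)]
  calc h / 9 ≤ 1 / (2 * π * h) * 1 ^ 2 * (2 * π * h / 3) ^ 2 := by
        field_simp
        nlinarith
    _ ≤ _ := by gcongr

theorem exists_parametrix (hν : ν ∈ Icc (0 : ℝ) (1 / 2)) (hK : 10 ≤ K) (hI : x₀ ≤ x₁)
    (has : ContDiff ℝ ∞ a) (hac : HasCompactSupport a)
    (hasupp : tsupport a ⊆ Ioo x₀ x₁ ×ˢ Ioo (-(2 * K)) (2 * K))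
    {χ : ℝ → ℝ} (hχ : ContDiff ℝ ∞ χ) {A B : ℝ} (h1 : ∀ x, x ∉ Icc A B → χ x = 1)
    {δ : ℝ} (hδ : 0 < δ) (h0 : ∀ y ∈ Ioo (x₀ - δ) (x₁ + δ), χ y = 0) :
    ∃ C' > 0, ∃ Q : ℝ → (Lp ℂ 2 (volume : Measure ℝ) →L[ℂ] Lp ℂ 2 muP),
      ∀ h ∈ Ioc (0 : ℝ) 1, ‖Q h‖ ≤ C' ∧ ∀ u : Lp ℂ 2 (volume : Measure ℝ), Q h u =ᵐ[muP]
        parametrix (parametrixConst ν h) (2 * ν - 2 * I / h) χ (Oph h a u) := by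
  obtain ⟨C₁, hC₁, hgram⟩ := lintegral_enorm_gram_le (A := A) (B := B) ν (hχ.pow 2)
    (fun y => sq_nonneg (χ y)) (fun x hx => by simp [h1 x hx]) hδ
    (fun y hy => by simp [h0 y hy]) hI
  obtain ⟨C₂, hC₂, hOph⟩ := lintegral_Oph_sq_le has hac
  have hbound : ∀ h ∈ Ioc (0 : ℝ) 1, ∀ u : Lp ℂ 2 (volume : Measure ℝ),
      eLpNorm (parametrix (parametrixConst ν h) (2 * ν - 2 * I / h) χ (Oph h a u)) 2 muP ≤
        ENNReal.ofReal (Real.sqrt (18 * C₁ * C₂)) * eLpNorm u 2 volume := by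
    rintro h ⟨hh, hh1⟩ u
    refine eLpNorm_two_le_of_lintegral_sq_le ?_
    rw [lintegral_muP]
    simp only [enorm_parametrix_sq (re_exponent ν h)]
    rw [lintegral_const_mul' _ _ ENNReal.ofReal_ne_top]
    have hv0 : ∀ y, y ∉ Icc x₀ x₁ → cpowR (jap y) (2 * ν - 2 * I / h - 1) * Oph h a u y = 0 :=
      fun y hy => by rw [Oph_eq_zero (fun y hy => symbol_eq_zero hasupp hy) _ hy, mul_zero]
    have hvi := integrable_cpowR_jap_mul_Oph hK has hac hasupp hh hh1 (2 * ν - 2 * I / h - 1) u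
    calc _ ≤ ENNReal.ofReal (2 * ‖parametrixConst ν h‖ ^ 2) * (ENNReal.ofReal (C₁ * h) *
          ∫⁻ x, ‖cpowR (jap x) (2 * ν - 2 * I / h - 1) * Oph h a u x‖ₑ ^ 2) := by
          gcongr
          exact hgram h hh _ hv0 hvi
      _ ≤ ENNReal.ofReal (2 * (9 / h)) * (ENNReal.ofReal (C₁ * h) *
          (ENNReal.ofReal C₂ * ∫⁻ x, ‖u x‖ₑ ^ 2)) := by
          gcongr
          · exact norm_parametrixConst_sq_le hν hh hh1
          · refine le_trans (lintegral_mono fun x => ?_)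
              (hOph h hh u (Lp.aestronglyMeasurable u).aemeasurable)
            refine pow_le_pow_left₀ zero_le ?_ 2
            rw [enorm_mul]
            refine mul_le_of_le_one_left zero_le ?_
            rw [← ofReal_norm, ENNReal.ofReal_le_one]
            refine norm_cpowR_jap_le_one ?_ x
            rw [sub_re, re_exponent, one_re]
            linarith [hν.2]
      _ = _ := by
          rw [← mul_assoc, ← mul_assoc, ← ENNReal.ofReal_mul (by positivity),
            ← ENNReal.ofReal_mul (by positivity)]
          congr 2
          field_simp
          ring
  have hmem : ∀ h ∈ Ioc (0 : ℝ) 1, ∀ u : Lp ℂ 2 (volume : Measure ℝ),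
      MemLp (parametrix (parametrixConst ν h) (2 * ν - 2 * I / h) χ (Oph h a u)) 2 muP :=
    fun h hh u => ⟨aestronglyMeasurable_parametrix hχ.continuous
      (integrable_cpowR_jap_mul_Oph hK has hac hasupp hh.1 hh.2 _ u).aestronglyMeasurable,
      (hbound h hh u).trans_lt (ENNReal.mul_lt_top ENNReal.ofReal_lt_top (Lp.eLpNorm_lt_top u))⟩
  have hex : ∀ h : ℝ, ∃ Q : Lp ℂ 2 (volume : Measure ℝ) →L[ℂ] Lp ℂ 2 muP, h ∈ Ioc (0 : ℝ) 1 →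
      ‖Q‖ ≤ Real.sqrt (18 * C₁ * C₂) + 1 ∧ ∀ u : Lp ℂ 2 (volume : Measure ℝ), Q u =ᵐ[muP]
        parametrix (parametrixConst ν h) (2 * ν - 2 * I / h) χ (Oph h a u) := by
    intro h
    by_cases hh : h ∈ Ioc (0 : ℝ) 1
    swap
    · exact ⟨0, fun hn => absurd hn hh⟩
    have hz : ∀ u : Lp ℂ 2 (volume : Measure ℝ), ∀ y, y ∉ Icc x₀ x₁ → Oph h a u y = 0 :=
      fun u y hy => Oph_eq_zero (fun y hy => symbol_eq_zero hasupp hy) _ hy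
    let L : Lp ℂ 2 (volume : Measure ℝ) →ₗ[ℂ] Lp ℂ 2 muP :=
      { toFun := fun u => (hmem h hh u).toLp _
        map_add' := fun u v => by
          rw [← MemLp.toLp_add]
          refine MemLp.toLp_congr _ _ (Eventually.of_forall fun y => ?_)
          rw [Pi.add_apply, ← parametrix_add hδ h0 (hz u) (hz v)
            (integrable_cpowR_jap_mul_Oph hK has hac hasupp hh.1 hh.2 _ u)
            (integrable_cpowR_jap_mul_Oph hK has hac hasupp hh.1 hh.2 _ v)]
          congr 1
          exact funext fun y => Oph_add hK has hac hasupp hh.1 hh.2 u v y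
        map_smul' := fun r u => by
          rw [RingHom.id_apply, ← MemLp.toLp_const_smul]
          refine MemLp.toLp_congr _ _ (Eventually.of_forall fun y => ?_)
          rw [Pi.smul_apply, smul_eq_mul, ← parametrix_const_mul]
          congr 1
          exact funext fun y => Oph_smul has hac hasupp hh.1 r u y }
    refine ⟨L.mkContinuous (Real.sqrt (18 * C₁ * C₂)) fun u => ?_, fun _ => ⟨?_, fun u => ?_⟩⟩
    · change ‖(hmem h hh u).toLp _‖ ≤ _
      rw [Lp.norm_toLp, Lp.norm_def, ← ENNReal.toReal_ofReal (Real.sqrt_nonneg (18 * C₁ * C₂)),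
        ← ENNReal.toReal_mul]
      exact ENNReal.toReal_mono (ENNReal.mul_ne_top ENNReal.ofReal_ne_top (Lp.eLpNorm_ne_top u))
        (hbound h hh u)
    · exact (LinearMap.mkContinuous_norm_le _ (Real.sqrt_nonneg _) _).trans (by linarith)
    · exact (hmem h hh u).coeFn_toLp
  choose Q hQ using hex
  exact ⟨Real.sqrt (18 * C₁ * C₂) + 1, by positivity, Q, fun h hh => hQ h hh⟩

end Operator

theorem integral_muP (f : ℝ → ℂ) : ∫ y, f y ∂muP = ∫ y, ((2 / (1 + y ^ 2) : ℝ) : ℂ) * f y := by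
  rw [muP, integral_withDensity_eq_integral_toReal_smul (by fun_prop)
    (Eventually.of_forall fun _ => ENNReal.ofReal_lt_top)]
  refine integral_congr_ae (Eventually.of_forall fun y => ?_)
  simp only
  rw [ENNReal.toReal_ofReal (by positivity), real_smul]

theorem cpowR_dS {x y : ℝ} (hxy : y ≠ x) (w : ℂ) :
    cpowR (dS x y) w = cpowR 2 w * cpowR (y - x) w * (cpowR (jap x) (-w) * cpowR (jap y) (-w)) := by
  have hx := (jap_pos x).ne'
  have hy := (jap_pos y).ne'
  have h1 : |x - y| ≠ 0 := abs_ne_zero.mpr (sub_ne_zero.mpr hxy.symm)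
  rw [dS, div_eq_mul_inv, mul_inv, cpowR_mul (mul_ne_zero two_ne_zero h1)
    (mul_ne_zero (inv_ne_zero hx) (inv_ne_zero hy)), cpowR_mul two_ne_zero h1,
    cpowR_mul (inv_ne_zero hx) (inv_ne_zero hy), cpowR_abs, cpowR_inv, cpowR_inv,
    ← neg_sub y x, cpowR_neg_left]

theorem integral_cut_parametrix (c α : ℂ) (χ : ℝ → ℝ) (g : ℝ → ℂ) (x : ℝ) :
    ∫ y, cpowR (dS x y) (α - 1) * ((χ y : ℂ) * parametrix c α χ g y) ∂muP =
      c * cpowR 2 α * cpowR (jap x) (1 - α) *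
        ∫ y, ((χ y ^ 2 : ℝ) : ℂ) * (cpowR (y - x) (α - 1) *
          ∫ z : ℝ, cpowR (y - z) (-α - 1) * (cpowR (jap z) (α - 1) * g z)) := by
  rw [integral_muP, ← integral_const_mul]
  refine integral_congr_ae ?_
  filter_upwards [Measure.ae_ne volume x] with y hy
  rw [cpowR_dS hy, parametrix]
  generalize (∫ z : ℝ, cpowR (y - z) (-α - 1) * (cpowR (jap z) (α - 1) * g z)) = T
  have e1 : cpowR (jap y) (1 - α) * cpowR (jap y) (1 + α) = (1 + (y : ℂ) ^ 2) := by
    rw [← cpowR_add, show (1 - α + (1 + α)) = ((2 : ℕ) : ℂ) by push_cast; ring,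
      cpowR_natCast (jap_pos y), ← ofReal_pow, jap_sq]
    push_cast
    rfl
  have e2 : cpowR 2 α = cpowR 2 (α - 1) * 2 := by
    have := cpowR_natCast (t := 2) two_pos 1
    rw [← sub_add_cancel α 1, cpowR_add, sub_add_cancel]
    simp only [Nat.cast_one, pow_one] at this
    rw [this]
    norm_num
  have e3 : (1 + (y : ℂ) ^ 2) ≠ 0 := by exact_mod_cast (by positivity : (1 + y ^ 2 : ℝ) ≠ 0)
  rw [e2, neg_sub]
  calc _ = c * (cpowR 2 (α - 1) * 2) * cpowR (jap x) (1 - α) * ((χ y : ℂ) ^ 2 *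
        (cpowR (y - x) (α - 1) * T)) * ((1 + (y : ℂ) ^ 2)⁻¹ *
          (cpowR (jap y) (1 - α) * cpowR (jap y) (1 + α))) := by
        push_cast
        ring
    _ = _ := by
        rw [e1, inv_mul_cancel₀ e3, mul_one, ofReal_pow]

section Identity

variable {x₀ x₁ δ : ℝ} {Ω : ℝ → ℝ}

theorem integral_cut_conv_eq (hδ : 0 < δ) (h0 : ∀ y ∈ Ioo (x₀ - δ) (x₁ + δ), Ω y = 0) (α : ℂ)
    {v : ℝ → ℂ} (hv : ∀ y, y ∉ Icc x₀ x₁ → v y = 0) {x : ℝ} (hx : x ∈ Icc x₀ x₁) :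
    ∫ y, (Ω y : ℂ) * (cpowR (y - x) (α - 1) * ∫ z : ℝ, cpowR (y - z) (-α - 1) * v z) =
      ∫ t : ℝ, (recipCut Ω (x, t) : ℂ) * ∫ z : ℝ, cpowR (1 - t * (z - x)) (-α - 1) * v z := by
  refine (integral_recip _ x).trans (integral_congr_ae ?_)
  filter_upwards [Measure.ae_ne volume 0] with t ht
  by_cases hk : recipCut Ω (x, t) = 0
  · rw [← recipCut_of_ne (Ω := Ω) (x := x) ht, hk]
    simp
  · have hg := mem_goodSet_of_mem_tsupport hδ h0 hx (subset_tsupport _ hk)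
    rw [integral_cpowR_shift_recip hδ hv ht hg, ← recipCut_of_ne (Ω := Ω) (x := x) ht,
      add_sub_cancel_left]
    have ht' : (t : ℂ) ≠ 0 := by exact_mod_cast ht
    have e : cpowR t⁻¹ (α - 1) * cpowR t⁻¹ (-α - 1) = (t : ℂ) ^ 2 := by
      rw [← cpowR_add, cpowR_inv, show -(α - 1 + (-α - 1)) = 2 by ring, cpowR_two_right ht]
    calc _ = (recipCut Ω (x, t) : ℂ) * (∫ z : ℝ, cpowR (1 - t * (z - x)) (-α - 1) * v z) *
          (((t : ℂ) ^ 2)⁻¹ * (cpowR t⁻¹ (α - 1) * cpowR t⁻¹ (-α - 1))) := by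
          push_cast
          ring
      _ = _ := by rw [e, inv_mul_cancel₀ (pow_ne_zero 2 ht'), mul_one]

theorem sub_Bop_eq {χ : ℝ → ℝ} {ν : ℝ} (hδ : 0 < δ)
    (h0 : ∀ y ∈ Ioo (x₀ - δ) (x₁ + δ), χ y = 0) {h : ℝ} (hh : 0 < h) {g f : ℝ → ℂ}
    (hg : ∀ y, y ∉ Icc x₀ x₁ → g y = 0)
    (hf : f =ᵐ[muP] parametrix (parametrixConst ν h) (2 * ν - 2 * I / h) χ g) {x : ℝ}
    (hx : x ∈ Icc x₀ x₁) :
    g x - Bop (1 / 2 - ν + I / h) (fun y => (χ y : ℂ) * f y) x =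
      cpowR (jap x) (1 - (2 * ν - 2 * I / h)) * (2 * π * I)⁻¹ *
        ((2 * ν - 2 * I / h : ℂ) * (∫ t : ℝ, (recipCut (fun y => χ y ^ 2) (x, t) : ℂ) * ∫ y : ℝ,
          cpowR (1 - t * (y - x)) (-(2 * ν - 2 * I / h : ℂ) - 1) *
            (cpowR (jap y) (2 * ν - 2 * I / h - 1) * g y))
        + 2 * π * I * (cpowR (jap x) (2 * ν - 2 * I / h - 1) * g x)) := by
  have him : |(1 / 2 - ν + I / h : ℂ).im| / (2 * π) = 1 / (2 * π * h) := by
    rw [show (1 / 2 - ν + I / h : ℂ) = ((1 / 2 - ν : ℝ) : ℂ) + ((1 / h : ℝ) : ℂ) * I by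
      push_cast; ring]
    simp only [add_im, ofReal_im, mul_im, ofReal_re, I_im, mul_one, I_re, mul_zero, add_zero,
      zero_add]
    rw [abs_of_pos (by positivity)]
    field_simp
  have hα := exponent_ne_zero ν hh
  rw [Bop, him, show (-2 * (1 / 2 - ν + I / h) : ℂ) = 2 * ν - 2 * I / h - 1 by ring,
    integral_congr_ae (g := fun y => cpowR (dS x y) (2 * ν - 2 * I / h - 1) * ((χ y : ℂ) *
      parametrix (parametrixConst ν h) (2 * ν - 2 * I / h) χ g y)) (by
        filter_upwards [hf] with y hy
        rw [hy]), integral_cut_parametrix, parametrixConst]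
  generalize (2 * ν - 2 * I / h : ℂ) = α at hα ⊢
  rw [integral_cut_conv_eq (Ω := fun y => χ y ^ 2) hδ (fun y hy => by simp [h0 y hy]) α
    (fun y hy => by rw [hg y hy, mul_zero]) hx]
  generalize (∫ t : ℝ, (recipCut (fun y => χ y ^ 2) (x, t) : ℂ) * ∫ z : ℝ,
    cpowR (1 - t * (z - x)) (-α - 1) * (cpowR (jap z) (α - 1) * g z)) = D
  have e1 : cpowR (jap x) (1 - α) * cpowR (jap x) (α - 1) = 1 := by
    rw [← cpowR_add, show 1 - α + (α - 1) = 0 by ring, cpowR_zero]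
  have e2 : ((Real.sqrt (1 / (2 * π * h)) : ℝ) : ℂ) ≠ 0 := by
    exact_mod_cast (Real.sqrt_pos.mpr (by positivity)).ne'
  have e3 : cpowR 2 α ≠ 0 := Complex.exp_ne_zero _
  have e4 : (π : ℂ) ≠ 0 := by exact_mod_cast Real.pi_ne_zero
  have e5 := I_ne_zero
  generalize cpowR (jap x) (1 - α) = P at e1 ⊢
  generalize cpowR (jap x) (α - 1) = P' at e1 ⊢
  generalize cpowR 2 α = R at e3 ⊢
  generalize ((Real.sqrt (1 / (2 * π * h)) : ℝ) : ℂ) = S at e2 ⊢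
  field_simp
  linear_combination (-(2 * π * I * g x)) * e1

end Identity

theorem jap_le (x : ℝ) : jap x ≤ 1 + |x| :=
  Real.sqrt_le_iff.mpr ⟨by positivity, by nlinarith [abs_nonneg x, sq_abs x]⟩

theorem norm_cpowR_jap_le {w : ℂ} (hw : w.re ≤ 1) (x : ℝ) : ‖cpowR (jap x) w‖ ≤ jap x := by
  rw [norm_cpowR]
  nth_rw 2 [← Real.exp_log (jap_pos x)]
  exact Real.exp_le_exp.mpr
    (mul_le_of_le_one_left (Real.log_nonneg (one_le_jap x)) hw)

theorem eLpNorm_two_le_of_forall_mem_Icc {F : ℝ → ℂ} {x₀ x₁ C : ℝ} (hI : x₁ - x₀ ≤ 1)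
    (hF0 : ∀ x, x ∉ Icc x₀ x₁ → F x = 0) (hF : ∀ x ∈ Icc x₀ x₁, ‖F x‖ ≤ C) :
    eLpNorm F 2 volume ≤ ENNReal.ofReal C := by
  rw [← eLpNorm_restrict_eq_of_support_subset (s := Icc x₀ x₁) fun x hx => by
    by_contra hn
    exact hx (hF0 x hn)]
  refine (eLpNorm_le_of_ae_bound (C := C) ?_).trans ?_
  · filter_upwards [ae_restrict_mem measurableSet_Icc] with x hx using hF x hx
  · refine mul_le_of_le_one_left zero_le ?_
    rw [Measure.restrict_apply_univ, Real.volume_Icc]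
    refine ENNReal.rpow_le_one ?_ (by positivity)
    rwa [ENNReal.ofReal_le_one]

end Parametrix

/-- Partial invertibility of `B(s)`: for a symbol `a` supported in
`{x ∈ I°, |ξ| < 2K}` with `10K|I| ≤ 1`, there is a uniformly bounded family of operators
`Q_h : L²(ℝ,dx) → L²(ℝ,dP)` with `Op_h(a) = ψ_I B(s) ω_I Q_h + O(h^∞)`. -/
theorem stmt10 (ν K x₀ x₁ : ℝ) (hν : ν ∈ Set.Icc (0 : ℝ) (1 / 2)) (hK : 10 ≤ K)
    (hI : x₀ ≤ x₁) (hKI : 10 * K * (x₁ - x₀) ≤ 1)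
    (a : ℝ × ℝ → ℂ) (has : ContDiff ℝ (⊤ : ℕ∞) a) (hac : HasCompactSupport a)
    (hasupp : tsupport a ⊆ Set.Ioo x₀ x₁ ×ˢ Set.Ioo (-(2 * K)) (2 * K))
    (ψ ω : ℝ → ℝ) (hψs : ContDiff ℝ (⊤ : ℕ∞) ψ) (hψsupp : tsupport ψ ⊆ Set.Ioo x₀ x₁)
    (hψ1 : ∃ U : Set ℝ, IsOpen U ∧ (∀ p ∈ tsupport a, (p : ℝ × ℝ).1 ∈ U) ∧ Set.EqOn ψ 1 U)
    (hωs : ContDiff ℝ (⊤ : ℕ∞) ω)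
    (hω0 : ∃ V : Set ℝ, IsOpen V ∧ Set.Icc x₀ x₁ ⊆ V ∧ Set.EqOn ω 0 V)
    (hω1 : ∀ x, x ∉ Set.Icc (x₀ - 1 / (10 * K)) (x₁ + 1 / (10 * K)) → ω x = 1) :
    ∃ C' > 0, ∃ CN : ℕ → ℝ, ∃ Q : ℝ → (Lp ℂ 2 (volume : Measure ℝ) →L[ℂ] Lp ℂ 2 muP),
      (∀ h ∈ Set.Ioc (0 : ℝ) 1, ‖Q h‖ ≤ C') ∧
      ∀ N : ℕ, ∀ h ∈ Set.Ioc (0 : ℝ) 1, ∀ u : Lp ℂ 2 (volume : Measure ℝ),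
        eLpNorm (fun x => Oph h a (⇑u) x - (ψ x : ℂ) *
            Bop (1 / 2 - ν + I / h) (fun y => (ω y : ℂ) * (⇑(Q h u) : ℝ → ℂ) y) x) 2
            (volume : Measure ℝ)
          ≤ ENNReal.ofReal (CN N * h ^ (N : ℝ) * ‖u‖) := by
  obtain ⟨V, hVo, hIV, hV⟩ := hω0
  obtain ⟨δ, hδ, hδV⟩ := isCompact_Icc.exists_thickening_subset_open hVo hIV
  have h0 : ∀ y ∈ Ioo (x₀ - δ) (x₁ + δ), ω y = 0 := fun y hy => hV (hδV (by
    rw [mem_thickening_iff]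
    refine ⟨max x₀ (min y x₁), ⟨le_max_left _ _, max_le hI (min_le_right _ _)⟩, ?_⟩
    rw [Real.dist_eq, abs_lt]
    rcases le_total y x₁ with h1 | h1
    · rw [min_eq_left h1]
      rcases le_total x₀ y with h2 | h2
      · rw [max_eq_right h2]; constructor <;> linarith
      · rw [max_eq_left h2]; constructor <;> linarith [hy.1]
    · rw [min_eq_right h1, max_eq_right hI]; constructor <;> linarith [hy.2]))
  obtain ⟨U, -, haU, hψU⟩ := hψ1
  obtain ⟨C', hC', Q, hQ⟩ := exists_parametrix hν hK hI has hac hasupp hωs hω1 hδ h0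
  have herr := norm_Oph_error_le hν hK hKI has hac hasupp (hωs.pow 2)
    (fun x hx => by simp [hω1 x hx]) hδ (fun y hy => by simp [h0 y hy])
  choose CN hCN0 hCN using herr
  obtain ⟨M, hM⟩ := (hψs.continuous.bounded_above_of_compact_support
    (HasCompactSupport.intro' isCompact_Icc isClosed_Icc (fun x hx =>
      image_eq_zero_of_notMem_tsupport fun h => hx (Ioo_subset_Icc_self (hψsupp h)))))
  have hM0 : 0 ≤ M := (norm_nonneg _).trans (hM 0)
  refine ⟨C', hC', fun N => M * ((1 + |x₀| + |x₁|) * CN N), Q, fun h hh => (hQ h hh).1,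
    fun N h hh u => ?_⟩
  have hψO : ∀ x, (ψ x : ℂ) * Oph h a u x = Oph h a u x := by
    intro x
    by_cases hx : x ∈ U
    · rw [hψU hx]; simp
    · have : ∀ ξ, a (x, ξ) = 0 := fun ξ => image_eq_zero_of_notMem_tsupport fun hm => hx (haU _ hm)
      simp [Oph, this]
  have hF : ∀ x, Oph h a u x - (ψ x : ℂ) *
      Bop (1 / 2 - ν + I / h) (fun y => (ω y : ℂ) * (⇑(Q h u) : ℝ → ℂ) y) x = (ψ x : ℂ) *
      (Oph h a u x - Bop (1 / 2 - ν + I / h) (fun y => (ω y : ℂ) * (⇑(Q h u) : ℝ → ℂ) y) x) :=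
    fun x => by rw [mul_sub, hψO]
  refine eLpNorm_two_le_of_forall_mem_Icc (x₀ := x₀) (x₁ := x₁) (by nlinarith) ?_ ?_
  · intro x hx
    rw [hF, image_eq_zero_of_notMem_tsupport fun hm => hx (Ioo_subset_Icc_self (hψsupp hm))]
    simp
  · intro x hx
    have hjap : jap x ≤ 1 + |x₀| + |x₁| := by
      refine (jap_le x).trans ?_
      have : |x| ≤ |x₀| + |x₁| := abs_le.mpr
        ⟨by linarith [hx.1, neg_abs_le x₀, abs_nonneg x₁],
          by linarith [hx.2, le_abs_self x₁, abs_nonneg x₀]⟩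
      linarith
    have hP : ‖cpowR (jap x) (1 - (2 * ν - 2 * I / h))‖ ≤ 1 + |x₀| + |x₁| := by
      refine (norm_cpowR_jap_le ?_ x).trans hjap
      rw [sub_re, re_exponent, one_re]
      linarith [hν.1]
    have h2π : ‖(2 * π * I : ℂ)⁻¹‖ ≤ 1 := by
      rw [norm_inv, norm_mul, norm_mul, norm_I, norm_real, Real.norm_of_nonneg Real.pi_pos.le,
        Complex.norm_ofNat, mul_one]
      exact inv_le_one_of_one_le₀ (by linarith [Real.pi_gt_three])
    rw [hF, sub_Bop_eq hδ h0 hh.1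
      (fun y hy => Oph_eq_zero (fun y hy => symbol_eq_zero hasupp hy) _ hy) ((hQ h hh).2 u) hx,
      norm_mul, norm_mul, norm_mul, norm_real, Real.rpow_natCast]
    calc _ ≤ M * ((1 + |x₀| + |x₁|) * 1 * (CN N * h ^ N * ‖u‖)) := by
          gcongr
          · exact hM x
          · exact hCN N h hh.1 hh.2 u x hx
      _ = _ := by ring
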